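/- Assume additionally m ≥ 2, and let s, s′ be distinct rational numbers in I_1(r;n) ∪ I_2(r;n) such that u_s is conjugate in Heck(r;n) to u_{s′} or to u_{s′}^{−1}. Then neither s nor s′ belongs to I_1(r) ∪ I_2(r). -/

import Mathlib

/- Formalization of statements from "Homotopically equivalent simple loops on
2-bridge spheres in Heckoid orbifolds for 2-bridge links (II)" by Lee-Sakuma.

We work in the free group `F` on two generators `a = gen 0`, `b = gen 1`.
For a rational `s` (in lowest terms `q/p`, with `0 ≤ s ≤ 1`), `uWord s` is the
word `u_s = a b^{ε₁} a^{ε₂} ⋯ b^{ε_{2p-1}}` with `ε_i = (-1)^⌊i·s⌋`.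
`CS s` is (a linear representative of) the cyclic sequence of lengths of
maximal constant-sign runs of exponents of `u_s`; since `u_s` begins with a
positive letter and (for `0 < s ≤ 1`) ends with a negative letter, the linear
run-length sequence represents the cyclic one.  `CyclicContains L T` says the
cyclic sequence represented by `L` contains `T` as a block of consecutive
terms.  `cfQ [m₁,…,m_k]` is the continued fraction `1/(m₁+1/(m₂+⋯+1/m_k))`.
`memI1 M n s` / `memI2 M n s` express `s ∈ I₁(r;n)` / `s ∈ I₂(r;n)` where
`r = cfQ M`, and `memI1hat` / `memI2hat` express `s ∈ I₁(r)` / `s ∈ I₂(r)`.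
The Heckoid group `Heck(r;n) = ⟨a,b | u_r^n⟩` is the quotient of `F` by the
normal closure `heckN r n` of `u_r^n`, with quotient map `heckQ r n`. -/

namespace Heckoid

abbrev F : Type := FreeGroup (Fin 2)

/-- The generators: `gen 0 = a`, `gen 1 = b` (and `gen i` depends on parity). -/
def gen (i : ℕ) : F := FreeGroup.of ⟨i % 2, Nat.mod_lt _ (by norm_num)⟩

/-- The word `u_s = a b^{ε₁} a^{ε₂} b^{ε₃} ⋯ a^{ε_{2p-2}} b^{ε_{2p-1}}`,
where `s = q/p` in lowest terms and `ε_i = (-1)^⌊iq/p⌋`. -/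
def uWord (s : ℚ) : F :=
  ((List.range (2 * s.den)).map
    (fun i => gen i ^ ((-1 : ℤ) ^ (⌊(i : ℚ) * s⌋.toNat)))).prod

/-- The sequence of exponent signs `ε₀, ε₁, …, ε_{2p-1}` of `u_s`. -/
def signList (s : ℚ) : List ℤ :=
  (List.range (2 * s.den)).map (fun i => (-1 : ℤ) ^ (⌊(i : ℚ) * s⌋.toNat))

/-- Lengths of the maximal runs of equal consecutive entries. -/
def runLengths {α : Type} [BEq α] (l : List α) : List ℕ :=
  (l.splitBy (· == ·)).map List.length

/-- `CS s = CS(u_s)`: the cyclic sequence of lengths of maximal constant-sign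
runs of `u_s`, represented by a list. -/
def CS (s : ℚ) : List ℕ := runLengths (signList s)

/-- The cyclic sequence represented by `L` contains `T` as a block of
consecutive terms. -/
def CyclicContains (L T : List ℕ) : Prop := ∃ k, T <+: L.rotate k

/-- The continued fraction `[m₁, m₂, …, m_k] = 1/(m₁+1/(m₂+⋯+1/m_k))`. -/
def cfQ : List ℕ → ℚ
  | [] => 0
  | a :: l => 1 / ((a : ℚ) + cfQ l)

/-- `d⟨T, T'⟩`: `d` consecutive repetitions of the concatenation of `T` and `T'`. -/
def rep2 (d : ℕ) (T T' : List ℕ) : List ℕ := (List.replicate d (T ++ T')).flatten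

/-- `s ∈ I₁(r;n)` where `r = cfQ M`:  `[0, [m₁,…,m_{k-1},m_k-1,2]]` for `k` even,
`[0, [m₁,…,m_k,2n-2])` for `k` odd. -/
def memI1 (M : List ℕ) (n : ℕ) (s : ℚ) : Prop :=
  if Even M.length then 0 ≤ s ∧ s ≤ cfQ (M.dropLast ++ [M.getLast! - 1, 2])
  else 0 ≤ s ∧ s < cfQ (M ++ [2 * n - 2])

/-- `s ∈ I₂(r;n)` where `r = cfQ M`: `([m₁,…,m_k,2n-2], 1]` for `k` even,
`[[m₁,…,m_{k-1},m_k-1,2], 1]` for `k` odd. -/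
def memI2 (M : List ℕ) (n : ℕ) (s : ℚ) : Prop :=
  if Even M.length then cfQ (M ++ [2 * n - 2]) < s ∧ s ≤ 1
  else cfQ (M.dropLast ++ [M.getLast! - 1, 2]) ≤ s ∧ s ≤ 1

/-- `s ∈ I₁(r)` where `r = cfQ M`. -/
def memI1hat (M : List ℕ) (s : ℚ) : Prop :=
  if Even M.length then 0 ≤ s ∧ s ≤ cfQ (M.dropLast ++ [M.getLast! - 1])
  else 0 ≤ s ∧ s ≤ cfQ M.dropLast

/-- `s ∈ I₂(r)` where `r = cfQ M`. -/
def memI2hat (M : List ℕ) (s : ℚ) : Prop :=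
  if Even M.length then cfQ M.dropLast ≤ s ∧ s ≤ 1
  else cfQ (M.dropLast ++ [M.getLast! - 1]) ≤ s ∧ s ≤ 1

/-- The normal closure of `u_r^n`, so that `Heck(r;n) = F ⧸ heckN r n`. -/
abbrev heckN (r : ℚ) (n : ℕ) : Subgroup F := Subgroup.normalClosure {uWord r ^ n}

/-- The quotient map `F → Heck(r;n) = ⟨a, b | u_r^n⟩`. -/
def heckQ (r : ℚ) (n : ℕ) : F →* F ⧸ heckN r n := QuotientGroup.mk' (heckN r n)

section
open Equiv Function
set_option linter.unusedSectionVars false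

/-! ### Orbits of permutations -/

section Orbits
variable {D : Type} [Fintype D] [DecidableEq D]

/-- The number of cycles (fixed points included) of a permutation. -/
noncomputable def orb (π : Perm D) : ℕ := Nat.card (Quotient (Perm.SameCycle.setoid π))

theorem eq_of_sameCycle {X : Type} {π : Perm D} {f : D → X} (hf : ∀ d, f (π d) = f d) {u v : D}
    (h : π.SameCycle u v) : f u = f v := by
  obtain ⟨k, rfl⟩ := h.exists_nat_pow_eq
  clear h
  induction k with
  | zero => rfl
  | succ k ih => rw [pow_succ', Perm.mul_apply, hf, ih]

theorem card_range_le_orb {X : Type} (π : Perm D) (f : D → X) (hf : ∀ d, f (π d) = f d) :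
    Nat.card (Set.range f) ≤ orb π := by
  have : Finite (Quotient (Perm.SameCycle.setoid π)) := Quotient.finite _
  let g : Quotient (Perm.SameCycle.setoid π) → Set.range f :=
    Quotient.lift (fun d => ⟨f d, d, rfl⟩) (fun a b h => Subtype.ext (eq_of_sameCycle hf h))
  refine Nat.card_le_card_of_surjective g ?_
  rintro ⟨_, d, rfl⟩
  exact ⟨Quotient.mk _ d, rfl⟩

theorem sameCycle_apply (π : Perm D) (d : D) : π.SameCycle d (π d) :=
  Perm.sameCycle_apply_right.2 (Perm.SameCycle.refl _ _)

theorem orb_le_orb_mul_swap_succ (π : Perm D) (x y : D) : orb π ≤ orb (π * swap x y) + 1 := by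
  classical
  have : Finite (Quotient (Perm.SameCycle.setoid π)) := Quotient.finite _
  let Q := Quotient (Perm.SameCycle.setoid π)
  let c : D → Q := Quotient.mk _
  let f : D → Q := fun d => if c d = c y then c x else c d
  have hc : ∀ d, c (π d) = c d := fun d => Quotient.sound (sameCycle_apply π d).symm
  have hf : ∀ d, f ((π * swap x y) d) = f d := by
    intro d
    simp only [f, Perm.mul_apply, hc]
    rcases eq_or_ne d x with rfl | hx
    · simp
    rcases eq_or_ne d y with rfl | hy
    · simp
    rw [swap_apply_of_ne_of_ne hx hy]
  have h1 := card_range_le_orb _ f hf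
  have h2 : Nat.card Q ≤ Nat.card (Set.range f) + 1 := by
    let g : Option (Set.range f) → Q := fun o => o.elim (c y) (fun z => z.1)
    have : Function.Surjective g := by
      intro z
      obtain ⟨d, rfl⟩ := Quotient.exists_rep z
      by_cases h : c d = c y
      · exact ⟨none, h.symm⟩
      · exact ⟨some ⟨f d, d, rfl⟩, by simp [g, f, h, c]⟩
    have := Nat.card_le_card_of_surjective g this
    rwa [Finite.card_option] at this
  exact h2.trans (by omega)

theorem orb_succ_le_of_sameCycle {π : Perm D} {x y : D} (hxy : x ≠ y) (h : π.SameCycle x y) :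
    orb π + 1 ≤ orb (π * swap x y) := by
  classical
  have hfin : Finite (Quotient (Perm.SameCycle.setoid π)) := Quotient.finite _
  have hex : ∃ k, (π ^ k) x = y := h.exists_nat_pow_eq
  let k := Nat.find hex
  have hk : (π ^ k) x = y := Nat.find_spec hex
  have hmin : ∀ j, j < k → (π ^ j) x ≠ y := fun j hj => Nat.find_min hex hj
  have hper : ∀ j, 0 < j → j ≤ k → (π ^ j) x ≠ x := by
    intro j hj hjk hx
    refine hmin (k - j) (by omega) ?_
    rw [← hk]
    nth_rewrite 2 [show k = (k - j) + j by omega]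
    rw [pow_add, Perm.mul_apply, hx]
  have hk0 : 0 < k := by
    rcases Nat.eq_zero_or_pos k with h0 | h0
    · rw [h0] at hk; exact absurd hk hxy
    · exact h0
  let S : Set D := {d | ∃ i, 0 < i ∧ i ≤ k ∧ (π ^ i) x = d}
  have hyS : y ∈ S := ⟨k, hk0, le_rfl, hk⟩
  have hxS : x ∉ S := fun ⟨i, h0, h1, h2⟩ => hper i h0 h1 h2
  have hmaps : Set.MapsTo (π * swap x y) S S := by
    rintro d ⟨i, h0, h1, rfl⟩
    rcases h1.lt_or_eq with h1 | h1
    · refine ⟨i + 1, by omega, by omega, ?_⟩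
      rw [Perm.mul_apply, swap_apply_of_ne_of_ne (hper i h0 h1.le) (hmin i h1), pow_succ',
        Perm.mul_apply]
    · refine ⟨1, by omega, by omega, ?_⟩
      rw [h1, hk, Perm.mul_apply, swap_apply_right, pow_one]
  have hiff : ∀ d, (π * swap x y) d ∈ S ↔ d ∈ S := by
    intro d
    refine ⟨fun hd => ?_, fun hd => hmaps hd⟩
    have := Perm.perm_symm_mapsTo_of_mapsTo (π * swap x y) hmaps hd
    rwa [symm_apply_apply] at this
  let c : D → Quotient (Perm.SameCycle.setoid π) := Quotient.mk _
  have hc : ∀ d, c (π d) = c d := fun d => Quotient.sound (sameCycle_apply π d).symm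
  have hcx : c x = c y := Quotient.sound h
  let f : D → Quotient (Perm.SameCycle.setoid π) × Prop := fun d => (c d, d ∈ S)
  have hf : ∀ d, f ((π * swap x y) d) = f d := by
    intro d
    refine Prod.ext ?_ (propext (hiff d))
    simp only [f, Perm.mul_apply, hc]
    rcases eq_or_ne d x with rfl | hx
    · simp [hcx]
    rcases eq_or_ne d y with rfl | hy
    · simp [hcx]
    rw [swap_apply_of_ne_of_ne hx hy]
  refine le_trans ?_ (card_range_le_orb _ f hf)
  let g : Set.range f → Quotient (Perm.SameCycle.setoid π) := fun z => z.1.1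
  have hg : Function.Surjective g := by
    intro z
    obtain ⟨d, rfl⟩ := Quotient.exists_rep z
    exact ⟨⟨f d, d, rfl⟩, rfl⟩
  by_contra hcon
  have hle := Nat.card_le_card_of_surjective g hg
  have heq : Nat.card (Set.range f) = Nat.card (Quotient (Perm.SameCycle.setoid π)) := by
    unfold orb at hcon
    omega
  have hb := (Nat.bijective_iff_surjective_and_card g).2 ⟨hg, heq⟩
  have := @hb.1 ⟨f x, x, rfl⟩ ⟨f y, y, rfl⟩ hcx
  have h2 : (x ∈ S) = (y ∈ S) := congrArg (fun z : Set.range f => z.1.2) this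
  exact hxS (h2 ▸ hyS)

theorem sameCycle_mul_swap {π : Perm D} {x y : D} (h : ¬ π.SameCycle x y) :
    (π * swap x y).SameCycle x y := by
  have hpos : ∃ k, 0 < k ∧ (π ^ k) y = y := ⟨orderOf π, orderOf_pos π, by simp [pow_orderOf_eq_one]⟩
  classical
  let k := Nat.find hpos
  obtain ⟨hk0, hk⟩ : 0 < k ∧ (π ^ k) y = y := Nat.find_spec hpos
  have hmin : ∀ j, 0 < j → j < k → (π ^ j) y ≠ y := fun j h0 hj hy =>
    Nat.find_min hpos hj ⟨h0, hy⟩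
  have hx : ∀ j, (π ^ j) y ≠ x := fun j hj => h (Perm.SameCycle.symm ⟨j, by simpa using hj⟩)
  have key : ∀ j, 0 < j → j ≤ k → ((π * swap x y) ^ j) x = (π ^ j) y := by
    intro j h0 hj
    induction j with
    | zero => omega
    | succ j ih =>
      rcases Nat.eq_zero_or_pos j with rfl | hj0
      · simp
      · rw [pow_succ', Perm.mul_apply, ih hj0 (by omega), Perm.mul_apply,
          swap_apply_of_ne_of_ne (hx j) (hmin j hj0 (by omega)), pow_succ', Perm.mul_apply]
  exact ⟨k, by simpa [hk] using key k hk0 le_rfl⟩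

end Orbits

/-! ### Planar combinatorial maps -/

section Maps
variable {D : Type} [Fintype D] [DecidableEq D]

/-- Being in the same connected component of the combinatorial map `(φ, α)`. -/
def Rel (φ α : Perm D) (u v : D) : Prop :=
  ∀ f : D → Prop, (∀ d, f (φ d) ↔ f d) → (∀ d, f (α d) ↔ f d) → (f u ↔ f v)

theorem Rel.refl (φ α : Perm D) (u : D) : Rel φ α u u := fun _ _ _ => Iff.rfl
theorem Rel.symm {φ α : Perm D} {u v : D} (h : Rel φ α u v) : Rel φ α v u :=
  fun f h1 h2 => (h f h1 h2).symm
theorem Rel.trans {φ α : Perm D} {u v w : D} (h : Rel φ α u v) (h' : Rel φ α v w) :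
    Rel φ α u w := fun f h1 h2 => (h f h1 h2).trans (h' f h1 h2)
theorem Rel.face (φ α : Perm D) (d : D) : Rel φ α d (φ d) := fun _ h1 _ => (h1 d).symm
theorem Rel.edge (φ α : Perm D) (d : D) : Rel φ α d (α d) := fun _ _ h2 => (h2 d).symm

theorem Rel.of_sameCycle_vertex {φ α : Perm D} {u v : D} (h : (φ * α).SameCycle u v) :
    Rel φ α u v := by
  intro f h1 h2
  exact (eq_of_sameCycle (f := f) (fun d => propext (by rw [Perm.mul_apply, h1, h2])) h) ▸ Iff.rfl

theorem Rel.of_sameCycle_face {φ α : Perm D} {u v : D} (h : φ.SameCycle u v) :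
    Rel φ α u v := by
  intro f h1 h2
  exact (eq_of_sameCycle (f := f) (fun d => propext (h1 d)) h) ▸ Iff.rfl

/-- Each component of `(φ, α)` is a sphere, phrased as an Euler characteristic bound. -/
def Planar (φ α : Perm D) : Prop :=
  ∃ K : Finset D, (∀ d, ∃ k ∈ K, Rel φ α d k) ∧
    4 * K.card + Fintype.card D ≤ 2 * (orb φ + orb (φ * α))

theorem Rel.of_steps {φ α φ' α' : Perm D} {x y : D}
    (h1 : ∀ d, Rel φ' α' d (φ d) ∨
      ((Rel φ' α' d x ∨ Rel φ' α' d y) ∧ (Rel φ' α' (φ d) x ∨ Rel φ' α' (φ d) y)))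
    (h2 : ∀ d, Rel φ' α' d (α d) ∨
      ((Rel φ' α' d x ∨ Rel φ' α' d y) ∧ (Rel φ' α' (α d) x ∨ Rel φ' α' (α d) y)))
    {u v : D} (h : Rel φ α u v) :
    Rel φ' α' u v ∨ ((Rel φ' α' u x ∨ Rel φ' α' u y) ∧ (Rel φ' α' v x ∨ Rel φ' α' v y)) := by
  have aux : ∀ a b, (Rel φ' α' a b ∨
      ((Rel φ' α' a x ∨ Rel φ' α' a y) ∧ (Rel φ' α' b x ∨ Rel φ' α' b y))) →
      (Rel φ' α' u a ∨ ((Rel φ' α' u x ∨ Rel φ' α' u y) ∧ (Rel φ' α' a x ∨ Rel φ' α' a y))) →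
      (Rel φ' α' u b ∨ ((Rel φ' α' u x ∨ Rel φ' α' u y) ∧ (Rel φ' α' b x ∨ Rel φ' α' b y))) := by
    rintro a b (hab | ⟨ha, hb⟩) (hua | ⟨hu, ha'⟩)
    · exact .inl (hua.trans hab)
    · exact .inr ⟨hu, ha'.imp hab.symm.trans hab.symm.trans⟩
    · exact .inr ⟨ha.imp hua.trans hua.trans, hb⟩
    · exact .inr ⟨hu, hb⟩
  have sw : ∀ a b, (Rel φ' α' a b ∨
      ((Rel φ' α' a x ∨ Rel φ' α' a y) ∧ (Rel φ' α' b x ∨ Rel φ' α' b y))) → (Rel φ' α' b a ∨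
      ((Rel φ' α' b x ∨ Rel φ' α' b y) ∧ (Rel φ' α' a x ∨ Rel φ' α' a y))) :=
    fun a b h => h.imp Rel.symm And.symm
  refine (h (fun w => Rel φ' α' u w ∨
    ((Rel φ' α' u x ∨ Rel φ' α' u y) ∧ (Rel φ' α' w x ∨ Rel φ' α' w y))) ?_ ?_).1 (.inl (.refl _ _ _))
  · exact fun d => ⟨aux _ _ (sw _ _ (h1 d)), aux _ _ (h1 d)⟩
  · exact fun d => ⟨aux _ _ (sw _ _ (h2 d)), aux _ _ (h2 d)⟩

section Cover
variable {R R' : D → D → Prop} {x y : D} {K : Finset D}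

theorem exists_cover_succ (hs : ∀ u v, R' u v → R' v u) (ht : ∀ u v w, R' u v → R' v w → R' u w)
    (h : ∀ u v, R u v → R' u v ∨ ((R' u x ∨ R' u y) ∧ (R' v x ∨ R' v y)))
    (hK : ∀ d, ∃ k ∈ K, R d k) :
    ∃ K' : Finset D, (∀ d, ∃ k ∈ K', R' d k) ∧ K'.card ≤ K.card + 1 := by
  by_cases hx : ∃ k ∈ K, R' k x
  · refine ⟨insert y K, fun d => ?_, Finset.card_insert_le _ _⟩
    obtain ⟨k, hk, hd⟩ := hK d
    obtain ⟨k', hk', hx⟩ := hx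
    rcases h d k hd with h1 | ⟨h1 | h1, -⟩
    · exact ⟨k, by simp [hk], h1⟩
    · exact ⟨k', by simp [hk'], ht _ _ _ h1 (hs _ _ hx)⟩
    · exact ⟨y, by simp, h1⟩
  · refine ⟨insert x K, fun d => ?_, Finset.card_insert_le _ _⟩
    obtain ⟨k, hk, hd⟩ := hK d
    rcases h d k hd with h1 | ⟨h1 | h1, h2 | h2⟩
    · exact ⟨k, by simp [hk], h1⟩
    · exact ⟨x, by simp, h1⟩
    · exact ⟨x, by simp, h1⟩
    · exact absurd ⟨k, hk, h2⟩ hx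
    · exact ⟨k, by simp [hk], ht _ _ _ h1 (hs _ _ h2)⟩

theorem le_of_joined (hs : ∀ u v, R' u v → R' v u) (ht : ∀ u v w, R' u v → R' v w → R' u w)
    (h : ∀ u v, R u v → R' u v ∨ ((R' u x ∨ R' u y) ∧ (R' v x ∨ R' v y)))
    (hxy : R' x y) {u v : D} (huv : R u v) : R' u v := by
  rcases h u v huv with h1 | ⟨h1 | h1, h2 | h2⟩
  · exact h1
  · exact ht _ _ _ h1 (hs _ _ h2)
  · exact ht _ _ _ h1 (ht _ _ _ hxy (hs _ _ h2))
  · exact ht _ _ _ h1 (ht _ _ _ (hs _ _ hxy) (hs _ _ h2))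
  · exact ht _ _ _ h1 (hs _ _ h2)

theorem exists_cover_pred (hRs : ∀ u v, R u v → R v u) (hRt : ∀ u v w, R u v → R v w → R u w)
    (hs : ∀ u v, R' u v → R' v u) (ht : ∀ u v w, R' u v → R' v w → R' u w)
    (h : ∀ u v, R u v → R' u v) (hxy : R' x y) (hn : ¬ R x y)
    (hK : ∀ d, ∃ k ∈ K, R d k) :
    ∃ K' : Finset D, (∀ d, ∃ k ∈ K', R' d k) ∧ K'.card + 1 ≤ K.card := by
  obtain ⟨a, ha, hxa⟩ := hK x
  obtain ⟨b, hb, hyb⟩ := hK y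
  have hab : a ≠ b := by
    rintro rfl
    exact hn (hRt _ _ _ hxa (hRs _ _ hyb))
  refine ⟨K.erase b, fun d => ?_, by rw [Finset.card_erase_add_one hb]⟩
  obtain ⟨k, hk, hd⟩ := hK d
  by_cases hkb : k = b
  · refine ⟨a, by simp [hab, ha], ?_⟩
    subst hkb
    exact ht _ _ _ (h _ _ hd) (ht _ _ _ (hs _ _ (h _ _ hyb))
      (ht _ _ _ (hs _ _ hxy) (h _ _ hxa)))
  · exact ⟨k, by simp [hkb, hk], h _ _ hd⟩

end Cover

theorem mul_swap_mul_involution {φ α : Perm D} (hα : ∀ d, α (α d) = d) (x y : D) :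
    φ * swap x y * α = φ * α * swap (α x) (α y) := by
  ext d
  simp only [Perm.mul_apply]
  congr 1
  rw [swap_apply_def, swap_apply_def]
  have h1 : α d = x ↔ d = α x := ⟨fun h => by rw [← h, hα], fun h => by rw [h, hα]⟩
  have h2 : α d = y ↔ d = α y := ⟨fun h => by rw [← h, hα], fun h => by rw [h, hα]⟩
  simp only [h1, h2]
  split_ifs <;> simp [hα]

theorem Planar.mul_swap {φ α : Perm D} (hP : Planar φ α) (hα : ∀ d, α (α d) = d) {x y : D}
    (hxy : x ≠ y)
    (h : φ.SameCycle x y ∨ (φ * α).SameCycle (α x) (α y) ∨ ¬ Rel φ α x y) :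
    Planar (φ * swap x y) α := by
  obtain ⟨K, hK, hc⟩ := hP
  have hα' : α x ≠ α y := fun h => hxy (α.injective h)
  have hstep : ∀ u v, Rel φ α u v → Rel (φ * swap x y) α u v ∨
      ((Rel (φ * swap x y) α u x ∨ Rel (φ * swap x y) α u y) ∧
        (Rel (φ * swap x y) α v x ∨ Rel (φ * swap x y) α v y)) := by
    intro u v
    refine Rel.of_steps (fun d => ?_) (fun d => .inl (Rel.edge _ _ d))
    rcases eq_or_ne d x with rfl | hx
    · refine .inr ⟨.inl (.refl _ _ _), .inr ?_⟩
      simpa using (Rel.face (φ * swap d y) α y).symm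
    rcases eq_or_ne d y with rfl | hy
    · refine .inr ⟨.inr (.refl _ _ _), .inl ?_⟩
      simpa using (Rel.face (φ * swap x d) α x).symm
    · left
      simpa [swap_apply_of_ne_of_ne hx hy] using (Rel.face (φ * swap x y) α d)
  have hs : ∀ u v, Rel (φ * swap x y) α u v → Rel (φ * swap x y) α v u := fun _ _ => Rel.symm
  have ht : ∀ u v w, Rel (φ * swap x y) α u v → Rel (φ * swap x y) α v w →
    Rel (φ * swap x y) α u w := fun _ _ _ => Rel.trans
  have hκ := mul_swap_mul_involution (φ := φ) hα x y
  have of_vertex : (φ * α * swap (α x) (α y)).SameCycle (α x) (α y) →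
      Rel (φ * swap x y) α x y := by
    intro h
    rw [← hκ] at h
    exact (Rel.edge _ _ x).trans ((Rel.of_sameCycle_vertex h).trans (Rel.edge _ _ y).symm)
  have b1 := orb_le_orb_mul_swap_succ φ x y
  have b2 := orb_le_orb_mul_swap_succ (φ * α) (α x) (α y)
  unfold Planar
  rw [hκ]
  by_cases hf : φ.SameCycle x y
  · have b3 := orb_succ_le_of_sameCycle hxy hf
    by_cases hv : (φ * α).SameCycle (α x) (α y)
    · have b4 := orb_succ_le_of_sameCycle hα' hv
      obtain ⟨K', hK', hc'⟩ := exists_cover_succ hs ht hstep hK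
      exact ⟨K', hK', by omega⟩
    · have := of_vertex (sameCycle_mul_swap hv)
      refine ⟨K, fun d => ?_, by omega⟩
      obtain ⟨k, hk, hd⟩ := hK d
      exact ⟨k, hk, le_of_joined hs ht hstep this hd⟩
  · have hj : Rel (φ * swap x y) α x y := Rel.of_sameCycle_face (sameCycle_mul_swap hf)
    have hle : ∀ u v, Rel φ α u v → Rel (φ * swap x y) α u v := fun u v =>
      le_of_joined hs ht hstep hj
    by_cases hv : (φ * α).SameCycle (α x) (α y)
    · have b4 := orb_succ_le_of_sameCycle hα' hv
      refine ⟨K, fun d => ?_, by omega⟩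
      obtain ⟨k, hk, hd⟩ := hK d
      exact ⟨k, hk, hle _ _ hd⟩
    · have hn : ¬ Rel φ α x y := by tauto
      obtain ⟨K', hK', hc'⟩ := exists_cover_pred (R := Rel φ α) (fun _ _ => Rel.symm)
        (fun _ _ _ => Rel.trans) hs ht hle hj hn hK
      exact ⟨K', hK', by omega⟩

theorem Planar.switch {φ α : Perm D} (hP : Planar φ α) (hα : ∀ d, α (α d) = d)
    (hne : ∀ d, α d ≠ d) {d e : D} (hde : φ d = e) (h : α d ≠ e) (hde' : d ≠ e) :
    Planar φ (α * swap d (α e) * swap e (α d)) := by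
  obtain ⟨a, ha⟩ : ∃ a, a = α d := ⟨_, rfl⟩
  obtain ⟨b, hb⟩ : ∃ b, b = α e := ⟨_, rfl⟩
  rw [← ha, ← hb]
  rw [← ha] at h
  have hda : α a = d := by rw [ha, hα]
  have heb : α b = e := by rw [hb, hα]
  have hbd : b ≠ d := fun h' => h (by rw [ha, ← h', heb])
  have had : a ≠ d := ha ▸ hne d
  have hbe : b ≠ e := hb ▸ hne e
  have hab : a ≠ b := fun h' => hde' (α.injective (by rw [← ha, ← hb, h']))
  set α' := α * swap d b * swap e a with hα'
  have e1 : α' d = e := by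
    simp [hα', swap_apply_of_ne_of_ne hde' had.symm, heb]
  have e2 : α' b = a := by
    rw [ha]; simp [hα', swap_apply_of_ne_of_ne hbe hab.symm]
  have e0 : ∀ z, z ≠ d → z ≠ e → z ≠ a → z ≠ b → α' z = α z := by
    intro z h1 h2 h3 h4
    simp [hα', swap_apply_of_ne_of_ne, h1, h2, h3, h4]
  have r1 : Rel φ α' d e := e1 ▸ Rel.edge φ α' d
  have r2 : Rel φ α' b a := e2 ▸ Rel.edge φ α' b
  have hstep : ∀ u v, Rel φ α u v → Rel φ α' u v ∨
      ((Rel φ α' u d ∨ Rel φ α' u b) ∧ (Rel φ α' v d ∨ Rel φ α' v b)) := by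
    intro u v
    refine Rel.of_steps (fun d => .inl (Rel.face _ _ d)) (fun z => ?_)
    rcases eq_or_ne z d with rfl | h1
    · exact .inr ⟨.inl (.refl _ _ _), .inr (by simpa [← ha] using r2.symm)⟩
    rcases eq_or_ne z e with rfl | h2
    · exact .inr ⟨.inl r1.symm, .inr (by simpa [← hb] using Rel.refl _ _ _)⟩
    rcases eq_or_ne z a with rfl | h3
    · exact .inr ⟨.inr r2.symm, .inl (by simpa [hda] using Rel.refl _ _ _)⟩
    rcases eq_or_ne z b with rfl | h4
    · exact .inr ⟨.inr (.refl _ _ _), .inl (by simpa [heb] using r1.symm)⟩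
    · exact .inl (e0 z h1 h2 h3 h4 ▸ Rel.edge φ α' z)
  have hs : ∀ u v, Rel φ α' u v → Rel φ α' v u := fun _ _ => Rel.symm
  have ht : ∀ u v w, Rel φ α' u v → Rel φ α' v w → Rel φ α' u w := fun _ _ _ => Rel.trans
  obtain ⟨K, hK, hc⟩ := hP
  have hcomm : φ * α' = φ * α * swap e a * swap d b := by
    have : swap d b * swap e a = swap e a * swap d b := by
      refine (Perm.disjoint_swap_swap ?_).commute
      simp [hde', had.symm, hbd.symm, hbe, hab.symm, h.symm]
    rw [hα', mul_assoc α, this]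
    simp only [mul_assoc]
  have hκ : (φ * α) a = e := by simp [hda, hde]
  have b1 := orb_succ_le_of_sameCycle (π := φ * α) h.symm
    (by rw [← hκ]; exact (sameCycle_apply _ _).symm)
  have b2 := orb_le_orb_mul_swap_succ (φ * α * swap e a) d b
  unfold Planar
  by_cases hv : (φ * α * swap e a).SameCycle d b
  · have b3 := orb_succ_le_of_sameCycle hbd.symm hv
    obtain ⟨K', hK', hc'⟩ := exists_cover_succ hs ht hstep hK
    exact ⟨K', hK', by rw [hcomm]; omega⟩
  · have := sameCycle_mul_swap hv
    rw [← hcomm] at this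
    refine ⟨K, fun d => ?_, by rw [hcomm]; omega⟩
    obtain ⟨k, hk, hd⟩ := hK d
    exact ⟨k, hk, le_of_joined hs ht hstep (Rel.of_sameCycle_vertex this) hd⟩

end Maps

end

section
open Equiv Function
set_option linter.unusedSectionVars false

/-! ### Labelled diagrams -/

/-- A combinatorial map on the darts `D` whose darts carry a letter `(gen, sg)`, the kind of the
face they bound, and a position `x` inside that face. -/
structure Dg (D : Type) where
  φ : Perm D
  α : Perm D
  gen : D → Fin 2
  sg : D → Bool
  kind : D → ℕ
  x : D → ℤ

/-- The sizes describing the faces of each kind. -/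
structure Par where
  P : ℕ → ℤ
  Q : ℕ → ℤ
  N : ℕ → ℕ

/-- The face through `d` reads a power of the cyclic word given by the parameters. -/
structure Face {D : Type} (π : Par) (m : Dg D) (d : D) : Prop where
  kind_next : m.kind (m.φ d) = m.kind d
  x_nonneg : 0 ≤ m.x d
  x_lt : m.x d < π.P (m.kind d)
  x_next : m.x (m.φ d) = m.x d + π.Q (m.kind d) -
    if m.sg (m.φ d) = m.sg d then 0 else π.P (m.kind d)
  gen_next : m.gen (m.φ d) ≠ m.gen d
  period : ∀ i, m.φ^[i] d = d ↔ π.N (m.kind d) ∣ i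

/-- A planar diagram all of whose faces are closed faces (kinds `0, 1, 2`), digons (kind `3`),
or the free face (kind `4`), whose darts are listed by `L`. -/
structure Valid {D : Type} [Fintype D] [DecidableEq D] (π : Par) (m : Dg D) (L : List D) :
    Prop where
  planar : Planar m.φ m.α
  inv : ∀ d, m.α (m.α d) = d
  fpf : ∀ d, m.α d ≠ d
  gen_edge : ∀ d, m.gen (m.α d) = m.gen d
  sg_edge : ∀ d, m.sg (m.α d) = !m.sg d
  face : ∀ d, m.kind d < 3 → Face π m d
  junk : ∀ d, m.kind d = 3 → m.φ d = m.α d ∧ m.φ (m.α d) = d ∧ m.kind (m.α d) = 3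
  kind_le : ∀ d, m.kind d ≤ 4
  free : ∀ d, d ∈ L ↔ m.kind d = 4
  nodup : L.Nodup
  cyc : L.map m.φ = L.rotate 1

def Dg.letter {D : Type} (m : Dg D) (d : D) : Fin 2 × Bool := (m.gen d, m.sg d)

theorem Face.transport {D D' : Type} {π : Par} {m : Dg D} {m' : Dg D'} {j : D → D'}
    (hj : Injective j) {T : D → Prop} (hT : ∀ e, T e → T (m.φ e))
    (hφ : ∀ e, T e → m'.φ (j e) = j (m.φ e))
    (hk : ∀ e, T e → m'.kind (j e) = m.kind e)
    (hg : ∀ e, T e → m'.gen (j e) = m.gen e)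
    (hs : ∀ e, T e → m'.sg (j e) = m.sg e)
    (hx : ∀ e, T e → m'.x (j e) = m.x e) {d : D} (hd : T d) (h : Face π m d) :
    Face π m' (j d) := by
  have hit : ∀ i, T (m.φ^[i] d) ∧ m'.φ^[i] (j d) = j (m.φ^[i] d) := by
    intro i
    induction i with
    | zero => exact ⟨hd, rfl⟩
    | succ i ih =>
      rw [iterate_succ_apply', iterate_succ_apply', ih.2, hφ _ ih.1]
      exact ⟨hT _ ih.1, rfl⟩
  have hd' := hT d hd
  constructor
  · rw [hφ d hd, hk _ hd', hk _ hd, h.kind_next]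
  · rw [hx _ hd]; exact h.x_nonneg
  · rw [hx _ hd, hk _ hd]; exact h.x_lt
  · rw [hφ d hd, hx _ hd', hx _ hd, hk _ hd, hs _ hd', hs _ hd]; exact h.x_next
  · rw [hφ d hd, hg _ hd', hg _ hd]; exact h.gen_next
  · intro i
    rw [(hit i).2, hj.eq_iff, hk _ hd]
    exact h.period i

section Ops
variable {D : Type} [Fintype D] [DecidableEq D] {π : Par} {m : Dg D}

theorem Valid.rotate {L : List D} (h : Valid π m L) (k : ℕ) : Valid π m (L.rotate k) where
  __ := h
  free := fun d => by rw [List.mem_rotate]; exact h.free d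
  nodup := List.nodup_rotate.2 h.nodup
  cyc := by rw [List.map_rotate, h.cyc, List.rotate_rotate, List.rotate_rotate, add_comm]

theorem Valid.of_isRotated {L L' : List D} (h : Valid π m L) (hL : L ~r L') : Valid π m L' := by
  obtain ⟨k, rfl⟩ := hL
  exact h.rotate k

/-- `m'` arises from `m` by surgery on the free face only. -/
structure Same (m m' : Dg D) : Prop where
  gen : m'.gen = m.gen
  sg : m'.sg = m.sg
  x : m'.x = m.x
  kind : ∀ d, m'.kind d < 3 ∨ m.kind d < 3 → m'.kind d = m.kind d

theorem Same.trans {m₁ m₂ m₃ : Dg D} (h : Same m₁ m₂) (h' : Same m₂ m₃) : Same m₁ m₃ where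
  gen := h'.gen.trans h.gen
  sg := h'.sg.trans h.sg
  x := h'.x.trans h.x
  kind := by
    rintro d (hd | hd)
    · have h1 := h'.kind d (.inl hd)
      rw [h1] at hd ⊢
      exact h.kind d (.inl hd)
    · have h1 := h.kind d (.inr hd)
      rw [← h1] at hd ⊢
      exact h'.kind d (.inr hd)

theorem Same.letter {m₁ m₂ : Dg D} (h : Same m₁ m₂) : m₂.letter = m₁.letter := by
  funext d; simp [Dg.letter, h.gen, h.sg]

theorem Face.of_same {m m' : Dg D} (hf : ∀ d, m.kind d < 3 → Face π m d) (h : Same m m')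
    (hφ : ∀ d, m.kind d < 3 → m'.φ d = m.φ d) (d : D) (hd : m'.kind d < 3) : Face π m' d := by
  have hd' : m.kind d < 3 := h.kind d (.inl hd) ▸ hd
  refine Face.transport (j := id) injective_id (T := fun e => m.kind e < 3) ?_ hφ
    (fun e he => h.kind e (.inr he)) (fun e _ => by rw [h.gen, id])
    (fun e _ => by rw [h.sg, id]) (fun e _ => by rw [h.x, id]) hd' (hf d hd')
  intro e he
  rw [(hf e he).kind_next]
  exact he

theorem Valid.exists_switch {L : List D} (h : Valid π m L) {d e : D} (hd : d ∈ L) (he : e ∈ L)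
    (hde : m.φ d = e) (hg : m.gen d = m.gen e) (hs : m.sg d ≠ m.sg e) :
    ∃ m' : Dg D, Valid π m' L ∧ Same m m' ∧ m'.α d = e := by
  by_cases ha : m.α d = e
  · exact ⟨m, h, ⟨rfl, rfl, rfl, fun _ _ => rfl⟩, ha⟩
  have hne : d ≠ e := fun hh => hs (by rw [hh])
  obtain ⟨a, haa⟩ : ∃ a, a = m.α d := ⟨_, rfl⟩
  obtain ⟨b, hbb⟩ : ∃ b, b = m.α e := ⟨_, rfl⟩
  have hda : m.α a = d := by rw [haa, h.inv]
  have heb : m.α b = e := by rw [hbb, h.inv]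
  have hae : a ≠ e := haa ▸ ha
  have hbd : b ≠ d := fun h' => hae (by rw [haa, ← h', heb])
  have had : a ≠ d := haa ▸ h.fpf d
  have hbe : b ≠ e := hbb ▸ h.fpf e
  have hab : a ≠ b := fun h' => hne (m.α.injective (by rw [← haa, ← hbb, h']))
  obtain ⟨α', hα'⟩ : ∃ α', α' = m.α * swap d b * swap e a := ⟨_, rfl⟩
  have e1 : α' d = e := by
    simp [hα', swap_apply_of_ne_of_ne hne had.symm, heb]
  have e2 : α' b = a := by
    rw [hα', Perm.mul_apply, Perm.mul_apply, swap_apply_of_ne_of_ne hbe hab.symm,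
      swap_apply_right, haa]
  have e3 : α' e = d := by
    simp [hα', swap_apply_of_ne_of_ne had hab, hda]
  have e4 : α' a = b := by
    simp [hα', swap_apply_of_ne_of_ne hne.symm hbe.symm, ← hbb]
  have e0 : ∀ z, z ≠ d → z ≠ e → z ≠ a → z ≠ b → α' z = m.α z := by
    intro z h1 h2 h3 h4
    simp [hα', swap_apply_of_ne_of_ne, h1, h2, h3, h4]
  have hga : m.gen a = m.gen d := by rw [haa, h.gen_edge]
  have hgb : m.gen b = m.gen e := by rw [hbb, h.gen_edge]
  have hsa : m.sg a = m.sg e := by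
    rw [haa, h.sg_edge]; revert hs; cases m.sg d <;> cases m.sg e <;> simp
  have hsb : m.sg b = m.sg d := by
    rw [hbb, h.sg_edge]; revert hs; cases m.sg d <;> cases m.sg e <;> simp
  have cases4 : ∀ (p : D → Prop), p d → p e → p a → p b →
      (∀ z, z ≠ d → z ≠ e → z ≠ a → z ≠ b → p z) → ∀ z, p z := by
    intro p h1 h2 h3 h4 h5 z
    by_cases z1 : z = d
    · exact z1 ▸ h1
    by_cases z2 : z = e
    · exact z2 ▸ h2
    by_cases z3 : z = a
    · exact z3 ▸ h3
    by_cases z4 : z = b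
    · exact z4 ▸ h4
    exact h5 z z1 z2 z3 z4
  have hsn : m.sg e = !m.sg d := by
    revert hs; cases m.sg d <;> cases m.sg e <;> simp
  refine ⟨{ m with α := α' }, ?_, ⟨rfl, rfl, rfl, fun _ _ => rfl⟩, e1⟩
  have hsame : Same m { m with α := α' } := ⟨rfl, rfl, rfl, fun _ _ => rfl⟩
  refine
  { planar := ?_
    inv := ?_
    fpf := ?_
    gen_edge := ?_
    sg_edge := ?_
    face := Face.of_same h.face hsame (fun _ _ => rfl)
    junk := ?_
    kind_le := h.kind_le
    free := h.free
    nodup := h.nodup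
    cyc := h.cyc }
  · have := h.planar.switch h.inv h.fpf hde ha hne
    rwa [← haa, ← hbb, ← hα'] at this
  · refine cases4 _ ?_ ?_ ?_ ?_ fun z h1 h2 h3 h4 => ?_
    · simp [e1, e3]
    · simp [e1, e3]
    · simp [e2, e4]
    · simp [e2, e4]
    · simp only
      rw [e0 z h1 h2 h3 h4, e0, h.inv]
      · exact fun hh => h3 (by rw [haa, ← hh, h.inv])
      · exact fun hh => h4 (by rw [hbb, ← hh, h.inv])
      · exact fun hh => h1 (by rw [← h.inv z, hh, hda])
      · exact fun hh => h2 (by rw [← h.inv z, hh, heb])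
  · refine cases4 _ ?_ ?_ ?_ ?_ fun z h1 h2 h3 h4 => ?_
    · simp [e1, hne.symm]
    · simp [e3, hne]
    · simp [e4, hab.symm]
    · simp [e2, hab]
    · simp only
      rw [e0 z h1 h2 h3 h4]; exact h.fpf z
  · refine cases4 _ ?_ ?_ ?_ ?_ fun z h1 h2 h3 h4 => ?_
    · simp [e1, hg]
    · simp [e3, hg]
    · simp [e4, hga, hgb, hg]
    · simp [e2, hga, hgb, hg]
    · simp only
      rw [e0 z h1 h2 h3 h4]; exact h.gen_edge z
  · refine cases4 _ ?_ ?_ ?_ ?_ fun z h1 h2 h3 h4 => ?_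
    · simp [e1, hsn]
    · simp [e3, hsn]
    · simp [e4, hsa, hsb, hsn]
    · simp [e2, hsa, hsb, hsn]
    · simp only
      rw [e0 z h1 h2 h3 h4]; exact h.sg_edge z
  · intro z hz
    have hz' := h.junk z hz
    have hd4 := (h.free d).1 hd
    have he4 := (h.free e).1 he
    simp only at hz ⊢
    rw [e0 z]
    · exact hz'
    · rintro rfl; omega
    · rintro rfl; omega
    · rintro rfl; rw [hda] at hz'; omega
    · rintro rfl; rw [heb] at hz'; omega

/-- Retype two darts as bounding a digon. -/
def Dg.junkify (m : Dg D) (φ' : Perm D) (d e : D) : Dg D :=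
  { m with φ := φ', kind := fun z => if z = d ∨ z = e then 3 else m.kind z }

theorem Valid.junkify {L L' : List D} (h : Valid π m L) {φ' : Perm D} {d e : D}
    (hd : m.kind d = 4) (he : m.kind e = 4) (hde : m.α d = e) (h1 : φ' d = e) (h2 : φ' e = d)
    (hφ : ∀ z, m.kind z ≠ 4 → φ' z = m.φ z) (hP : Planar φ' m.α)
    (hf : ∀ z, z ∈ L' ↔ z ∈ L ∧ z ≠ d ∧ z ≠ e) (hn : L'.Nodup) (hc : L'.map φ' = L'.rotate 1) :
    Valid π (m.junkify φ' d e) L' ∧ Same m (m.junkify φ' d e) := by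
  have hed : m.α e = d := by rw [← hde, h.inv]
  have hsame : Same m (m.junkify φ' d e) := by
    refine ⟨rfl, rfl, rfl, fun z hz => ?_⟩
    simp only [Dg.junkify] at hz ⊢
    split_ifs at hz ⊢ with hh
    · rcases hh with rfl | rfl <;> omega
    · rfl
  refine ⟨?_, hsame⟩
  refine
  { planar := hP
    inv := h.inv
    fpf := h.fpf
    gen_edge := h.gen_edge
    sg_edge := h.sg_edge
    face := Face.of_same h.face hsame (fun z hz => hφ z (by omega))
    junk := ?_
    kind_le := ?_
    free := ?_
    nodup := hn
    cyc := hc }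
  · intro z hz
    simp only [Dg.junkify] at hz ⊢
    split_ifs at hz with hh
    · rcases hh with rfl | rfl
      · simp [h1, h2, hde]
      · simp [h1, h2, hed]
    · obtain ⟨j1, j2, j3⟩ := h.junk z hz
      rw [hφ z (by omega), hφ _ (by omega)]
      refine ⟨j1, j2, ?_⟩
      split_ifs
      · rfl
      · exact j3
  · intro z
    simp only [Dg.junkify]
    split_ifs
    · omega
    · exact h.kind_le z
  · intro z
    rw [hf, h.free]
    simp only [Dg.junkify]
    split_ifs with hh
    · rcases hh with rfl | rfl <;> simp
    · simp only [not_or] at hh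
      simp [hh]

theorem Valid.zip {u d e : D} {T : List D} (h : Valid π m (u :: d :: e :: T))
    (hg : m.gen d = m.gen e) (hs : m.sg d ≠ m.sg e) :
    ∃ m' : Dg D, Valid π m' (u :: T) ∧ Same m m' := by
  have hcyc : m.φ d = e := by
    have := h.cyc
    simp only [List.map_cons, List.rotate_cons_succ, List.rotate_zero, List.cons_append,
      List.cons.injEq] at this
    exact this.2.1
  obtain ⟨m₁, hv, hsame, ha⟩ := h.exists_switch (d := d) (e := e) (by simp) (by simp) hcyc hg hs
  have hc := hv.cyc
  simp only [List.map_cons, List.rotate_cons_succ, List.rotate_zero, List.cons_append,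
    List.cons.injEq] at hc
  obtain ⟨c1, c2, c3⟩ := hc
  have hn := hv.nodup
  simp only [List.nodup_cons, List.mem_cons, not_or] at hn
  obtain ⟨⟨nud, nue, nuT⟩, ⟨nde, ndT⟩, neT, nT⟩ := hn
  have hea : m₁.α e = d := by rw [← ha, hv.inv]
  have k4 : ∀ z ∈ (u :: d :: e :: T), m₁.kind z = 4 := fun z hz => (hv.free z).1 hz
  have := hv.junkify (L' := u :: T) (φ' := m₁.φ * swap u e) (d := d) (e := e)
    (k4 _ (by simp)) (k4 _ (by simp)) ha
    (by simp [swap_apply_of_ne_of_ne (Ne.symm nud) nde, c2]) (by simp [c1])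
    (fun z hz => by
      have h1 : z ≠ u := by rintro rfl; exact hz (k4 _ (by simp))
      have h2 : z ≠ e := by rintro rfl; exact hz (k4 _ (by simp))
      simp [swap_apply_of_ne_of_ne h1 h2])
    (hv.planar.mul_swap hv.inv nue (.inr (.inl ?_)))
    (fun z => ?_) (by simp [nuT, nT]) ?_
  · exact ⟨_, this.1, hsame.trans this.2⟩
  · rw [hea]
    have := sameCycle_apply (m₁.φ * m₁.α) (m₁.α u)
    rwa [Perm.mul_apply, hv.inv, c1] at this
  · simp only [List.mem_cons]
    constructor
    · rintro (rfl | hz)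
      · simp [nud, nue]
      · refine ⟨by simp [hz], ?_, ?_⟩
        · rintro rfl; exact ndT hz
        · rintro rfl; exact neT hz
    · tauto
  · simp only [List.map_cons, List.rotate_cons_succ, List.rotate_zero, Perm.mul_apply,
      swap_apply_left]
    have : List.map (⇑(m₁.φ * swap u e)) T = List.map m₁.φ T := by
      refine List.map_congr_left fun z hz => ?_
      have h1 : z ≠ u := by rintro rfl; exact nuT hz
      have h2 : z ≠ e := by rintro rfl; exact neT hz
      simp [swap_apply_of_ne_of_ne h1 h2]
    rw [this, c3]

theorem Valid.zip_pair {d e : D} (h : Valid π m [d, e])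
    (hg : m.gen d = m.gen e) (hs : m.sg d ≠ m.sg e) :
    ∃ m' : Dg D, Valid π m' [] ∧ Same m m' := by
  have hcyc := h.cyc
  simp only [List.map_cons, List.rotate_cons_succ, List.rotate_zero, List.cons_append,
      List.cons.injEq, List.map_nil, List.nil_append, and_true] at hcyc
  obtain ⟨m₁, hv, hsame, ha⟩ := h.exists_switch (d := d) (e := e) (by simp) (by simp) hcyc.1 hg hs
  have hc := hv.cyc
  simp only [List.map_cons, List.rotate_cons_succ, List.rotate_zero, List.cons_append,
    List.cons.injEq, List.map_nil, List.nil_append, and_true] at hc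
  have := hv.junkify (L' := []) (φ' := m₁.φ) (d := d) (e := e)
    ((hv.free _).1 (by simp)) ((hv.free _).1 (by simp)) ha hc.1 hc.2 (fun _ _ => rfl) hv.planar
    (fun z => by simp only [List.mem_cons]; simp; tauto) (by simp) (by simp)
  exact ⟨_, this.1, hsame.trans this.2⟩

/-- Folding the free face along a free reduction of its boundary word. -/
theorem Valid.step {L : List D} (h : Valid π m L) {W' : List (Fin 2 × Bool)}
    (hW : FreeGroup.Red.Step (L.map m.letter) W') :
    ∃ (m' : Dg D) (L' : List D), Valid π m' L' ∧ Same m m' ∧ L'.map m'.letter = W' := by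
  generalize hX : L.map m.letter = X at hW
  obtain ⟨A, B, g, b⟩ := hW
  obtain ⟨LA, L2, rfl, rfl, hL2⟩ := List.map_eq_append_iff.1 hX
  obtain ⟨d, L3, rfl, hd, hL3⟩ := List.map_eq_cons_iff.1 hL2
  obtain ⟨e, LB, rfl, he, rfl⟩ := List.map_eq_cons_iff.1 hL3
  simp only [Dg.letter, Prod.mk.injEq] at hd he
  have hg : m.gen d = m.gen e := by rw [hd.1, he.1]
  have hs : m.sg d ≠ m.sg e := by rw [hd.2, he.2]; simp
  have hrot : Valid π m (d :: e :: (LB ++ LA)) := by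
    refine h.of_isRotated ?_
    simpa using List.isRotated_append (l := LA) (l' := d :: e :: LB)
  rcases List.eq_nil_or_concat (LB ++ LA) with hnil | ⟨T, u, hT⟩
  · rw [hnil] at hrot
    obtain ⟨m', hv, hsame⟩ := hrot.zip_pair hg hs
    have : LB = [] ∧ LA = [] := by simpa using hnil
    exact ⟨m', [], hv, hsame, by simp [this.1, this.2]⟩
  · rw [hT] at hrot
    have hrot2 : Valid π m (u :: d :: e :: T) := by
      refine hrot.of_isRotated ?_
      simpa using List.isRotated_append (l := d :: e :: T) (l' := [u])
    obtain ⟨m', hv, hsame⟩ := hrot2.zip hg hs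
    refine ⟨m', LA ++ LB, hv.of_isRotated ?_, hsame, by simp [hsame.letter]⟩
    have h1 : (u :: T) ~r (T ++ [u]) := by
      simpa using List.isRotated_append (l := [u]) (l' := T)
    have h2 : (T ++ [u]) = LB ++ LA := by simpa using hT.symm
    exact (h2 ▸ h1).trans List.isRotated_append

theorem Valid.red {L : List D} (h : Valid π m L) {W' : List (Fin 2 × Bool)}
    (hW : FreeGroup.Red (L.map m.letter) W') :
    ∃ (m' : Dg D) (L' : List D), Valid π m' L' ∧ Same m m' ∧ L'.map m'.letter = W' := by
  induction hW with
  | refl => exact ⟨m, L, h, ⟨rfl, rfl, rfl, fun _ _ => rfl⟩, rfl⟩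
  | tail _ hs ih =>
    obtain ⟨m₁, L₁, hv, hsame, rfl⟩ := ih
    obtain ⟨m₂, L₂, hv2, hsame2, h2⟩ := hv.step hs
    exact ⟨m₂, L₂, hv2, hsame.trans hsame2, h2⟩

/-- The number of darts on faces of kind `k`. -/
def Dg.cnt (m : Dg D) (k : ℕ) : ℕ := (Finset.univ.filter fun d => m.kind d = k).card

theorem Same.cnt {m m' : Dg D} (h : Same m m') {k : ℕ} (hk : k < 3) : m'.cnt k = m.cnt k := by
  unfold Dg.cnt
  congr 1
  ext d
  simp only [Finset.mem_filter, Finset.mem_univ, true_and]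
  constructor
  · intro hd; rw [← h.kind d (.inl (by omega)), hd]
  · intro hd; rw [h.kind d (.inr (by omega)), hd]

end Ops

end

section
open Equiv Function
set_option linter.unusedSectionVars false

theorem map_mul_swap_eq_rotate {D : Type} [DecidableEq D] {φ : Perm D} {u v : D} {A B : List D}
    (h1 : (u :: A).map φ = (u :: A).rotate 1) (h2 : (v :: B).map φ = (v :: B).rotate 1)
    (hn : ((u :: A) ++ (v :: B)).Nodup) :
    (u :: B ++ v :: A).map (φ * swap u v) = (u :: B ++ v :: A).rotate 1 := by
  simp only [List.cons_append, List.nodup_cons, List.mem_append, List.mem_cons, not_or,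
    List.nodup_append] at hn
  obtain ⟨⟨huA, huv, huB⟩, hA, ⟨hvB, hB⟩, hdis⟩ := hn
  have hvA : v ∉ A := fun h => hdis v h v (by simp) rfl
  have aux : ∀ C : List D, u ∉ C → v ∉ C → C.map (φ * swap u v) = C.map φ := by
    intro C h1 h2
    refine List.map_congr_left fun z hz => ?_
    rw [Perm.mul_apply, swap_apply_of_ne_of_ne (by rintro rfl; exact h1 hz)
      (by rintro rfl; exact h2 hz)]
  simp only [List.map_cons, List.rotate_cons_succ, List.rotate_zero] at h1 h2
  simp only [List.cons_append, List.map_cons, List.map_append, aux A huA hvA, aux B huB hvB,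
    List.rotate_cons_succ, List.rotate_zero, Perm.mul_apply, swap_apply_left, swap_apply_right,
    h1, List.append_assoc]
  rw [← List.cons_append, h2]
  simp

/-! ### Gluing diagrams at a point -/

section Sum
variable {D₁ D₂ : Type} [Fintype D₁] [Fintype D₂] [DecidableEq D₁] [DecidableEq D₂]

theorem orb_add_le_orb_sumCongr (φ₁ : Perm D₁) (φ₂ : Perm D₂) :
    orb φ₁ + orb φ₂ ≤ orb (Perm.sumCongr φ₁ φ₂) := by
  have : Finite (Quotient (Perm.SameCycle.setoid φ₁)) := Quotient.finite _
  have : Finite (Quotient (Perm.SameCycle.setoid φ₂)) := Quotient.finite _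
  let f : D₁ ⊕ D₂ → Quotient (Perm.SameCycle.setoid φ₁) ⊕ Quotient (Perm.SameCycle.setoid φ₂) :=
    Sum.map (Quotient.mk _) (Quotient.mk _)
  have hf : ∀ d, f (Perm.sumCongr φ₁ φ₂ d) = f d := by
    rintro (d | d)
    · exact congrArg Sum.inl (Quotient.sound (sameCycle_apply φ₁ d).symm)
    · exact congrArg Sum.inr (Quotient.sound (sameCycle_apply φ₂ d).symm)
  have hs : Surjective f := Sum.map_surjective.2 ⟨Quotient.mk_surjective, Quotient.mk_surjective⟩
  have := card_range_le_orb _ f hf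
  rw [hs.range_eq, Nat.card_univ, Nat.card_sum] at this
  exact this

theorem Planar.sumCongr {φ₁ α₁ : Perm D₁} {φ₂ α₂ : Perm D₂} (h1 : Planar φ₁ α₁)
    (h2 : Planar φ₂ α₂) : Planar (Perm.sumCongr φ₁ φ₂) (Perm.sumCongr α₁ α₂) := by
  obtain ⟨K₁, hK1, hc1⟩ := h1
  obtain ⟨K₂, hK2, hc2⟩ := h2
  refine ⟨K₁.disjSum K₂, ?_, ?_⟩
  · rintro (d | d)
    · obtain ⟨k, hk, hd⟩ := hK1 d
      exact ⟨Sum.inl k, by simpa using hk, fun f f1 f2 => hd (fun z => f (Sum.inl z))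
        (fun z => f1 (Sum.inl z)) (fun z => f2 (Sum.inl z))⟩
    · obtain ⟨k, hk, hd⟩ := hK2 d
      exact ⟨Sum.inr k, by simpa using hk, fun f f1 f2 => hd (fun z => f (Sum.inr z))
        (fun z => f1 (Sum.inr z)) (fun z => f2 (Sum.inr z))⟩
  · rw [Perm.sumCongr_mul, Finset.card_disjSum, Fintype.card_sum]
    have := orb_add_le_orb_sumCongr φ₁ φ₂
    have := orb_add_le_orb_sumCongr (φ₁ * α₁) (φ₂ * α₂)
    omega

/-- The diagram obtained from two diagrams by gluing two corners of their free faces. -/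
def Dg.join (m₁ : Dg D₁) (m₂ : Dg D₂) (u : D₁) (v : D₂) : Dg (D₁ ⊕ D₂) where
  φ := Perm.sumCongr m₁.φ m₂.φ * swap (Sum.inl u) (Sum.inr v)
  α := Perm.sumCongr m₁.α m₂.α
  gen := Sum.elim m₁.gen m₂.gen
  sg := Sum.elim m₁.sg m₂.sg
  kind := Sum.elim m₁.kind m₂.kind
  x := Sum.elim m₁.x m₂.x

variable {π : Par} {m₁ : Dg D₁} {m₂ : Dg D₂}

theorem Valid.join {u : D₁} {v : D₂} {A : List D₁} {B : List D₂} (h1 : Valid π m₁ (u :: A))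
    (h2 : Valid π m₂ (v :: B)) :
    Valid π (m₁.join m₂ u v)
      (Sum.inl u :: B.map Sum.inr ++ Sum.inr v :: A.map Sum.inl) := by
  have hu : m₁.kind u = 4 := (h1.free u).1 (by simp)
  have hv : m₂.kind v = 4 := (h2.free v).1 (by simp)
  have hinl : ∀ e, m₁.kind e ≠ 4 → (m₁.join m₂ u v).φ (Sum.inl e) = Sum.inl (m₁.φ e) := by
    intro e he
    have : e ≠ u := by rintro rfl; exact he hu
    simp [Dg.join, swap_apply_of_ne_of_ne, this]
  have hinr : ∀ e, m₂.kind e ≠ 4 → (m₁.join m₂ u v).φ (Sum.inr e) = Sum.inr (m₂.φ e) := by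
    intro e he
    have : e ≠ v := by rintro rfl; exact he hv
    simp [Dg.join, swap_apply_of_ne_of_ne, this]
  refine
  { planar := ?_
    inv := ?_
    fpf := ?_
    gen_edge := ?_
    sg_edge := ?_
    face := ?_
    junk := ?_
    kind_le := ?_
    free := ?_
    nodup := ?_
    cyc := ?_ }
  · refine (h1.planar.sumCongr h2.planar).mul_swap ?_ (by simp) (.inr (.inr ?_))
    · rintro (d | d)
      · simp [h1.inv]
      · simp [h2.inv]
    · intro h
      have := h (fun d => d.isLeft = true) (by rintro (d | d) <;> simp)
        (by rintro (d | d) <;> simp)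
      simp at this
  · rintro (d | d)
    · simp [Dg.join, h1.inv]
    · simp [Dg.join, h2.inv]
  · rintro (d | d)
    · simp [Dg.join, h1.fpf]
    · simp [Dg.join, h2.fpf]
  · rintro (d | d)
    · simp [Dg.join, h1.gen_edge]
    · simp [Dg.join, h2.gen_edge]
  · rintro (d | d)
    · simp [Dg.join, h1.sg_edge]
    · simp [Dg.join, h2.sg_edge]
  · rintro (d | d) hd
    · refine Face.transport Sum.inl_injective (T := fun e => m₁.kind e < 3)
        (fun e he => ?_) (fun e he => hinl e (by omega)) (fun e he => rfl) (fun e he => rfl)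
        (fun e he => rfl) (fun e he => rfl) hd (h1.face d hd)
      rw [(h1.face e he).kind_next]; exact he
    · refine Face.transport Sum.inr_injective (T := fun e => m₂.kind e < 3)
        (fun e he => ?_) (fun e he => hinr e (by omega)) (fun e he => rfl) (fun e he => rfl)
        (fun e he => rfl) (fun e he => rfl) hd (h2.face d hd)
      rw [(h2.face e he).kind_next]; exact he
  · rintro (d | d) hd
    · have hd' : m₁.kind d = 3 := hd
      obtain ⟨j1, j2, j3⟩ := h1.junk d hd
      have e1 : (m₁.join m₂ u v).α (Sum.inl d) = Sum.inl (m₁.α d) := rfl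
      rw [e1, hinl _ (by omega), hinl _ (by omega), j1, j2]
      exact ⟨rfl, rfl, j3⟩
    · have hd' : m₂.kind d = 3 := hd
      obtain ⟨j1, j2, j3⟩ := h2.junk d hd
      have e1 : (m₁.join m₂ u v).α (Sum.inr d) = Sum.inr (m₂.α d) := rfl
      rw [e1, hinr _ (by omega), hinr _ (by omega), j1, j2]
      exact ⟨rfl, rfl, j3⟩
  · rintro (d | d)
    · exact h1.kind_le d
    · exact h2.kind_le d
  · rintro (d | d)
    · have := h1.free d
      simp only [List.mem_cons] at this
      simp [Dg.join, ← this]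
    · have := h2.free d
      simp only [List.mem_cons] at this
      simp [Dg.join, ← this, or_comm]
  · have n1 := h1.nodup
    have n2 := h2.nodup
    have hb := n2
    rw [List.nodup_cons] at n1 n2
    simp only [List.cons_append, List.nodup_cons, List.nodup_append, List.mem_append,
      List.mem_cons, List.mem_map]
    refine ⟨by simp [n1.1], n2.2.map Sum.inr_injective, ⟨by simp, n1.2.map Sum.inl_injective⟩, ?_⟩
    rintro _ ⟨a, ha, rfl⟩ _ (rfl | ⟨b, hb, rfl⟩)
    · simp only [ne_eq, Sum.inr.injEq]; rintro rfl; exact n2.1 ha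
    · simp
  · refine map_mul_swap_eq_rotate (A := A.map Sum.inl) (B := B.map Sum.inr) ?_ ?_ ?_
    · have := congrArg (List.map (Sum.inl : D₁ → D₁ ⊕ D₂)) h1.cyc
      simpa [comp_def] using this
    · have := congrArg (List.map (Sum.inr : D₂ → D₁ ⊕ D₂)) h2.cyc
      simpa [comp_def] using this
    · have n1 := h1.nodup.map (Sum.inl_injective (β := D₂))
      have n2 := h2.nodup.map (Sum.inr_injective (α := D₁))
      rw [List.map_cons] at n1 n2
      refine n1.append n2 ?_
      intro a ha hb
      rw [← List.map_cons, List.mem_map] at ha hb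
      obtain ⟨_, _, rfl⟩ := ha
      obtain ⟨_, _, h⟩ := hb
      simp at h

theorem Dg.cnt_join (u : D₁) (v : D₂) (k : ℕ) :
    (m₁.join m₂ u v).cnt k = m₁.cnt k + m₂.cnt k := by
  unfold Dg.cnt
  rw [← Finset.card_disjSum]
  congr 1
  ext (d | d)
  · rw [Finset.inl_mem_disjSum, Finset.mem_filter, Finset.mem_filter]; simp [Dg.join]
  · rw [Finset.inr_mem_disjSum, Finset.mem_filter, Finset.mem_filter]; simp [Dg.join]

end Sum

/-- There is a diagram with free face reading `W` and `c k` darts on closed faces of kind `k`. -/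
def Ex (π : Par) (c : ℕ → ℕ) (W : List (Fin 2 × Bool)) : Prop :=
  ∃ (D : Type) (_ : Fintype D) (_ : DecidableEq D) (m : Dg D) (L : List D),
    Valid π m L ∧ L.map m.letter = W ∧ ∀ k < 3, m.cnt k = c k

theorem Ex.rotate {π : Par} {c : ℕ → ℕ} {W W' : List (Fin 2 × Bool)} (h : Ex π c W)
    (hW : W ~r W') : Ex π c W' := by
  obtain ⟨D, i1, i2, m, L, hv, rfl, hc⟩ := h
  obtain ⟨k, rfl⟩ := hW
  exact ⟨D, i1, i2, m, L.rotate k, hv.rotate k, by rw [List.map_rotate], hc⟩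

theorem Ex.red {π : Par} {c : ℕ → ℕ} {W W' : List (Fin 2 × Bool)} (h : Ex π c W)
    (hW : FreeGroup.Red W W') : Ex π c W' := by
  obtain ⟨D, i1, i2, m, L, hv, rfl, hc⟩ := h
  obtain ⟨m', L', hv', hs, h'⟩ := hv.red hW
  exact ⟨D, i1, i2, m', L', hv', h', fun k hk => by rw [hs.cnt hk, hc k hk]⟩

theorem Ex.append {π : Par} {c₁ c₂ : ℕ → ℕ} {W₁ W₂ : List (Fin 2 × Bool)} (h₁ : Ex π c₁ W₁)
    (h₂ : Ex π c₂ W₂) (n₁ : W₁ ≠ []) (n₂ : W₂ ≠ []) : Ex π (c₁ + c₂) (W₁ ++ W₂) := by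
  obtain ⟨D₁, i1, i2, m₁, L₁, hv₁, rfl, hc₁⟩ := h₁
  obtain ⟨D₂, j1, j2, m₂, L₂, hv₂, rfl, hc₂⟩ := h₂
  obtain ⟨A, u, rfl⟩ : ∃ A u, L₁ = A ++ [u] := by
    rcases List.eq_nil_or_concat L₁ with rfl | ⟨A, u, h⟩
    · simp at n₁
    · exact ⟨A, u, by simpa using h⟩
  obtain ⟨B, v, rfl⟩ : ∃ A u, L₂ = A ++ [u] := by
    rcases List.eq_nil_or_concat L₂ with rfl | ⟨A, u, h⟩
    · simp at n₂
    · exact ⟨A, u, by simpa using h⟩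
  have hu := hv₁.of_isRotated (List.isRotated_append (l := A) (l' := [u]))
  have hv := hv₂.of_isRotated (List.isRotated_append (l := B) (l' := [v]))
  have := Valid.join (u := u) (v := v) (A := A) (B := B) hu hv
  refine Ex.rotate (W := (Sum.inl u :: B.map Sum.inr ++ Sum.inr v :: A.map Sum.inl).map
    (m₁.join m₂ u v).letter) ⟨D₁ ⊕ D₂, inferInstance, inferInstance, _, _, this, rfl, ?_⟩ ?_
  · intro k hk
    rw [Dg.cnt_join, hc₁ k hk, hc₂ k hk, Pi.add_apply]
  · have e1 : ∀ z, (m₁.join m₂ u v).letter (Sum.inl z) = m₁.letter z := fun _ => rfl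
    have e2 : ∀ z, (m₁.join m₂ u v).letter (Sum.inr z) = m₂.letter z := fun _ => rfl
    have h1 : ∀ C : List D₁, C.map ((m₁.join m₂ u v).letter ∘ Sum.inl) = C.map m₁.letter :=
      fun C => List.map_congr_left fun z _ => e1 z
    have h2 : ∀ C : List D₂, C.map ((m₁.join m₂ u v).letter ∘ Sum.inr) = C.map m₂.letter :=
      fun C => List.map_congr_left fun z _ => e2 z
    simp only [List.map_append, List.map_cons, List.map_map, h1, h2, e1, e2, List.map_nil]
    have := List.isRotated_append (l := [m₁.letter u] ++ (B.map m₂.letter ++ [m₂.letter v]))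
      (l' := A.map m₁.letter)
    simpa using this

/-! ### Basic diagrams -/

theorem ex_spur (π : Par) (g : Fin 2) (b : Bool) : Ex π 0 [(g, b), (g, !b)] := by
  let ν : Perm Bool := Equiv.boolNot
  let m : Dg Bool := ⟨ν, ν, fun _ => g, fun z => xor z b, fun _ => 4, fun _ => 0⟩
  refine ⟨Bool, inferInstance, inferInstance, m, [false, true], ?_, ?_, ?_⟩
  · refine
    { planar := ?_
      inv := by intro d; cases d <;> rfl
      fpf := by intro d; cases d <;> simp [m, ν]
      gen_edge := fun _ => rfl
      sg_edge := by intro d; cases d <;> cases b <;> rfl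
      face := fun d hd => by simp [m] at hd
      junk := fun d hd => by simp [m] at hd
      kind_le := fun d => le_rfl
      free := by simp [m]
      nodup := by decide
      cyc := rfl }
    refine ⟨{false}, ?_, ?_⟩
    · intro d
      refine ⟨false, by simp, ?_⟩
      cases d
      · exact Rel.refl _ _ _
      · exact (Rel.face ν ν false).symm
    · have h1 := card_range_le_orb ν (fun _ => ()) (fun _ => rfl)
      have h2 := card_range_le_orb (ν * ν) id (by decide)
      have e1 : Nat.card (Set.range (fun _ : Bool => ())) = 1 := by simp
      have e2 : Nat.card (Set.range (id : Bool → Bool)) = 2 := by simp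
      rw [e1] at h1
      rw [e2] at h2
      simp only [Finset.card_singleton, Fintype.card_bool]
      change 4 * 1 + 2 ≤ 2 * (orb ν + orb (ν * ν))
      omega
  · simp [m, Dg.letter]
  · intro k hk
    simp [Dg.cnt, m]; omega

/-- A doubly infinite periodic word that can be read along a face. -/
structure Tmpl (P Q : ℤ) (N : ℕ) (g : ℤ → Fin 2) (s : ℤ → Bool) (x : ℤ → ℤ) : Prop where
  per_g : ∀ i, g (i + N) = g i
  per_s : ∀ i, s (i + N) = s i
  per_x : ∀ i, x (i + N) = x i
  x_nonneg : ∀ i, 0 ≤ x i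
  x_lt : ∀ i, x i < P
  x_next : ∀ i, x (i + 1) = x i + Q - if s (i + 1) = s i then 0 else P
  gen_next : ∀ i, g (i + 1) ≠ g i

theorem Tmpl.rev {P Q : ℤ} {N : ℕ} {g : ℤ → Fin 2} {s : ℤ → Bool} {x : ℤ → ℤ}
    (h : Tmpl P Q N g s x) :
    Tmpl P Q N (fun i => g (-1 - i)) (fun i => !s (-1 - i)) (fun i => P - 1 - x (-1 - i)) where
  per_g i := by
    have := h.per_g (-1 - (i + N)); rw [← this]; congr 1; ring
  per_s i := by
    have := h.per_s (-1 - (i + N)); rw [← this]; congr 2; ring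
  per_x i := by
    have := h.per_x (-1 - (i + N)); rw [← this]; congr 2; ring
  x_nonneg i := by have := h.x_lt (-1 - i); omega
  x_lt i := by have := h.x_nonneg (-1 - i); omega
  x_next i := by
    have := h.x_next (-1 - (i + 1))
    rw [show (-1 - (i + 1) + 1 : ℤ) = -1 - i by ring] at this
    simp only [Bool.not_inj_iff]
    split_ifs at this ⊢ with h1 h2 h2
    · omega
    · exact absurd h1.symm h2
    · exact absurd h2.symm h1
    · omega
  gen_next i := by
    have := h.gen_next (-1 - (i + 1))
    rw [show (-1 - (i + 1) + 1 : ℤ) = -1 - i by ring] at this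
    exact this.symm

theorem periodic_congr {X : Type} {N : ℕ} {f : ℤ → X} (hf : ∀ i, f (i + N) = f i) {a b : ℤ}
    (h : (a : ZMod N) = (b : ZMod N)) : f a = f b := by
  have hp : Periodic f (N : ℤ) := hf
  obtain ⟨k, hk⟩ := (ZMod.intCast_eq_intCast_iff_dvd_sub a b N).1 h
  have : b = a + k * N := by linarith
  rw [this]
  exact ((hp.int_mul k) a).symm

/-- The shift of the two faces of the sphere cut along a closed path of length `N`. -/
def shiftPerm (N : ℕ) : Perm (ZMod N × Bool) where
  toFun z := (if z.2 then z.1 - 1 else z.1 + 1, z.2)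
  invFun z := (if z.2 then z.1 + 1 else z.1 - 1, z.2)
  left_inv := by rintro ⟨i, b⟩; cases b <;> simp
  right_inv := by rintro ⟨i, b⟩; cases b <;> simp

def flipPerm (N : ℕ) : Perm (ZMod N × Bool) := (Equiv.refl _).prodCongr Equiv.boolNot

theorem planar_shift (N : ℕ) [NeZero N] : Planar (shiftPerm N) (flipPerm N) := by
  have hF : ∀ (i : ℕ), Rel (shiftPerm N) (flipPerm N) ((i : ZMod N), false) (0, false) := by
    intro i
    induction i with
    | zero => simpa using Rel.refl _ _ _
    | succ i ih =>
      refine Rel.trans ?_ ih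
      have := (Rel.face (shiftPerm N) (flipPerm N) ((i : ZMod N), false)).symm
      simpa [shiftPerm] using this
  have hF' : ∀ i : ZMod N, Rel (shiftPerm N) (flipPerm N) (i, false) (0, false) := by
    intro i
    simpa using hF i.val
  refine ⟨{(0, false)}, ?_, ?_⟩
  · rintro ⟨i, b⟩
    refine ⟨(0, false), by simp, ?_⟩
    cases b
    · exact hF' i
    · exact Rel.trans (Rel.edge (shiftPerm N) (flipPerm N) (i, true)) (hF' i)
  · have h1 := card_range_le_orb (shiftPerm N) (fun z => z.2) (fun _ => rfl)
    have h2 := card_range_le_orb (shiftPerm N * flipPerm N)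
      (fun z => if z.2 then z.1 + 1 else z.1)
      (by rintro ⟨i, b⟩; cases b <;> simp [shiftPerm, flipPerm])
    rw [Surjective.range_eq (fun b => ⟨(0, b), rfl⟩)] at h1
    rw [Surjective.range_eq (fun i => ⟨(i, false), rfl⟩)] at h2
    rw [Nat.card_univ, Nat.card_eq_fintype_card, Fintype.card_bool] at h1
    rw [Nat.card_univ, Nat.card_eq_fintype_card, ZMod.card] at h2
    simp only [Finset.card_singleton, Fintype.card_prod, ZMod.card, Fintype.card_bool]
    omega

theorem ex_base (π : Par) {k N : ℕ} (hk : k < 3) (hN0 : N ≠ 0) (hN : π.N k = N)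
    {g : ℤ → Fin 2} {s : ℤ → Bool} {x : ℤ → ℤ} (h : Tmpl (π.P k) (π.Q k) N g s x) :
    Ex π (fun j => if j = k then N else 0) ((List.range N).map fun i : ℕ => (g i, s i)) := by
  have : NeZero N := ⟨hN0⟩
  let m : Dg (ZMod N × Bool) :=
    { φ := shiftPerm N
      α := flipPerm N
      gen := fun z => g z.1.val
      sg := fun z => if z.2 then !s z.1.val else s z.1.val
      kind := fun z => if z.2 then k else 4
      x := fun z => π.P k - 1 - x z.1.val }
  have val_sub : ∀ i : ZMod N, ((((i - 1).val : ℕ) : ℤ) : ZMod N) = ((i.val - 1 : ℤ) : ZMod N) := by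
    intro i; simp
  have mem : ∀ i : ZMod N, ∃ j < N, (j : ZMod N) = i := fun i => ⟨i.val, ZMod.val_lt i, by simp⟩
  refine ⟨ZMod N × Bool, inferInstance, inferInstance, m,
    (List.range N).map fun j : ℕ => ((j : ZMod N), false), ?_, ?_, ?_⟩
  · refine
    { planar := planar_shift N
      inv := by rintro ⟨i, b⟩; simp [m, flipPerm]
      fpf := by rintro ⟨i, b⟩; simp [m, flipPerm]
      gen_edge := by rintro ⟨i, b⟩; simp [m, flipPerm]
      sg_edge := by rintro ⟨i, b⟩; cases b <;> simp [m, flipPerm]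
      face := ?_
      junk := ?_
      kind_le := ?_
      free := ?_
      nodup := ?_
      cyc := ?_ }
    · rintro ⟨i, b⟩ hb
      have hb : b = true := by
        by_contra hcon
        simp [m, hcon] at hb
      subst hb
      have e1 : m.φ (i, true) = (i - 1, true) := rfl
      have hx := h.x_next (i.val - 1)
      rw [sub_add_cancel] at hx
      constructor
      · rfl
      · have := h.x_lt i.val; simp only [m]; omega
      · have := h.x_nonneg i.val; simp only [m, if_true]; omega
      · rw [e1]
        simp only [m, if_true, Bool.not_inj_iff]
        rw [periodic_congr h.per_x (val_sub i), periodic_congr h.per_s (val_sub i)]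
        split_ifs at hx ⊢ with h1 h2 h2
        · omega
        · exact absurd h1.symm h2
        · exact absurd h2.symm h1
        · omega
      · rw [e1]
        simp only [m]
        rw [periodic_congr h.per_g (val_sub i)]
        have := h.gen_next (i.val - 1)
        rw [sub_add_cancel] at this
        exact this.symm
      · intro j
        have hj : m.φ^[j] (i, true) = (i - j, true) := by
          induction j with
          | zero => simp
          | succ j ih =>
            rw [iterate_succ_apply', ih]
            simp only [m, shiftPerm, coe_fn_mk, if_true, Nat.cast_succ]
            rw [sub_sub]
        rw [hj]
        simp only [m, if_true, hN, Prod.mk.injEq, and_true, sub_eq_self]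
        exact ZMod.natCast_eq_zero_iff j N
    · rintro ⟨i, b⟩ hb
      cases b <;> simp [m] at hb
      omega
    · rintro ⟨i, b⟩
      cases b <;> simp [m]
      omega
    · rintro ⟨i, b⟩
      obtain ⟨j, hj, rfl⟩ := mem i
      cases b
      · simp only [m, List.mem_map, List.mem_range, Prod.mk.injEq, and_true]
        simp only [Bool.false_eq_true, if_false, iff_true]
        exact ⟨j, hj, rfl⟩
      · simp [m]; omega
    · refine List.Nodup.map_on ?_ List.nodup_range
      intro a ha b hb hab
      rw [List.mem_range] at ha hb
      have := (ZMod.natCast_eq_natCast_iff' a b N).1 (Prod.mk.inj hab).1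
      rwa [Nat.mod_eq_of_lt ha, Nat.mod_eq_of_lt hb] at this
    · refine List.ext_getElem (by simp) ?_
      intro i h1 h2
      simp [List.getElem_rotate, m, shiftPerm]
  · rw [List.map_map]
    refine List.map_congr_left fun i hi => ?_
    rw [List.mem_range] at hi
    have : ((i : ZMod N)).val = i := by rw [ZMod.val_natCast, Nat.mod_eq_of_lt hi]
    simp only [m, Dg.letter, comp_apply, this, Bool.false_eq_true, if_false]
  · intro j hj
    unfold Dg.cnt
    have : (Finset.univ.filter fun d => m.kind d = j) =
        if j = k then Finset.univ.filter (fun d : ZMod N × Bool => d.2 = true) else ∅ := by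
      ext ⟨i, b⟩
      split_ifs with h1
      · subst h1; cases b <;> simp [m]; omega
      · cases b <;> simp [m] <;> omega
    rw [this]
    split_ifs
    · have : (Finset.univ.filter (fun d : ZMod N × Bool => d.2 = true)) =
          Finset.univ ×ˢ {true} := by ext ⟨i, b⟩; simp
      rw [this]; simp only [Finset.card_product, Finset.card_univ, ZMod.card,
        Finset.card_singleton, mul_one, if_pos, *]
    · simp [*]

end

section
open Equiv Function
set_option linter.unusedSectionVars false

/-! ### The words `u_s` as templates -/

def lgen (i : ℤ) : Fin 2 := ⟨(i % 2).toNat, by omega⟩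

def lsg (p q : ℤ) (i : ℤ) : Bool := decide (Even (i * q / p))

def lx (p q : ℤ) (i : ℤ) : ℤ := i * q % p

theorem tmpl_word {p q : ℤ} (hp : 0 < p) (hq0 : 0 ≤ q) (hqp : q ≤ p) {N n : ℕ}
    (hN : (N : ℤ) = 2 * p * n) : Tmpl p q N lgen (lsg p q) (lx p q) where
  per_g i := by
    simp only [lgen, hN, Fin.mk.injEq]
    congr 1
    rw [show i + 2 * p * n = i + 2 * (p * n) by ring, Int.add_mul_emod_self_left]
  per_s i := by
    unfold lsg
    rw [hN, show (i + 2 * p * n) * q = i * q + p * (2 * (n * q)) by ring,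
      Int.add_mul_ediv_left _ _ hp.ne', decide_eq_decide]
    simp [Int.even_add]
  per_x i := by
    unfold lx
    rw [hN, show (i + 2 * p * n) * q = i * q + p * (2 * (n * q)) by ring,
      Int.add_mul_emod_self_left]
  x_nonneg i := Int.emod_nonneg _ hp.ne'
  x_lt i := Int.emod_lt_of_pos _ hp
  x_next i := by
    unfold lx lsg
    have e1 := Int.mul_ediv_add_emod (i * q) p
    have e2 := Int.mul_ediv_add_emod ((i + 1) * q) p
    have a1 := Int.emod_nonneg (i * q) hp.ne'
    have a2 := Int.emod_lt_of_pos (i * q) hp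
    have b1 := Int.emod_nonneg ((i + 1) * q) hp.ne'
    have b2 := Int.emod_lt_of_pos ((i + 1) * q) hp
    generalize i * q % p = x at *
    generalize (i + 1) * q % p = y at *
    generalize hu : i * q / p = u at *
    generalize hv : (i + 1) * q / p = v at *
    have h3 : p * (v - u) = x + q - y := by linarith
    have h4 : 0 ≤ v - u := by
      by_contra hcon
      nlinarith
    have h5 : v - u ≤ 1 := by
      by_contra hcon
      nlinarith
    have h6 : v = u ∨ v = u + 1 := by omega
    rcases h6 with rfl | rfl
    · simp at h3 ⊢; omega
    · have : ¬ (decide (Even (u + 1)) = decide (Even u)) := by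
        rw [decide_eq_decide, Int.even_add_one]; tauto
      rw [if_neg this]
      linarith
  gen_next i := by
    simp only [lgen, ne_eq, Fin.mk.injEq]
    omega

/-- The first `N` letters of a bi-infinite word. -/
def wd (g : ℤ → Fin 2) (s : ℤ → Bool) (N : ℕ) : List (Fin 2 × Bool) :=
  (List.range N).map fun i : ℕ => (g i, s i)

theorem mk_map_range (f : ℕ → Fin 2 × Bool) (N : ℕ) :
    FreeGroup.mk ((List.range N).map f) = ((List.range N).map fun i => FreeGroup.mk [f i]).prod := by
  induction N with
  | zero => rfl
  | succ N ih =>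
    rw [List.range_succ, List.map_append, List.map_append, List.prod_append, ← ih,
      ← FreeGroup.mul_mk]
    simp

theorem uWord_eq {s : ℚ} (h0 : 0 ≤ s) :
    uWord s = FreeGroup.mk (wd lgen (lsg s.den s.num) (2 * s.den)) := by
  unfold wd uWord
  rw [mk_map_range]
  congr 1
  refine List.map_congr_left fun i _ => ?_
  have e1 : ⌊(i : ℚ) * s⌋ = (i : ℤ) * s.num / s.den := by
    rw [← Rat.floor_intCast_div_natCast]
    congr 1
    push_cast
    rw [mul_div_assoc, Rat.num_div_den]
  have hnn : 0 ≤ ⌊(i : ℚ) * s⌋ := Int.floor_nonneg.2 (by positivity)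
  have e2 : Even (⌊(i : ℚ) * s⌋.toNat) ↔ Even ((i : ℤ) * s.num / s.den) := by
    rw [← e1, ← Int.even_coe_nat, Int.toNat_of_nonneg hnn]
  have e3 : gen i = FreeGroup.mk [(lgen i, true)] := by
    unfold gen lgen FreeGroup.of
    congr 3
  simp only [lsg]
  by_cases he : Even (⌊(i : ℚ) * s⌋.toNat)
  · rw [he.neg_one_pow, decide_eq_true (e2.1 he), zpow_one, e3]
  · rw [(Nat.not_even_iff_odd.1 he).neg_one_pow, decide_eq_false (fun h => he (e2.2 h)), e3,
      zpow_neg_one, FreeGroup.inv_mk]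
    rfl

theorem mk_wd_pow {g : ℤ → Fin 2} {s : ℤ → Bool} {N : ℕ} (hg : ∀ i, g (i + N) = g i)
    (hs : ∀ i, s (i + N) = s i) (n : ℕ) :
    FreeGroup.mk (wd g s (N * n)) = FreeGroup.mk (wd g s N) ^ n := by
  induction n with
  | zero => rfl
  | succ n ih =>
    have hg' : Periodic g (N : ℤ) := hg
    have hs' : Periodic s (N : ℤ) := hs
    rw [pow_succ, ← ih, FreeGroup.mul_mk]
    congr 1
    unfold wd
    rw [Nat.mul_succ, List.range_add, List.map_append, List.map_map]
    congr 1
    refine List.map_congr_left fun i _ => ?_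
    simp only [comp_apply]
    have e : ((N * n + i : ℕ) : ℤ) = i + n * N := by push_cast; ring
    rw [e]
    exact Prod.ext (hg'.int_mul n i) (hs'.int_mul n i)

theorem mk_wd_inv {g : ℤ → Fin 2} {s : ℤ → Bool} {N : ℕ} (hg : ∀ i, g (i + N) = g i)
    (hs : ∀ i, s (i + N) = s i) :
    (FreeGroup.mk (wd g s N))⁻¹ =
      FreeGroup.mk (wd (fun i => g (-1 - i)) (fun i => !s (-1 - i)) N) := by
  rw [FreeGroup.inv_mk]
  congr 1
  unfold FreeGroup.invRev wd
  refine List.ext_getElem (by simp) fun i h1 h2 => ?_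
  simp only [List.length_map, List.length_range] at h2
  simp only [List.getElem_reverse, List.getElem_map, List.getElem_range, List.length_map,
    List.length_range]
  have e : ((N - 1 - i : ℕ) : ℤ) = (-1 - i) + N := by omega
  rw [e, hg, hs]

/-! ### Diagrams from conjugacies -/

def Good (π : Par) (g : FreeGroup (Fin 2)) : Prop :=
  ∃ c W, Ex π c W ∧ FreeGroup.mk W = g ∧ W ≠ [] ∧ c 0 = π.N 0 ∧ c 1 = 0

theorem Good.conj_letter {π : Par} {g : FreeGroup (Fin 2)} (hg : Good π g) (a : Fin 2) (b : Bool) :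
    Good π (FreeGroup.mk [(a, b)] * g * (FreeGroup.mk [(a, b)])⁻¹) := by
  obtain ⟨c, W, hW, rfl, hne, h0, h1⟩ := hg
  have h := (hW.append (ex_spur π a (!b)) hne (by simp)).rotate
    (W' := (a, b) :: (W ++ [(a, !b)])) (by
      have := List.isRotated_append (l := W ++ [(a, !b)]) (l' := [(a, b)])
      simpa using this)
  refine ⟨_, _, h, ?_, by simp, by simpa using h0, by simpa using h1⟩
  simp [FreeGroup.inv_mk, FreeGroup.invRev, FreeGroup.mul_mk]

theorem Good.conj {π : Par} {g : FreeGroup (Fin 2)} (hg : Good π g) (h : FreeGroup (Fin 2)) :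
    Good π (h * g * h⁻¹) := by
  obtain ⟨L, rfl⟩ : ∃ L, FreeGroup.mk L = h := ⟨h.toWord, FreeGroup.mk_toWord⟩
  induction L with
  | nil => simpa [← FreeGroup.one_eq_mk] using hg
  | cons l L ih =>
    have := ih.conj_letter l.1 l.2
    have e : FreeGroup.mk (l :: L) = FreeGroup.mk [l] * FreeGroup.mk L := by
      rw [FreeGroup.mul_mk]; rfl
    rw [e, mul_inv_rev]
    simpa only [mul_assoc] using this

theorem Good.mul {π : Par} {g : FreeGroup (Fin 2)} (hg : Good π g) {c : ℕ → ℕ}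
    {R : List (Fin 2 × Bool)} (hR : Ex π c R) (hne : R ≠ []) (h0 : c 0 = 0) (h1 : c 1 = 0) :
    Good π (g * FreeGroup.mk R) := by
  obtain ⟨c', W, hW, rfl, hne', h0', h1'⟩ := hg
  exact ⟨_, _, hW.append hR hne' hne, by rw [FreeGroup.mul_mk], by simp [hne], by simp [h0, h0'],
    by simp [h1, h1']⟩

theorem Good.mul_normalClosure {π : Par} {u : FreeGroup (Fin 2)}
    (hu : ∀ g, Good π g → Good π (g * u)) (hu' : ∀ g, Good π g → Good π (g * u⁻¹))
    {z : FreeGroup (Fin 2)} (hz : z ∈ Subgroup.normalClosure {u}) {g : FreeGroup (Fin 2)}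
    (hg : Good π g) : Good π (g * z) := by
  have key : (∀ g, Good π g → Good π (g * z)) ∧ (∀ g, Good π g → Good π (g * z⁻¹)) := by
    refine Subgroup.closure_induction (p := fun z _ => (∀ g, Good π g → Good π (g * z)) ∧
      (∀ g, Good π g → Good π (g * z⁻¹))) ?_ ?_ ?_ ?_ hz
    · intro x hx
      obtain ⟨_, hy, hc⟩ := Group.mem_conjugatesOfSet_iff.1 hx
      rw [Set.mem_singleton_iff.1 hy] at hc
      obtain ⟨h, rfl⟩ := isConj_iff.1 hc
      constructor
      · intro g hg
        have := (hu _ (hg.conj h⁻¹)).conj h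
        simpa [mul_assoc] using this
      · intro g hg
        have := (hu' _ (hg.conj h⁻¹)).conj h
        simpa [mul_assoc] using this
    · simp
    · rintro x y _ _ ⟨hx, hx'⟩ ⟨hy, hy'⟩
      refine ⟨fun g hg => ?_, fun g hg => ?_⟩
      · rw [← mul_assoc]; exact hy _ (hx _ hg)
      · rw [mul_inv_rev, ← mul_assoc]; exact hx' _ (hy' _ hg)
    · rintro x _ ⟨hx, hx'⟩
      exact ⟨hx', by simpa using hx⟩
  exact key.1 g hg

theorem Good.of_isConj {π : Par} {u v w : FreeGroup (Fin 2)}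
    (hu : ∀ g, Good π g → Good π (g * u)) (hu' : ∀ g, Good π g → Good π (g * u⁻¹))
    (hv : Good π v) (h : IsConj (QuotientGroup.mk' (Subgroup.normalClosure {u}) v)
      (QuotientGroup.mk' (Subgroup.normalClosure {u}) w)) : Good π w := by
  obtain ⟨c, hc⟩ := isConj_iff.1 h
  obtain ⟨c, rfl⟩ := QuotientGroup.mk'_surjective _ c
  rw [← map_inv, ← map_mul, ← map_mul] at hc
  have h2 : (c * v * c⁻¹)⁻¹ * w ∈ Subgroup.normalClosure {u} := QuotientGroup.eq.1 hc
  have := Good.mul_normalClosure hu hu' h2 (hv.conj c)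
  rwa [mul_inv_cancel_left] at this

theorem Good.exists_ex {π : Par} {W : List (Fin 2 × Bool)} (h : Good π (FreeGroup.mk W))
    (hW : FreeGroup.IsReduced W) : ∃ c, Ex π c W ∧ c 0 = π.N 0 ∧ c 1 = 0 := by
  obtain ⟨c, W', h1, h2, -, h3⟩ := h
  obtain ⟨W₁, hr1, hr2⟩ := FreeGroup.Red.exact.1 h2
  obtain rfl := hW.red_iff_eq.1 hr2
  exact ⟨c, h1.red hr1, h3⟩

theorem isReduced_wd {g : ℤ → Fin 2} {s : ℤ → Bool} (hg : ∀ i, g (i + 1) ≠ g i) (N : ℕ) :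
    FreeGroup.IsReduced (wd g s N) := by
  unfold wd FreeGroup.IsReduced
  rw [List.isChain_map, List.isChain_iff_getElem]
  intro i hi h
  simp only [List.getElem_range] at h
  exact absurd h.symm (by simpa using hg i)

/-- Sizes of the faces attached to slopes `s`, `s'` (special faces) and `r` (relators). -/
def par (n : ℕ) (r s s' : ℚ) : Par where
  P k := if k = 0 then s.den else if k = 1 then s'.den else r.den
  Q k := if k = 0 then s.num else if k = 1 then s'.num else r.num
  N k := if k = 0 then 2 * s.den else if k = 1 then 2 * s'.den else 2 * r.den * n

theorem tmpl_of_rat {s : ℚ} (h0 : 0 ≤ s) (h1 : s ≤ 1) (n : ℕ) :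
    Tmpl s.den s.num (2 * s.den * n) lgen (lsg s.den s.num) (lx s.den s.num) :=
  tmpl_word (by exact_mod_cast s.den_pos) (Rat.num_nonneg.2 h0)
    (by have := Rat.num_le_denom_iff.2 h1; exact_mod_cast this) (n := n) (by push_cast; ring)

theorem good_of_isConj {n : ℕ} (hn : n ≠ 0) {r s : ℚ} {s' : ℚ} (hr0 : 0 ≤ r) (hr1 : r ≤ 1)
    (hs0 : 0 ≤ s) (hs1 : s ≤ 1) {w : F}
    (h : IsConj (heckQ r n (uWord s)) (heckQ r n w)) : Good (par n r s s') w := by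
  have ts := tmpl_of_rat hs0 hs1 1
  have tr := tmpl_of_rat hr0 hr1 n
  have tr1 := tmpl_of_rat hr0 hr1 1
  have hrd := r.den_pos
  have hsd := s.den_pos
  rw [mul_one] at ts tr1
  have hpow : FreeGroup.mk (wd lgen (lsg r.den r.num) (2 * r.den * n)) = uWord r ^ n := by
    rw [uWord_eq hr0, mk_wd_pow tr1.per_g tr1.per_s]
  refine Good.of_isConj (u := uWord r ^ n) ?_ ?_ ?_ h
  · intro g hg
    rw [← hpow]
    refine hg.mul (ex_base (par n r s s') (k := 2) (by norm_num) (by positivity)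
      (by simp [par]) tr) ?_ (by simp) (by simp)
    simp [wd, hn]
  · intro g hg
    rw [← hpow, mk_wd_inv tr.per_g tr.per_s]
    refine hg.mul (ex_base (par n r s s') (k := 2) (by norm_num) (by positivity)
      (by simp [par]) tr.rev) ?_ (by simp) (by simp)
    simp [wd, hn]
  · refine ⟨_, _, ex_base (par n r s s') (k := 0) (by norm_num) (by positivity)
      (by simp [par]) ts, (uWord_eq hs0).symm, ?_, by simp [par], by simp⟩
    simp

theorem exists_ex_of_isConj {n : ℕ} (hn : n ≠ 0) {r s s' : ℚ} (hr0 : 0 ≤ r) (hr1 : r ≤ 1)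
    (hs0 : 0 ≤ s) (hs1 : s ≤ 1) (hs0' : 0 ≤ s') (hs1' : s' ≤ 1)
    (h : IsConj (heckQ r n (uWord s)) (heckQ r n (uWord s')) ∨
      IsConj (heckQ r n (uWord s)) ((heckQ r n (uWord s'))⁻¹)) :
    ∃ c g' sg' x', Tmpl s'.den s'.num (2 * s'.den) g' sg' x' ∧
      Ex (par n r s s') c (wd g' sg' (2 * s'.den)) ∧ c 0 = 2 * s.den ∧ c 1 = 0 := by
  have t := tmpl_of_rat hs0' hs1' 1
  rw [mul_one] at t
  rcases h with h | h
  · have := good_of_isConj (s' := s') hn hr0 hr1 hs0 hs1 h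
    rw [uWord_eq hs0'] at this
    obtain ⟨c, h1, h2⟩ := this.exists_ex (isReduced_wd t.gen_next _)
    exact ⟨c, _, _, _, t, h1, by simpa [par] using h2⟩
  · rw [← map_inv] at h
    have := good_of_isConj (s' := s') hn hr0 hr1 hs0 hs1 h
    rw [uWord_eq hs0', mk_wd_inv t.per_g t.per_s] at this
    obtain ⟨c, h1, h2⟩ := this.exists_ex (isReduced_wd t.rev.gen_next _)
    exact ⟨c, _, _, _, t.rev, h1, by simpa [par] using h2⟩

end

section
open Equiv Function
set_option linter.unusedSectionVars false

/-! ### Closing the free face -/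

theorem Valid.close {D : Type} [Fintype D] [DecidableEq D] {π : Par} {m : Dg D} {L : List D}
    {N : ℕ} {g : ℤ → Fin 2} {s : ℤ → Bool} {x : ℤ → ℤ} (h : Valid π m L)
    (hL : L.map m.letter = wd g s N) (hN0 : 0 < N) (hN : π.N 1 = N)
    (t : Tmpl (π.P 1) (π.Q 1) N g s x) (h1 : m.cnt 1 = 0) :
    ∃ m' : Dg D, Valid π m' [] ∧ m'.cnt 0 = m.cnt 0 ∧ m'.cnt 1 = N := by
  have hlen : L.length = N := by
    have := congrArg List.length hL
    simpa [wd] using this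
  have hlt : ∀ i, i % N < L.length := fun i => by rw [hlen]; exact Nat.mod_lt _ hN0
  let f : ℕ → D := fun i => L[i % N]'(hlt i)
  have hmem : ∀ i, f i ∈ L := fun i => List.getElem_mem _
  have hφ : ∀ i, m.φ (f i) = f (i + 1) := by
    intro i
    have e1 : (L.map m.φ)[i % N]'(by simpa using hlt i) = m.φ (f i) := by simp [f]
    rw [← e1]
    simp only [h.cyc, List.getElem_rotate, f]
    congr 1
    rw [hlen, Nat.mod_add_mod]
  have hit : ∀ i j, m.φ^[j] (f i) = f (i + j) := by
    intro i j
    induction j with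
    | zero => rfl
    | succ j ih => rw [iterate_succ_apply', ih, hφ]; rfl
  have hinj : ∀ i j, f i = f j ↔ i % N = j % N := by
    intro i j
    exact ⟨fun hh => (List.Nodup.getElem_inj_iff h.nodup).1 hh, fun hh => by simp only [f, hh]⟩
  have hsurj : ∀ d ∈ L, ∃ i, f i = d := by
    intro d hd
    obtain ⟨i, hi, rfl⟩ := List.getElem_of_mem hd
    refine ⟨i, ?_⟩
    simp only [f]
    congr 1
    exact Nat.mod_eq_of_lt (by omega)
  have hidx : ∀ i, L.idxOf (f i) = i % N := fun i => List.Nodup.idxOf_getElem h.nodup _ _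
  have hper : ∀ {X : Type} {w : ℤ → X}, (∀ i, w (i + N) = w i) → ∀ i : ℕ,
      w ((i % N : ℕ) : ℤ) = w (i : ℤ) := fun hw i => periodic_congr hw (by simp)
  have hlet : ∀ i, m.letter (f i) = (g i, s i) := by
    intro i
    have e1 : (L.map m.letter)[i % N]'(by simpa using hlt i) = m.letter (f i) := by simp [f]
    rw [← e1]
    simp only [hL, wd, List.getElem_map, List.getElem_range]
    rw [hper t.per_g, hper t.per_s]
  have hgen : ∀ i, m.gen (f i) = g i := fun i => congrArg Prod.fst (hlet i)
  have hsg : ∀ i, m.sg (f i) = s i := fun i => congrArg Prod.snd (hlet i)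
  let m' : Dg D := { m with
    kind := fun d => if d ∈ L then 1 else m.kind d
    x := fun d => if d ∈ L then x (L.idxOf d) else m.x d }
  have hkL : ∀ d ∈ L, m'.kind d = 1 := fun d hd => if_pos hd
  have hkn : ∀ d, d ∉ L → m'.kind d = m.kind d := fun d hd => if_neg hd
  have hx : ∀ i : ℕ, m'.x (f i) = x i := by
    intro i
    simp only [m', if_pos (hmem i), hidx]
    exact hper t.per_x i
  have hnot : ∀ d, m.kind d < 4 → d ∉ L := fun d hd hd' => by
    have := (h.free d).1 hd'; omega
  have hcnt : m'.cnt 1 = N := by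
    unfold Dg.cnt
    rw [← hlen, ← List.toFinset_card_of_nodup h.nodup]
    congr 1
    ext d
    simp only [Finset.mem_filter, Finset.mem_univ, true_and, List.mem_toFinset]
    refine ⟨fun hd => ?_, hkL d⟩
    by_contra hdL
    rw [hkn d hdL] at hd
    have := Finset.card_eq_zero.1 h1
    have hmm : d ∈ Finset.univ.filter fun d => m.kind d = 1 := by simp [hd]
    rw [this] at hmm
    simp at hmm
  refine ⟨m', ?_, ?_, hcnt⟩
  · refine
    { planar := h.planar
      inv := h.inv
      fpf := h.fpf
      gen_edge := h.gen_edge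
      sg_edge := h.sg_edge
      face := ?_
      junk := ?_
      kind_le := ?_
      free := ?_
      nodup := List.nodup_nil
      cyc := rfl }
    · intro d hd
      by_cases hdL : d ∈ L
      · obtain ⟨i, rfl⟩ := hsurj d hdL
        have e : m'.φ (f i) = f (i + 1) := hφ i
        refine ⟨?_, ?_, ?_, ?_, ?_, ?_⟩
        · rw [e, hkL _ (hmem _), hkL _ (hmem _)]
        · rw [hx]; exact t.x_nonneg _
        · rw [hx, hkL _ (hmem _)]; exact t.x_lt _
        · rw [e, hkL _ (hmem _), hx, hx]
          have := t.x_next i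
          rw [show m'.sg = m.sg from rfl, hsg, hsg]
          push_cast
          exact this
        · rw [e, show m'.gen = m.gen from rfl, hgen, hgen]
          push_cast
          exact t.gen_next i
        · intro j
          rw [hkL _ (hmem _), hN, show m'.φ = m.φ from rfl, hit, hinj]
          constructor
          · intro hh
            exact (Nat.add_modEq_left_iff).1 hh
          · intro hh
            exact (Nat.add_modEq_left_iff).2 hh
      · have hk := hkn d hdL
        rw [hk] at hd
        refine Face.transport (j := id) (m := m) (m' := m') injective_id (T := fun e => m.kind e < 3) ?_
          (fun e _ => rfl) (fun e he => hkn e (hnot e (by omega))) (fun e _ => rfl)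
          (fun e _ => rfl) (fun e he => if_neg (hnot e (by omega))) hd (h.face d hd)
        intro e he
        rw [(h.face e he).kind_next]
        exact he
    · intro d hd
      by_cases hdL : d ∈ L
      · rw [hkL d hdL] at hd; omega
      · rw [hkn d hdL] at hd
        obtain ⟨j1, j2, j3⟩ := h.junk d hd
        refine ⟨j1, j2, ?_⟩
        rw [hkn _ (hnot _ (by rw [show m'.α = m.α from rfl]; omega))]
        exact j3
    · intro d
      by_cases hdL : d ∈ L
      · rw [hkL d hdL]; omega
      · rw [hkn d hdL]; exact h.kind_le d
    · intro d
      simp only [List.not_mem_nil, false_iff]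
      by_cases hdL : d ∈ L
      · rw [hkL d hdL]; omega
      · rw [hkn d hdL]; exact fun hh => hdL ((h.free d).2 hh)
  · unfold Dg.cnt
    congr 1
    ext d
    simp only [Finset.mem_filter, Finset.mem_univ, true_and]
    by_cases hdL : d ∈ L
    · rw [hkL d hdL, (h.free d).1 hdL]; omega
    · rw [hkn d hdL]

end

section
open Equiv Function
set_option linter.unusedSectionVars false

/-! ### Cancelling mirror relator faces -/

section Merge
variable {D : Type} [Fintype D] [DecidableEq D] {π : Par} {m : Dg D}

/-- `v` is a mirror image of `u` in the relator. -/
structure Mirror (π : Par) (m : Dg D) (u v : D) : Prop where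
  kind_left : m.kind u = 2
  kind_right : m.kind v = 2
  x : m.x v = π.P 2 - 1 - m.x u
  sg : m.sg v = !m.sg u
  gen : m.gen v = m.gen u

theorem Mirror.symm {u v : D} (h : Mirror π m u v) : Mirror π m v u :=
  ⟨h.kind_right, h.kind_left, by rw [h.x]; ring, by rw [h.sg]; simp, h.gen.symm⟩

theorem Mirror.step (hf : ∀ d, m.kind d < 3 → Face π m d) {d e : D}
    (h : Mirror π m (m.φ d) e) (hd : m.kind d = 2) : Mirror π m d (m.φ e) := by
  have fd := hf d (by omega)
  have fe := hf e (by rw [h.kind_right]; omega)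
  have fe' := hf (m.φ e) (by rw [fe.kind_next, h.kind_right]; omega)
  have hP := fd.x_lt
  have h0 := fd.x_nonneg
  have hP' := fe'.x_lt
  have h0' := fe'.x_nonneg
  have hx := fd.x_next
  have hx' := fe.x_next
  have hm := h.x
  have hs := h.sg
  rw [fe.kind_next, h.kind_right] at hP'
  rw [h.kind_right] at hx'
  rw [hd] at hP hx
  have hc : m.sg (m.φ e) = m.sg e ↔ m.sg (m.φ d) = m.sg d := by
    by_cases c1 : m.sg (m.φ d) = m.sg d <;> by_cases c2 : m.sg (m.φ e) = m.sg e <;>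
      simp only [c1, c2, if_true, if_false, true_iff, iff_true] at hx hx' ⊢ <;> omega
  refine ⟨hd, by rw [fe.kind_next, h.kind_right], ?_, ?_, ?_⟩
  · rw [hx', hm, hx]
    by_cases c1 : m.sg (m.φ d) = m.sg d
    · rw [if_pos c1, if_pos (hc.2 c1)]; ring
    · rw [if_neg c1, if_neg (fun c => c1 (hc.1 c))]; ring
  · revert hc hs
    cases m.sg (m.φ e) <;> cases m.sg e <;> cases m.sg (m.φ d) <;> cases m.sg d <;> simp
  · have g1 := fd.gen_next
    have g2 := fe.gen_next
    rw [h.gen] at g2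
    omega

theorem Face.gen_iterate (hf : ∀ d, m.kind d < 3 → Face π m d) {d : D} (hd : m.kind d < 3)
    (i : ℕ) : m.kind (m.φ^[i] d) = m.kind d ∧ (m.gen (m.φ^[i] d) = m.gen d ↔ Even i) := by
  induction i with
  | zero => simp
  | succ i ih =>
    rw [iterate_succ_apply']
    have h := hf (m.φ^[i] d) (by rw [ih.1]; exact hd)
    refine ⟨by rw [h.kind_next, ih.1], ?_⟩
    have h1 := h.gen_next
    rw [Nat.even_add_one, ← ih.2]
    omega

theorem map_cycle {φ : Perm D} {v : D} {K : ℕ} (h : φ^[K + 1] v = v) :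
    (v :: (List.range K).map fun i => φ^[i + 1] v).map φ =
      (v :: (List.range K).map fun i => φ^[i + 1] v).rotate 1 := by
  rw [List.rotate_cons_succ, List.rotate_zero]
  have e1 : (v :: (List.range K).map fun i => φ^[i + 1] v) =
      (List.range (K + 1)).map fun i => φ^[i] v := by
    rw [List.range_succ_eq_map, List.map_cons, List.map_map]; rfl
  have e2 : (List.range K).map (fun i => φ^[i + 1] v) ++ [v] =
      (List.range (K + 1)).map fun i => φ^[i + 1] v := by
    rw [List.range_succ, List.map_append]
    simp only [List.map_cons, List.map_nil, h]
  rw [e1, e2, List.map_map]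
  refine List.map_congr_left fun i _ => ?_
  rw [comp_apply, iterate_succ_apply']

theorem nodup_cycle {φ : Perm D} {v : D} {N : ℕ} (h : ∀ i, φ^[i] v = v ↔ N ∣ i) :
    ((List.range N).map fun i => φ^[i] v).Nodup := by
  refine List.Nodup.map_on ?_ List.nodup_range
  have key : ∀ i j, i ≤ j → j < N → φ^[i] v = φ^[j] v → i = j := by
    intro i j hij hj he
    have : φ^[i] (φ^[j - i] v) = φ^[i] v := by
      rw [← iterate_add_apply, Nat.add_sub_cancel' hij, he]
    have := (h _).1 ((φ.injective.iterate i) this)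
    have := Nat.eq_zero_of_dvd_of_lt this (by omega)
    omega
  intro i hi j hj he
  rw [List.mem_range] at hi hj
  rcases le_total i j with hh | hh
  · exact key i j hh hj he
  · exact (key j i hh hi he.symm).symm

theorem Valid.merge (h : Valid π m []) (hN0 : 0 < π.N 2) {d₀ : D}
    (hd : m.kind d₀ = 2) (he : m.kind (m.α d₀) = 2) (hx : m.x (m.α d₀) = π.P 2 - 1 - m.x d₀) :
    ∃ m' : Dg D, Valid π m' [] ∧ m'.cnt 0 = m.cnt 0 ∧ m'.cnt 1 = m.cnt 1 ∧
      m'.cnt 2 < m.cnt 2 := by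
  obtain ⟨e₀, hee⟩ : ∃ e, e = m.α d₀ := ⟨_, rfl⟩
  obtain ⟨K, hK⟩ : ∃ K, π.N 2 = K + 1 := ⟨π.N 2 - 1, by omega⟩
  have hM : Mirror π m d₀ e₀ :=
    ⟨hd, hee ▸ he, hee ▸ hx, by rw [hee, h.sg_edge], by rw [hee, h.gen_edge]⟩
  have hperd : ∀ i, m.φ^[i] d₀ = d₀ ↔ K + 1 ∣ i := by
    have := (h.face d₀ (by omega)).period
    rwa [hd, hK] at this
  have hpere : ∀ i, m.φ^[i] e₀ = e₀ ↔ K + 1 ∣ i := by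
    have := (h.face e₀ (by rw [hM.kind_right]; omega)).period
    rwa [hM.kind_right, hK] at this
  have hd1 := (hperd (K + 1)).2 dvd_rfl
  have he1 := (hpere (K + 1)).2 dvd_rfl
  have hkd : ∀ i, m.kind (m.φ^[i] d₀) = 2 := fun i => by
    rw [(Face.gen_iterate h.face (by omega) i).1, hd]
  have hke : ∀ i, m.kind (m.φ^[i] e₀) = 2 := fun i => by
    rw [(Face.gen_iterate h.face (by rw [hM.kind_right]; omega) i).1, hM.kind_right]
  have hmir : ∀ j ≤ K + 1, Mirror π m (m.φ^[K + 1 - j] d₀) (m.φ^[j] e₀) := by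
    intro j
    induction j with
    | zero => intro _; rw [Nat.sub_zero, hd1]; exact hM
    | succ j ih =>
      intro hj
      have := ih (by omega)
      rw [iterate_succ_apply']
      rw [show K + 1 - j = (K + 1 - (j + 1)) + 1 by omega, iterate_succ_apply'] at this
      exact this.step h.face (hkd _)
  have hdis : ∀ k, m.φ^[k] d₀ ≠ e₀ := by
    intro k hk
    have hk' : m.φ^[k % (K + 1)] d₀ = e₀ := by
      rw [← hk]; exact IsPeriodicPt.iterate_mod_apply hd1 k
    have hlt := Nat.mod_lt k (Nat.succ_pos K)
    generalize k % (K + 1) = l at hk' hlt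
    have hev : Even l := by
      rw [← (Face.gen_iterate h.face (d := d₀) (by omega) l).2, hk', hM.gen]
    obtain ⟨j, rfl⟩ := hev
    have h2 := hmir (K + 1 - j) (by omega)
    rw [← hk', ← iterate_add_apply, show K + 1 - (K + 1 - j) = j by omega,
      show K + 1 - j + (j + j) = j + (K + 1) by omega, iterate_add_apply _ j (K + 1), hd1] at h2
    have := h2.sg
    simp at this
  obtain ⟨u, hu⟩ : ∃ u, u = m.φ^[K] d₀ := ⟨_, rfl⟩
  have hφu : m.φ u = d₀ := by rw [hu, ← iterate_succ_apply' m.φ, hd1]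
  have hui : ∀ i, m.φ^[i + 1] u = m.φ^[i] d₀ := fun i => by rw [iterate_succ_apply, hφu]
  have hperu : ∀ i, m.φ^[i] u = u ↔ K + 1 ∣ i := by
    intro i
    rw [← hperd, hu, ← iterate_add_apply, add_comm, iterate_add_apply]
    exact (m.φ.injective.iterate K).eq_iff
  obtain ⟨A, hA⟩ : ∃ A, A = (List.range K).map fun i => m.φ^[i + 1] u := ⟨_, rfl⟩
  obtain ⟨B, hB⟩ : ∃ B, B = (List.range K).map fun i => m.φ^[i + 1] e₀ := ⟨_, rfl⟩
  have cons_eq : ∀ v, v :: ((List.range K).map fun i => m.φ^[i + 1] v) =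
      (List.range (K + 1)).map fun i => m.φ^[i] v := fun v => by
    rw [List.range_succ_eq_map, List.map_cons, List.map_map]; rfl
  have hmemA : ∀ z, z ∈ u :: A ↔ ∃ i < K + 1, m.φ^[i] u = z := fun z => by
    rw [hA, cons_eq]; simp only [List.mem_map, List.mem_range]
  have hmemB : ∀ z, z ∈ e₀ :: B ↔ ∃ i < K + 1, m.φ^[i] e₀ = z := fun z => by
    rw [hB, cons_eq]; simp only [List.mem_map, List.mem_range]
  have hA1 : (u :: A).map m.φ = (u :: A).rotate 1 := hA ▸ map_cycle ((hperu _).2 dvd_rfl)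
  have hB1 : (e₀ :: B).map m.φ = (e₀ :: B).rotate 1 := hB ▸ map_cycle he1
  have hnd : ((u :: A) ++ (e₀ :: B)).Nodup := by
    rw [List.nodup_append]
    refine ⟨by rw [hA, cons_eq]; exact nodup_cycle hperu,
      by rw [hB, cons_eq]; exact nodup_cycle hpere, ?_⟩
    rintro a ha b hb rfl
    obtain ⟨i, -, hi⟩ := (hmemA a).1 ha
    obtain ⟨j, hj, hj'⟩ := (hmemB a).1 hb
    apply hdis (K + 1 - j + (i + K))
    rw [iterate_add_apply, iterate_add_apply, ← hu, hi, ← hj', ← iterate_add_apply,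
      Nat.sub_add_cancel hj.le, he1]
  have hcyc := map_mul_swap_eq_rotate hA1 hB1 hnd
  have hperm : (u :: B ++ e₀ :: A).Perm ((u :: A) ++ (e₀ :: B)) := by
    simp only [List.cons_append]
    refine List.Perm.cons _ ?_
    refine List.perm_middle.trans (List.Perm.trans ?_ List.perm_middle.symm)
    exact List.Perm.cons _ List.perm_append_comm
  obtain ⟨L, hL⟩ : ∃ L, L = u :: B ++ e₀ :: A := ⟨_, rfl⟩
  rw [← hL] at hcyc hperm
  have hmem : ∀ z, z ∈ L ↔ z ∈ u :: A ∨ z ∈ e₀ :: B := fun z => by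
    rw [hperm.mem_iff, List.mem_append]
  have huL : u ∈ L := (hmem u).2 (.inl (by simp))
  have heL : e₀ ∈ L := (hmem e₀).2 (.inr (by simp))
  have hk2 : ∀ z ∈ L, m.kind z = 2 := by
    intro z hz
    rcases (hmem z).1 hz with hz | hz
    · obtain ⟨i, -, rfl⟩ := (hmemA z).1 hz
      rw [hu, ← iterate_add_apply]; exact hkd _
    · obtain ⟨i, -, rfl⟩ := (hmemB z).1 hz
      exact hke _
  have hclosed : ∀ z, m.φ z ∈ L → z ∈ L := by
    intro z hz
    have hback : ∀ (v : D) (C : List D), (v :: C).map m.φ = (v :: C).rotate 1 →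
        m.φ z ∈ v :: C → z ∈ v :: C := by
      intro v C hC hz
      rw [← List.mem_rotate (n := 1), ← hC, List.mem_map] at hz
      obtain ⟨y, hy, hyz⟩ := hz
      rwa [← m.φ.injective hyz]
    rcases (hmem _).1 hz with hz | hz
    · exact (hmem _).2 (.inl (hback _ _ hA1 hz))
    · exact (hmem _).2 (.inr (hback _ _ hB1 hz))
  let m₁ : Dg D := { m with
    φ := m.φ * swap u e₀
    kind := fun z => if z ∈ L then 4 else m.kind z }
  have hφ₁ : ∀ z, z ∉ L → m₁.φ z = m.φ z := by
    intro z hz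
    change m.φ (swap u e₀ z) = _
    rw [swap_apply_of_ne_of_ne] <;> rintro rfl <;> exact hz ‹_›
  have hkL : ∀ z ∈ L, m₁.kind z = 4 := fun z hz => if_pos hz
  have hkn : ∀ z, z ∉ L → m₁.kind z = m.kind z := fun z hz => if_neg hz
  have hne4 : ∀ z, m.kind z ≠ 4 := fun z hz => by
    have := (h.free z).2 hz; simp at this
  have hv : Valid π m₁ L := by
    refine
    { planar := ?_
      inv := h.inv
      fpf := h.fpf
      gen_edge := h.gen_edge
      sg_edge := h.sg_edge
      face := ?_
      junk := ?_
      kind_le := ?_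
      free := ?_
      nodup := hperm.nodup_iff.2 hnd
      cyc := hcyc }
    · refine h.planar.mul_swap h.inv ?_ (.inr (.inl ?_))
      · rintro rfl
        rw [List.nodup_append] at hnd
        exact hnd.2.2 u (by simp) u (by simp) rfl
      · refine ⟨1, ?_⟩
        rw [zpow_one, Perm.mul_apply, h.inv, hφu, hee, h.inv]
    · intro d hdk
      have hdL : d ∉ L := fun hh => by rw [hkL d hh] at hdk; omega
      have hdk' := hkn d hdL ▸ hdk
      refine Face.transport (j := id) (m := m) (m' := m₁) injective_id
        (T := fun e => m.kind e < 3 ∧ e ∉ L) ?_ (fun e he => hφ₁ e he.2)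
        (fun e he => hkn e he.2) (fun _ _ => rfl) (fun _ _ => rfl) (fun _ _ => rfl)
        ⟨hdk', hdL⟩ (h.face d hdk')
      intro e he
      exact ⟨by rw [(h.face e he.1).kind_next]; exact he.1, fun hh => he.2 (hclosed e hh)⟩
    · intro d hdk
      have hdL : d ∉ L := fun hh => by rw [hkL d hh] at hdk; omega
      rw [hkn d hdL] at hdk
      obtain ⟨j1, j2, j3⟩ := h.junk d hdk
      have hαL : m.α d ∉ L := fun hh => by rw [hk2 _ hh] at j3; omega
      exact ⟨by rw [hφ₁ d hdL]; exact j1, by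
        change m₁.φ (m.α d) = d
        rw [hφ₁ _ hαL]; exact j2, (hkn _ hαL).trans j3⟩
    · intro d
      by_cases hdL : d ∈ L
      · rw [hkL d hdL]
      · rw [hkn d hdL]; exact h.kind_le d
    · intro d
      by_cases hdL : d ∈ L
      · simp [hkL d hdL, hdL]
      · simp [hkn d hdL, hdL, hne4]
  have hrot : L ~r (B ++ [e₀]) ++ (A ++ [u]) := by
    have := List.isRotated_append (l := [u]) (l' := B ++ e₀ :: A)
    rw [hL]; simpa using this
  have hv' := hv.of_isRotated hrot
  have hBe : B ++ [e₀] = (List.range (K + 1)).map fun i => m.φ^[i + 1] e₀ := by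
    rw [hB, List.range_succ, List.map_append]
    simp only [List.map_cons, List.map_nil, he1]
  have hAu : A ++ [u] = (List.range (K + 1)).map fun i => m.φ^[i] d₀ := by
    rw [hA, List.range_succ, List.map_append]
    simp only [List.map_cons, List.map_nil, hui]
    rw [hu]
  have hinv : (A ++ [u]).map m₁.letter = FreeGroup.invRev ((B ++ [e₀]).map m₁.letter) := by
    rw [hBe, hAu]
    unfold FreeGroup.invRev
    refine List.ext_getElem (by simp) fun i h1 h2 => ?_
    simp only [List.length_map, List.length_range] at h1
    simp only [List.getElem_reverse, List.getElem_map, List.getElem_range, List.length_map,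
      List.length_range]
    have := (hmir (K + 1 - 1 - i + 1) (by omega)).symm
    rw [show K + 1 - (K + 1 - 1 - i + 1) = i by omega] at this
    exact Prod.ext this.gen this.sg
  have hred : FreeGroup.Red (((B ++ [e₀]) ++ (A ++ [u])).map m₁.letter) [] := by
    rw [List.map_append, hinv]
    have : FreeGroup.mk ((B ++ [e₀]).map m₁.letter ++
        FreeGroup.invRev ((B ++ [e₀]).map m₁.letter)) = FreeGroup.mk [] := by
      rw [← FreeGroup.mul_mk, ← FreeGroup.inv_mk, mul_inv_cancel, FreeGroup.one_eq_mk]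
    obtain ⟨W, hW1, hW2⟩ := FreeGroup.Red.exact.1 this
    rw [FreeGroup.Red.nil_iff] at hW2
    rwa [hW2] at hW1
  obtain ⟨m₂, L₂, hv₂, hs₂, hl₂⟩ := hv'.red hred
  obtain rfl := List.map_eq_nil_iff.1 hl₂
  have hcnt : ∀ k < 2, m₁.cnt k = m.cnt k := by
    intro k hk
    unfold Dg.cnt
    congr 1
    ext z
    simp only [Finset.mem_filter, Finset.mem_univ, true_and]
    by_cases hz : z ∈ L
    · rw [hkL z hz, hk2 z hz]; omega
    · rw [hkn z hz]
  refine ⟨m₂, hv₂, (hs₂.cnt (by omega)).trans (hcnt 0 (by omega)),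
    (hs₂.cnt (by omega)).trans (hcnt 1 (by omega)), ?_⟩
  rw [hs₂.cnt (by omega)]
  unfold Dg.cnt
  refine Finset.card_lt_card (Finset.ssubset_iff_subset_ne.2 ⟨?_, ?_⟩)
  · intro z
    simp only [Finset.mem_filter, Finset.mem_univ, true_and]
    by_cases hz : z ∈ L
    · rw [hkL z hz]; omega
    · rw [hkn z hz]; exact id
  · intro heq
    have h1 : u ∈ Finset.univ.filter fun d => m.kind d = 2 := by simp [hk2 u huL]
    rw [← heq] at h1
    simp [hkL u huL] at h1

/-- A diagram with the given special faces in which no two relator faces cancel. -/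
theorem Valid.exists_reduced (h : Valid π m []) (hN0 : 0 < π.N 2) :
    ∃ m' : Dg D, Valid π m' [] ∧ m'.cnt 0 = m.cnt 0 ∧ m'.cnt 1 = m.cnt 1 ∧
      ∀ d, m'.kind d = 2 → m'.kind (m'.α d) = 2 → m'.x (m'.α d) ≠ π.P 2 - 1 - m'.x d := by
  induction hc : m.cnt 2 using Nat.strong_induction_on generalizing m with
  | _ c ih =>
    by_cases hred : ∀ d, m.kind d = 2 → m.kind (m.α d) = 2 → m.x (m.α d) ≠ π.P 2 - 1 - m.x d
    · exact ⟨m, h, rfl, rfl, hred⟩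
    · push Not at hred
      obtain ⟨d, h1, h2, h3⟩ := hred
      obtain ⟨m₁, hv, e0, e1, hlt⟩ := h.merge hN0 h1 h2 h3
      obtain ⟨m₂, hv₂, f0, f1, hr⟩ := ih _ (hc ▸ hlt) hv rfl
      exact ⟨m₂, hv₂, f0.trans e0, f1.trans e1, hr⟩

end Merge

end

section
open Equiv Function
set_option linter.unusedSectionVars false

/-! ### Curvature -/

section Curvature
variable {D : Type} [Fintype D] [DecidableEq D]

open Classical in
/-- The size of the cycle of `d`. -/
noncomputable def cyl (π : Perm D) (d : D) : ℕ :=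
  (Finset.univ.filter fun e => π.SameCycle d e).card

theorem cyl_pos (π : Perm D) (d : D) : 0 < cyl π d :=
  Finset.card_pos.2 ⟨d, by simp [Perm.SameCycle.refl]⟩

open Classical in
theorem orb_eq_sum (π : Perm D) : (orb π : ℚ) = ∑ d, 1 / (cyl π d : ℚ) := by
  have : Fintype (Quotient (Perm.SameCycle.setoid π)) := Fintype.ofFinite _
  rw [orb, Nat.card_eq_fintype_card, ← Finset.card_univ, Finset.cast_card,
    ← Finset.sum_fiberwise Finset.univ (fun d => (Quotient.mk (Perm.SameCycle.setoid π) d))]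
  refine Finset.sum_congr rfl fun q _ => ?_
  induction q using Quotient.inductionOn with
  | h d =>
    have hset : (Finset.univ.filter fun e =>
        Quotient.mk (Perm.SameCycle.setoid π) e = Quotient.mk (Perm.SameCycle.setoid π) d) =
        Finset.univ.filter fun e => π.SameCycle d e := by
      ext e
      simp only [Finset.mem_filter, Finset.mem_univ, true_and]
      rw [Quotient.eq]
      exact ⟨fun h => Perm.SameCycle.symm h, fun h => Perm.SameCycle.symm h⟩
    have hc : ∀ e ∈ Finset.univ.filter fun e => π.SameCycle d e,
        1 / (cyl π e : ℚ) = 1 / (cyl π d : ℚ) := by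
      intro e he
      simp only [Finset.mem_filter, Finset.mem_univ, true_and] at he
      congr 2
      unfold cyl
      congr 1
      ext z
      simp only [Finset.mem_filter, Finset.mem_univ, true_and]
      exact ⟨fun h => he.trans h, fun h => he.symm.trans h⟩
    rw [hset, Finset.sum_congr rfl hc, Finset.sum_const, nsmul_eq_mul]
    have := cyl_pos π d
    change _ = (cyl π d : ℚ) * _
    field_simp

theorem le_cyl {π : Perm D} {d : D} {n : ℕ}
    (h : ∀ i j, i < j → j < n → π^[i] d ≠ π^[j] d) : n ≤ cyl π d := by
  classical
  have hinj : Set.InjOn (fun i => π^[i] d) (Finset.range n : Set ℕ) := by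
    intro i hi j hj hij
    simp only [Finset.coe_range, Set.mem_Iio] at hi hj
    rcases lt_trichotomy i j with hh | hh | hh
    · exact absurd hij (h i j hh hj)
    · exact hh
    · exact absurd hij.symm (h j i hh hi)
  rw [← Finset.card_range n, ← Finset.card_image_of_injOn hinj]
  refine Finset.card_le_card ?_
  intro z hz
  obtain ⟨i, -, rfl⟩ := Finset.mem_image.1 hz
  simp only [Finset.mem_filter, Finset.mem_univ, true_and]
  exact ⟨i, by rw [zpow_natCast, Perm.coe_pow]⟩

theorem le_cyl_of_period {π : Perm D} {d : D} {n : ℕ} (h : ∀ i, π^[i] d = d → n ∣ i) :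
    n ≤ cyl π d := by
  refine le_cyl fun i j hij hj he => ?_
  have h1 : π^[i] (π^[j - i] d) = π^[i] d := by
    rw [← iterate_add_apply, Nat.add_sub_cancel' hij.le, he]
  have := Nat.eq_zero_of_dvd_of_lt (h _ ((π.injective.iterate i) h1)) (by omega)
  omega

/-- The corner at `d` is essential: its vertex does not have degree two. -/
def Ess (φ α : Perm D) (d : D) : Prop := (φ * α) ((φ * α) d) ≠ d

open Classical in
/-- The weight of a corner of a relator face. -/
noncomputable def wt (φ α : Perm D) (kind : D → ℕ) (c : D) : ℕ :=
  (if Ess φ α c then 1 else 0) + (if Ess φ α c ∧ kind (α c) < 2 then 1 else 0)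

theorem curvature {φ α : Perm D} {kind : D → ℕ} {gen : D → Fin 2} {N N₀ N₁ : ℕ}
    (hP : Planar φ α) (inv : ∀ d, α (α d) = d) (fpf : ∀ d, α d ≠ d)
    (gen_edge : ∀ d, gen (α d) = gen d) (gen_next : ∀ d, kind d < 3 → gen (φ d) ≠ gen d)
    (kind_next : ∀ d, kind d < 3 → kind (φ d) = kind d) (kind_le : ∀ d, kind d ≤ 3)
    (junk : ∀ d, kind d = 3 → φ d = α d ∧ φ (α d) = d ∧ kind (α d) = 3)
    (hN : 0 < N) (hN₀ : 0 < N₀) (hN₁ : 0 < N₁)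
    (p₀ : ∀ d, kind d = 0 → ∀ i, φ^[i] d = d → N₀ ∣ i)
    (p₁ : ∀ d, kind d = 1 → ∀ i, φ^[i] d = d → N₁ ∣ i)
    (p₂ : ∀ d, kind d = 2 → ∀ i, φ^[i] d = d → N ∣ i)
    (c₀ : (Finset.univ.filter fun d => kind d = 0).card = N₀)
    (c₁ : (Finset.univ.filter fun d => kind d = 1).card = N₁)
    (hloc : ∀ d, kind d = 2 → 4 ≤ ∑ i ∈ Finset.range N, wt φ α kind (φ^[i] d)) :
    (∀ d, kind d < 3 → Ess φ α d → (φ * α)^[4] d = d) ∧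
    (∀ d, kind d = 2 → ∑ i ∈ Finset.range N, wt φ α kind (φ^[i] d) = 4) ∧
    (∀ d, kind d < 2 → Ess φ α d → ∃ c, kind c = 2 ∧ kind (α c) < 2 ∧ (φ * α) c = d) := by
  classical
  set κ := φ * α with hκ
  have hκe : ∀ d, κ d = φ (α d) := fun d => rfl
  have live_α : ∀ d, kind d < 3 → kind (α d) < 3 := by
    intro d hd
    by_contra hh
    have := junk (α d) (by have := kind_le (α d); omega)
    rw [inv] at this
    omega
  have hgκ : ∀ d, kind d < 3 → gen (κ d) ≠ gen d := fun d hd => by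
    rw [hκe, ← gen_edge d]; exact gen_next _ (live_α d hd)
  have hlκ : ∀ d, kind d < 3 → kind (κ d) < 3 := fun d hd => by
    rw [hκe, kind_next _ (live_α d hd)]; exact live_α d hd
  have fin2 : ∀ a b c : Fin 2, a ≠ b → b ≠ c → a = c := by omega
  have hg2 : ∀ d, kind d < 3 → gen (κ (κ d)) = gen d := fun d hd =>
    fin2 _ _ _ (hgκ _ (hlκ _ hd)) (hgκ _ hd)
  have k1 : ∀ d, kind d < 3 → κ d ≠ d := fun d hd h => hgκ d hd (by rw [h])
  have k3 : ∀ d, kind d < 3 → κ (κ (κ d)) ≠ d := fun d hd h =>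
    hgκ d hd (by rw [← hg2 (κ d) (hlκ d hd), h])
  have cyl4 : ∀ d, kind d < 3 → Ess φ α d → 4 ≤ cyl κ d := by
    intro d hd he
    refine le_cyl fun i j hij hj => ?_
    have := k1 d hd
    have := k3 d hd
    have : κ (κ d) ≠ d := he
    interval_cases j <;> interval_cases i <;>
      simp only [iterate_succ_apply', iterate_zero, id_eq, ne_eq, κ.injective.eq_iff] <;>
      exact Ne.symm ‹_›
  have cyl5 : ∀ d, kind d < 3 → Ess φ α d → κ^[4] d ≠ d → 5 ≤ cyl κ d := by
    intro d hd he h4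
    refine le_cyl fun i j hij hj => ?_
    have := k1 d hd
    have := k3 d hd
    have : κ (κ d) ≠ d := he
    have : κ (κ (κ (κ d))) ≠ d := h4
    interval_cases j <;> interval_cases i <;>
      simp only [iterate_succ_apply', iterate_zero, id_eq, ne_eq, κ.injective.eq_iff] <;>
      exact Ne.symm ‹_›
  have cyl2 : ∀ d, kind d < 3 → 2 ≤ cyl κ d := by
    intro d hd
    refine le_cyl fun i j hij hj => ?_
    have := k1 d hd
    obtain rfl : j = 1 := by omega
    obtain rfl : i = 0 := by omega
    exact Ne.symm ‹_›
  -- counts of darts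
  set J := Finset.univ.filter fun d => kind d = 3 with hJ
  set S := Finset.univ.filter fun d => kind d < 3 ∧ ¬ Ess φ α d with hS
  set E := Finset.univ.filter fun d => kind d < 3 ∧ Ess φ α d with hE
  set R := Finset.univ.filter fun d => kind d = 2 with hR
  set X := Finset.univ.filter fun d => kind d = 0 with hX
  set Y := Finset.univ.filter fun d => kind d = 1 with hY
  have split1 : ∀ f : D → ℚ, ∑ d, f d = ∑ d ∈ J, f d + ∑ d ∈ S, f d + ∑ d ∈ E, f d := by
    intro f
    rw [hJ, hS, hE, Finset.sum_filter, Finset.sum_filter, Finset.sum_filter,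
      ← Finset.sum_add_distrib, ← Finset.sum_add_distrib]
    refine Finset.sum_congr rfl fun d _ => ?_
    have := kind_le d
    by_cases h1 : kind d = 3
    · simp [h1]
    · have h2 : kind d < 3 := by omega
      by_cases h3 : Ess φ α d <;> simp [h1, h2, h3]
  have split2 : ∀ f : D → ℚ,
      ∑ d, f d = ∑ d ∈ J, f d + ∑ d ∈ X, f d + ∑ d ∈ Y, f d + ∑ d ∈ R, f d := by
    intro f
    rw [hJ, hX, hY, hR, Finset.sum_filter, Finset.sum_filter, Finset.sum_filter,
      Finset.sum_filter, ← Finset.sum_add_distrib, ← Finset.sum_add_distrib,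
      ← Finset.sum_add_distrib]
    refine Finset.sum_congr rfl fun d _ => ?_
    have := kind_le d
    generalize kind d = k at this
    interval_cases k <;> simp
  have bound : ∀ (T : Finset D) (π : Perm D) (n : ℕ), 0 < n → (∀ d ∈ T, n ≤ cyl π d) →
      ∑ d ∈ T, 1 / (cyl π d : ℚ) ≤ T.card * (1 / (n : ℚ)) := by
    intro T π n hn hT
    rw [← nsmul_eq_mul]
    refine Finset.sum_le_card_nsmul _ _ _ fun d hd => ?_
    have h1 : (n : ℚ) ≤ cyl π d := by exact_mod_cast hT d hd
    exact one_div_le_one_div_of_le (by exact_mod_cast hn) h1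
  have mJ : ∀ d, d ∈ J ↔ kind d = 3 := fun d => by simp [hJ]
  have mE : ∀ d, d ∈ E ↔ kind d < 3 ∧ Ess φ α d := fun d => by simp [hE]
  have mS : ∀ d, d ∈ S ↔ kind d < 3 ∧ ¬ Ess φ α d := fun d => by simp [hS]
  have mR : ∀ d, d ∈ R ↔ kind d = 2 := fun d => by simp [hR]
  have mX : ∀ d, d ∈ X ↔ kind d = 0 := fun d => by simp [hX]
  have mY : ∀ d, d ∈ Y ↔ kind d = 1 := fun d => by simp [hY]
  have bφ : (orb φ : ℚ) ≤ J.card / 2 + 2 + R.card / N := by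
    rw [orb_eq_sum, split2]
    have b1 := bound J φ 2 (by norm_num) fun d hd => by
      refine le_cyl fun i j hij hj => ?_
      obtain rfl : j = 1 := by omega
      obtain rfl : i = 0 := by omega
      intro h
      exact fpf d (by rw [← (junk d ((mJ d).1 hd)).1]; exact h.symm)
    have b2 := bound X φ N₀ hN₀ fun d hd => le_cyl_of_period (p₀ d ((mX d).1 hd))
    have b3 := bound Y φ N₁ hN₁ fun d hd => le_cyl_of_period (p₁ d ((mY d).1 hd))
    have b4 := bound R φ N hN fun d hd => le_cyl_of_period (p₂ d ((mR d).1 hd))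
    rw [c₀, mul_one_div_cancel (by exact_mod_cast hN₀.ne')] at b2
    rw [c₁, mul_one_div_cancel (by exact_mod_cast hN₁.ne')] at b3
    rw [mul_one_div] at b1 b4
    push_cast at b1
    linarith
  have bκ : (orb κ : ℚ) ≤ J.card + S.card / 2 + ∑ d ∈ E, 1 / (cyl κ d : ℚ) := by
    rw [orb_eq_sum, split1]
    have b1 := bound J κ 1 (by norm_num) fun d _ => cyl_pos κ d
    have b2 := bound S κ 2 (by norm_num) fun d hd => cyl2 d ((mS d).1 hd).1
    rw [mul_one_div] at b1 b2
    push_cast at b1 b2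
    linarith
  have bE : ∀ d ∈ E, 1 / (cyl κ d : ℚ) ≤ 1 / 4 := fun d hd => by
    have h1 : (4 : ℚ) ≤ cyl κ d := by exact_mod_cast cyl4 d ((mE d).1 hd).1 ((mE d).1 hd).2
    exact one_div_le_one_div_of_le (by norm_num) h1
  have hcard : (Fintype.card D : ℚ) = J.card + S.card + E.card := by
    have := split1 fun _ => 1
    simpa using this
  -- components
  obtain ⟨K, hK, hKc⟩ := hP
  have hKJ : J.card + 2 ≤ 2 * K.card := by
    have hj : ∀ d ∈ J, d ∈ K ∨ α d ∈ K := by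
      intro d hd
      obtain ⟨j1, j2, j3⟩ := junk d ((mJ d).1 hd)
      obtain ⟨k, hk, hrel⟩ := hK d
      have : d = d ∨ d = α d ↔ k = d ∨ k = α d := by
        refine hrel (fun z => z = d ∨ z = α d) (fun z => ?_) (fun z => ?_)
        · constructor
          · rintro (h | h)
            · right; exact φ.injective (by rw [h, j2])
            · left; exact φ.injective (by rw [h, j1])
          · rintro (rfl | rfl)
            · right; exact j1
            · left; exact j2
        · constructor
          · rintro (h | h)
            · right; rw [← h, inv]
            · left; exact α.injective h
          · rintro (rfl | rfl)
            · right; rfl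
            · left; exact inv _
      rcases this.1 (.inl rfl) with rfl | rfl
      · exact .inl hk
      · exact .inr hk
    obtain ⟨d₀, hd₀⟩ : X.Nonempty := Finset.card_pos.1 (by rw [c₀]; exact hN₀)
    rw [mX] at hd₀
    obtain ⟨k₀, hk₀, hrel⟩ := hK d₀
    have hk3 : kind k₀ ≠ 3 := by
      have : kind d₀ = 3 ↔ kind k₀ = 3 := by
        refine hrel (fun z => kind z = 3) (fun z => ?_) (fun z => ?_)
        · constructor
          · intro h
            by_contra hz
            have := kind_next z (by have := kind_le z; omega)
            omega
          · intro h
            rw [(junk z h).1]; exact (junk z h).2.2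
        · exact ⟨fun h => by have := (junk _ h).2.2; rwa [inv] at this, fun h => (junk z h).2.2⟩
      intro h
      have := this.2 h
      omega
    have hKJ1 : (K.filter fun d => kind d = 3).card + 1 ≤ K.card := by
      rw [Nat.succ_le_iff]
      refine Finset.card_lt_card (Finset.filter_ssubset.2 ⟨k₀, hk₀, hk3⟩)
    have hsub : J ⊆ (K.filter fun d => kind d = 3) ∪ (K.filter fun d => kind d = 3).image α := by
      intro d hd
      rw [Finset.mem_union, Finset.mem_image]
      have hd3 := (mJ d).1 hd
      rcases hj d hd with h | h
      · exact .inl (Finset.mem_filter.2 ⟨h, hd3⟩)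
      · exact .inr ⟨α d, Finset.mem_filter.2 ⟨h, (junk d hd3).2.2⟩, inv d⟩
    have h1 := Finset.card_le_card hsub
    have h2 := Finset.card_union_le (K.filter fun d => kind d = 3)
      ((K.filter fun d => kind d = 3).image α)
    have h3 := Finset.card_image_le (s := K.filter fun d => kind d = 3) (f := α)
    omega
  have hEuler : (E.card : ℚ) ≤
      2 * (∑ d ∈ E, 1 / (cyl κ d : ℚ)) + 2 * (R.card / N) := by
    have h1 : (4 * K.card + Fintype.card D : ℚ) ≤ 2 * (orb φ + orb κ) := by exact_mod_cast hKc
    have h2 : (J.card + 2 : ℚ) ≤ 2 * K.card := by exact_mod_cast hKJ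
    linarith
  -- the local estimate
  set U := Finset.univ.filter fun d => kind d = 2 ∧ Ess φ α d with hU
  set V := Finset.univ.filter fun d => kind d = 2 ∧ Ess φ α d ∧ kind (α d) < 2 with hV
  set W := Finset.univ.filter fun d => kind d < 2 ∧ Ess φ α d with hW
  have hEUW : E.card = U.card + W.card := by
    rw [hU, hW, ← Finset.card_union_of_disjoint]
    · congr 1
      ext d
      simp only [hE, Finset.mem_union, Finset.mem_filter, Finset.mem_univ, true_and]
      constructor
      · rintro ⟨h1, h2⟩
        by_cases h3 : kind d = 2
        · exact .inl ⟨h3, h2⟩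
        · exact .inr ⟨by omega, h2⟩
      · rintro (⟨h1, h2⟩ | ⟨h1, h2⟩)
        · exact ⟨by omega, h2⟩
        · exact ⟨by omega, h2⟩
    · rw [Finset.disjoint_filter]
      rintro d - ⟨h1, -⟩ ⟨h2, -⟩
      omega
  have hVW : V.image κ ⊆ W := by
    intro z hz
    obtain ⟨c, hc, rfl⟩ := Finset.mem_image.1 hz
    simp only [hV, hW, Finset.mem_filter, Finset.mem_univ, true_and] at hc ⊢
    refine ⟨by rw [hκe, kind_next _ (by omega)]; exact hc.2.2, ?_⟩
    intro h
    exact hc.2.1 (κ.injective h)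
  have hVc : (V.image κ).card = V.card := Finset.card_image_of_injective _ κ.injective
  have hsumR : ∑ d ∈ R, wt φ α kind d = U.card + V.card := by
    rw [hU, hV, Finset.card_filter, Finset.card_filter, ← Finset.sum_add_distrib, hR,
      Finset.sum_filter]
    refine Finset.sum_congr rfl fun d _ => ?_
    unfold wt
    by_cases h1 : kind d = 2 <;> simp [h1]
  have hkit : ∀ d i, kind (φ^[i] d) = 2 ↔ kind d = 2 := by
    intro d i
    induction i with
    | zero => rfl
    | succ i ih =>
      rw [iterate_succ_apply', ← ih]
      constructor
      · intro h
        by_cases h3 : kind (φ^[i] d) < 3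
        · rw [← kind_next _ h3, h]
        · have h4 := junk (φ^[i] d) (by have := kind_le (φ^[i] d); omega)
          rw [h4.1] at h
          omega
      · intro h; rw [kind_next _ (by omega), h]
  have hav : ∑ d ∈ R, ∑ i ∈ Finset.range N, wt φ α kind (φ^[i] d) =
      N * ∑ d ∈ R, wt φ α kind d := by
    rw [Finset.sum_comm]
    have : ∀ i ∈ Finset.range N, ∑ d ∈ R, wt φ α kind (φ^[i] d) = ∑ d ∈ R, wt φ α kind d := by
      intro i _
      refine Finset.sum_equiv (φ ^ i) (fun d => ?_) (fun d _ => ?_)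
      · rw [mR, mR, Perm.coe_pow, hkit]
      · rw [Perm.coe_pow]
    rw [Finset.sum_congr rfl this, Finset.sum_const, Finset.card_range, smul_eq_mul]
  have hlow : R.card * 4 ≤ ∑ d ∈ R, ∑ i ∈ Finset.range N, wt φ α kind (φ^[i] d) := by
    rw [← smul_eq_mul]
    exact Finset.card_nsmul_le_sum _ _ _ fun d hd => hloc d ((mR d).1 hd)
  have hNq : (0 : ℚ) < N := by exact_mod_cast hN
  have q1 : (R.card * 4 : ℚ) ≤ N * (U.card + V.card) := by
    rw [hav, hsumR] at hlow; exact_mod_cast hlow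
  have q1' : (R.card / N * 4 : ℚ) ≤ U.card + V.card := by
    rw [div_mul_eq_mul_div, div_le_iff₀ hNq]; linarith
  have q2 : V.card ≤ W.card := hVc ▸ Finset.card_le_card hVW
  have q2' : (V.card : ℚ) ≤ W.card := by exact_mod_cast q2
  have q3 : (E.card : ℚ) = U.card + W.card := by exact_mod_cast hEUW
  have q4 : ∑ d ∈ E, 1 / (cyl κ d : ℚ) ≤ ∑ d ∈ E, (1 / 4 : ℚ) := Finset.sum_le_sum bE
  have q5 : ∑ d ∈ E, (1 / 4 : ℚ) = E.card / 4 := by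
    rw [Finset.sum_const, nsmul_eq_mul]; ring
  have e1 : ∑ d ∈ E, 1 / (cyl κ d : ℚ) = ∑ d ∈ E, (1 / 4 : ℚ) := by linarith
  have e2 : (R.card / N * 4 : ℚ) = U.card + V.card := by linarith
  have e3 : (W.card : ℚ) ≤ V.card := by linarith
  refine ⟨?_, ?_, ?_⟩
  · intro d hd he
    by_contra h4
    have h1 := (Finset.sum_eq_sum_iff_of_le bE).1 e1 d ((mE d).2 ⟨hd, he⟩)
    have h5 : (5 : ℚ) ≤ cyl κ d := by exact_mod_cast cyl5 d hd he h4
    have h6 : (1 : ℚ) / cyl κ d ≤ 1 / 5 := one_div_le_one_div_of_le (by norm_num) h5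
    rw [h1] at h6
    norm_num at h6
  · intro d hd
    have h1 : R.card * 4 = N * (U.card + V.card) := by
      have : (R.card * 4 : ℚ) = N * (U.card + V.card) := by
        rw [← e2]; field_simp
      exact_mod_cast this
    have h2 : ∑ d ∈ R, 4 = ∑ d ∈ R, ∑ i ∈ Finset.range N, wt φ α kind (φ^[i] d) := by
      rw [hav, hsumR, Finset.sum_const, smul_eq_mul, h1]
    exact ((Finset.sum_eq_sum_iff_of_le fun d hd => hloc d ((mR d).1 hd)).1 h2 d
      ((mR d).2 hd)).symm
  · intro d hd he
    have h1 : V.image κ = W := Finset.eq_of_subset_of_card_le hVW (by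
      rw [hVc]; exact_mod_cast e3)
    have h2 : d ∈ V.image κ := by
      rw [h1]; exact Finset.mem_filter.2 ⟨Finset.mem_univ _, hd, he⟩
    obtain ⟨c, hc, rfl⟩ := Finset.mem_image.1 h2
    simp only [hV, Finset.mem_filter, Finset.mem_univ, true_and] at hc
    exact ⟨c, hc.1, hc.2.2, rfl⟩

end Curvature

end

section
open Function
set_option linter.unusedSectionVars false

/-! ### The boundary of a relator face -/

/-- The numbers attached to a relator slope `q/p` and two special slopes: `P k` are the
denominators and `Dl k` the determinants with respect to `q/p`. -/
structure Num (p q g : ℤ) (n : ℕ) (P Dl : ℕ → ℤ) : Prop where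
  g_pos : 0 < g
  g_lt : g < p
  dvd : p ∣ g * q + 1
  two_le : 2 ≤ n
  P_two : P 2 = p
  D_two : Dl 2 = 0
  ne_zero : Dl 0 ≠ 0
  ne_one : Dl 1 ≠ 0
  pos_zero : 0 < Dl 0 → P 0 - p < g * Dl 0
  neg_zero : Dl 0 < 0 → P 0 - p < (p - g) * -Dl 0
  pos_one : 0 < Dl 1 → P 1 - p < ((2 * n - 2) * p + g) * Dl 1
  neg_one : Dl 1 < 0 → P 1 - p < ((2 * n - 2) * p + (p - g)) * -Dl 1

theorem Num.compl {p q g : ℤ} {n : ℕ} {P Dl : ℕ → ℤ} (h : Num p q g n P Dl) :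
    Num p (p - q) (p - g) n P (fun k => -Dl k) where
  g_pos := by have := h.g_lt; omega
  g_lt := by have := h.g_pos; omega
  dvd := by
    obtain ⟨c, hc⟩ := h.dvd
    exact ⟨p - q - g + c, by linear_combination hc⟩
  two_le := h.two_le
  P_two := h.P_two
  D_two := by simp [h.D_two]
  ne_zero := neg_ne_zero.2 h.ne_zero
  ne_one := neg_ne_zero.2 h.ne_one
  pos_zero := fun h' => h.neg_zero (by linarith)
  neg_zero := fun h' => by
    have := h.pos_zero (by linarith)
    simpa using this
  pos_one := fun h' => h.neg_one (by linarith)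
  neg_one := fun h' => by
    have := h.pos_one (by linarith)
    simpa using this

/-- The labels read along the boundary of a relator face and on the other side of it:
`x` is the position in the relator, `k` the kind of the neighbouring face, `Y` the mirrored
position in it, and `ess` holds at the essential corners. -/
structure Circle (p q : ℤ) (N : ℕ) (P Dl : ℕ → ℤ) (x Y : ℤ → ℤ) (k : ℤ → ℕ) (ess : ℤ → Prop) :
    Prop where
  x_nonneg : ∀ i, 0 ≤ x i
  x_lt : ∀ i, x i < p
  x_dvd : ∀ i, p ∣ x (i + 1) - x i - q
  Y_nonneg : ∀ i, 0 ≤ Y i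
  Y_lt : ∀ i, Y i < P (k i)
  k_le : ∀ i, k i ≤ 2
  smooth : ∀ i, ¬ ess (i + 1) → k (i + 1) = k i ∧
    p * Y (i + 1) - P (k i) * x (i + 1) = p * Y i - P (k i) * x i + Dl (k i)
  red : ∀ i, k i = 2 → Y i ≠ x i
  per_x : ∀ i, x (i + N) = x i
  per_Y : ∀ i, Y (i + N) = Y i
  per_k : ∀ i, k (i + N) = k i
  per_ess : ∀ i, ess (i + N) ↔ ess i

section Circle
variable {p q g : ℤ} {n N : ℕ} {P Dl : ℕ → ℤ} {x Y : ℤ → ℤ} {k : ℤ → ℕ} {ess : ℤ → Prop}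

theorem Circle.compl (c : Circle p q N P Dl x Y k ess) (hP : P 2 = p) :
    Circle p (p - q) N P (fun k => -Dl k) (fun i => p - 1 - x i) (fun i => P (k i) - 1 - Y i)
      k ess where
  x_nonneg i := by have := c.x_lt i; omega
  x_lt i := by have := c.x_nonneg i; omega
  x_dvd i := by
    obtain ⟨d, hd⟩ := c.x_dvd i
    exact ⟨-d - 1, by linear_combination -hd⟩
  Y_nonneg i := by have := c.Y_lt i; omega
  Y_lt i := by have := c.Y_nonneg i; omega
  k_le := c.k_le
  smooth i hi := by
    obtain ⟨h1, h2⟩ := c.smooth i hi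
    refine ⟨h1, ?_⟩
    rw [h1]
    linear_combination -h2
  red i hi h := by
    rw [hi, hP] at h
    exact c.red i hi (by linarith)
  per_x i := by rw [c.per_x]
  per_Y i := by rw [c.per_Y, c.per_k]
  per_k := c.per_k
  per_ess := c.per_ess

theorem Circle.shift (c : Circle p q N P Dl x Y k ess) (a : ℤ) :
    Circle p q N P Dl (fun i => x (a + i)) (fun i => Y (a + i)) (fun i => k (a + i))
      (fun i => ess (a + i)) where
  x_nonneg i := c.x_nonneg _
  x_lt i := c.x_lt _
  x_dvd i := by rw [← add_assoc]; exact c.x_dvd _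
  Y_nonneg i := c.Y_nonneg _
  Y_lt i := c.Y_lt _
  k_le i := c.k_le _
  smooth i hi := by rw [← add_assoc] at hi ⊢; exact c.smooth _ hi
  red i := c.red _
  per_x i := by rw [← add_assoc]; exact c.per_x _
  per_Y i := by rw [← add_assoc]; exact c.per_Y _
  per_k i := by rw [← add_assoc]; exact c.per_k _
  per_ess i := by rw [← add_assoc]; exact c.per_ess _

theorem dvd_of_eq_right {a b c : ℤ} (h : a ∣ b) (e : b = c) : a ∣ c := e ▸ h

theorem Circle.congr (c : Circle p q N P Dl x Y k ess) (i j : ℤ) :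
    p ∣ x j - x i - (j - i) * q := by
  have key : ∀ (i : ℤ) (t : ℕ), p ∣ x (i + t) - x i - t * q := by
    intro i t
    induction t with
    | zero => simp
    | succ t ih =>
      refine dvd_of_eq_right (dvd_add ih (c.x_dvd (i + t))) ?_
      push_cast
      rw [← add_assoc]
      ring
  rcases le_total i j with h | h
  · have := key i (j - i).toNat
    rw [Int.toNat_of_nonneg (by omega)] at this
    simpa using this
  · have := key j (i - j).toNat
    rw [Int.toNat_of_nonneg (by omega)] at this
    refine dvd_of_eq_right (dvd_neg.2 this) ?_
    rw [add_sub_cancel]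
    ring

theorem Circle.phase (c : Circle p q N P Dl x Y k ess) (h : p ∣ g * q + 1) (i j : ℤ) :
    p ∣ (j - i) + g * (x j - x i) := by
  exact dvd_of_eq_right (dvd_sub ((c.congr i j).mul_left g) (h.mul_right (-(j - i)))) (by ring)

theorem eq_of_dvd_of_mem {p a b : ℤ} (h : p ∣ a - b) (h1 : 0 ≤ a) (h2 : a < p) (h3 : 0 ≤ b)
    (h4 : b < p) : a = b := by
  have := Int.eq_zero_of_abs_lt_dvd h (by rw [abs_lt]; constructor <;> linarith)
  linarith

theorem Num.x_eq (H : Num p q g n P Dl) (c : Circle p q N P Dl x Y k ess) {i j a : ℤ}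
    (h : p ∣ (j - i) + g * (a - x i)) (h0 : 0 ≤ a) (ha : a < p) : x j = a := by
  have h1 := dvd_sub (c.phase H.dvd i j) h
  have h2 : p ∣ x j - a := by
    have h3 : p ∣ g * (x j - a) := dvd_of_eq_right h1 (by ring)
    have h4 := dvd_sub (H.dvd.mul_right (x j - a)) (h3.mul_left q)
    exact dvd_of_eq_right h4 (by ring)
  exact eq_of_dvd_of_mem h2 (c.x_nonneg _) (c.x_lt _) h0 ha

/-- No essential corner separates the position `i` from the position `s ≤ i`. -/
def Conn (ess : ℤ → Prop) (s i : ℤ) : Prop := s ≤ i ∧ ∀ j, s < j → j ≤ i → ¬ ess j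

theorem Conn.mono {s i i' s' : ℤ} (h : Conn ess s i) (h1 : s ≤ s') (h2 : s' ≤ i') (h3 : i' ≤ i) :
    Conn ess s' i' :=
  ⟨h2, fun j hj hj' => h.2 j (by omega) (by omega)⟩

theorem Conn.between {s i j : ℤ} (h : Conn ess s i) (h' : Conn ess s j) (hij : i ≤ j) :
    Conn ess i j := h'.mono h.1 hij le_rfl

theorem Circle.affine (c : Circle p q N P Dl x Y k ess) {s i : ℤ} (h : Conn ess s i) :
    k i = k s ∧ p * Y i - P (k s) * x i = p * Y s - P (k s) * x s + (i - s) * Dl (k s) := by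
  obtain ⟨t, rfl⟩ : ∃ t : ℕ, i = s + t := ⟨(i - s).toNat, by have := h.1; omega⟩
  induction t with
  | zero => simp
  | succ t ih =>
    obtain ⟨h1, h2⟩ := ih (h.mono le_rfl (by omega) (by push_cast; omega))
    obtain ⟨h3, h4⟩ := c.smooth (s + t) (h.2 _ (by omega) (by push_cast; omega))
    rw [h1] at h3 h4
    push_cast
    rw [← add_assoc]
    refine ⟨h3, ?_⟩
    rw [h4, h2]
    ring

theorem Circle.zero_neg (c : Circle p q N P Dl x Y k ess) (hp : 0 < p) {s i j : ℤ}
    (hi : Conn ess s i) (hj : Conn ess s j) (h0 : x i = 0) (h1 : x j = p - 1) :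
    (j - i) * Dl (k s) ≤ P (k s) - p := by
  have a1 := (c.affine hi).2
  have a2 := (c.affine hj).2
  have b1 := c.Y_nonneg i
  have b2 := c.Y_lt j
  rw [(c.affine hj).1] at b2
  rw [h0] at a1
  rw [h1] at a2
  nlinarith

/-- Half the bound for the number of special positions facing a face of kind `k`. -/
def half (n k : ℕ) : ℤ := if k = 1 then n else 1

theorem Num.pos (H : Num p q g n P Dl) {k : ℕ} (hk : k < 2) (h : 0 < Dl k) :
    P k - p < ((2 * half n k - 2) * p + g) * Dl k := by
  rcases (by omega : k = 0 ∨ k = 1) with rfl | rfl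
  · simpa [half] using H.pos_zero h
  · simpa [half] using H.pos_one h

theorem Num.neg (H : Num p q g n P Dl) {k : ℕ} (hk : k < 2) (h : Dl k < 0) :
    P k - p < ((2 * half n k - 2) * p + (p - g)) * -Dl k := by
  rcases (by omega : k = 0 ∨ k = 1) with rfl | rfl
  · simpa [half] using H.neg_zero h
  · simpa [half] using H.neg_one h

theorem Num.p_pos (H : Num p q g n P Dl) : 0 < p := H.g_pos.trans H.g_lt

theorem Num.half_pos (H : Num p q g n P Dl) (k : ℕ) : 1 ≤ half n k := by
  have := H.two_le
  unfold half; split <;> omega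

theorem Num.ne (H : Num p q g n P Dl) {k : ℕ} (hk : k < 2) : Dl k ≠ 0 := by
  rcases (by omega : k = 0 ∨ k = 1) with rfl | rfl
  · exact H.ne_zero
  · exact H.ne_one

theorem Num.zeros_far (H : Num p q g n P Dl) (c : Circle p q N P Dl x Y k ess) {i j : ℤ}
    (hi : x i = 0) (hj : x j = 0) (hk : k i < 2) (hij : i + (2 * half n (k i) - 1) * p ≤ j) :
    ¬ Conn ess i j := by
  intro hc
  have hp := H.p_pos
  have hg := H.g_pos
  have hg' := H.g_lt
  have hh := H.half_pos (k i)
  have hmp : 0 ≤ (2 * half n (k i) - 2) * p := mul_nonneg (by omega) hp.le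
  have conn : ∀ t, i ≤ t → t ≤ j → Conn ess i t := fun t h1 h2 => hc.mono le_rfl h1 h2
  rcases lt_or_gt_of_ne (H.ne hk) with hD | hD
  · have h1 : x (i + g) = p - 1 := by
      refine H.x_eq (i := i) c ?_ (by omega) (by omega)
      rw [hi]; exact ⟨g, by ring⟩
    have h2 : i + g ≤ j := by linarith
    have := c.zero_neg hp hc (conn _ (by omega) h2) hj h1
    have := H.neg hk hD
    nlinarith
  · have h1 : x (i + g + (2 * half n (k i) - 2) * p) = p - 1 := by
      refine H.x_eq (i := i) c ?_ (by omega) (by omega)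
      rw [hi]; exact ⟨g + (2 * half n (k i) - 2), by ring⟩
    have h2 : i + g + (2 * half n (k i) - 2) * p ≤ j := by linarith
    have := c.zero_neg hp (conn i le_rfl (by linarith)) (conn _ (by omega) h2) hi h1
    have := H.pos hk hD
    nlinarith

theorem Num.negs_far (H : Num p q g n P Dl) (c : Circle p q N P Dl x Y k ess) {i j : ℤ}
    (hi : x i = p - 1) (hj : x j = p - 1) (hk : k i < 2)
    (hij : i + (2 * half n (k i) - 1) * p ≤ j) : ¬ Conn ess i j :=
  H.compl.zeros_far (c.compl H.P_two) (by simp [hi]) (by simp [hj]) hk hij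

theorem Num.two_special (H : Num p q g n P Dl) (c : Circle p q N P Dl x Y k ess) {s i j : ℤ}
    (hs : k s = 2) (hi : Conn ess s i) (hj : Conn ess s j) (h0 : x i = 0) (h1 : x j = p - 1) :
    False := by
  have hp := H.p_pos
  have a1 := (c.affine hi).2
  have a2 := (c.affine hj).2
  have b1 := c.Y_nonneg i
  have b2 := c.Y_lt j
  have r := c.red s hs
  rw [(c.affine hj).1, hs, H.P_two] at b2
  rw [hs, H.P_two, H.D_two] at a1 a2
  rw [h0] at a1
  rw [h1] at a2
  have e1 : Y i = Y s - x s := by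
    have : p * Y i = p * (Y s - x s) := by linarith
    exact mul_left_cancel₀ hp.ne' this
  have e2 : Y j - (p - 1) = Y s - x s := by
    have : p * (Y j - (p - 1)) = p * (Y s - x s) := by linarith
    exact mul_left_cancel₀ hp.ne' this
  omega

theorem exists_far {p : ℤ} (hp : 0 < p) (c : ℕ) (T : Finset ℤ)
    (hT : ∀ i ∈ T, ∀ j ∈ T, p ∣ j - i) (hc : c < T.card) :
    ∃ i ∈ T, ∃ j ∈ T, i + c * p ≤ j := by
  have hne : T.Nonempty := Finset.card_pos.1 (by omega)
  obtain ⟨a, ha⟩ : ∃ a, a = T.min' hne := ⟨_, rfl⟩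
  have haT : a ∈ T := ha ▸ T.min'_mem hne
  by_contra hcon
  push Not at hcon
  have : T ⊆ (Finset.range c).image fun t : ℕ => a + t * p := by
    intro j hj
    obtain ⟨d, hd⟩ := hT a haT j hj
    have h1 : a ≤ j := ha ▸ T.min'_le _ hj
    have h2 := hcon a haT j hj
    have hd0 : 0 ≤ d := by
      by_contra h
      nlinarith
    refine Finset.mem_image.2 ⟨d.toNat, Finset.mem_range.2 ?_, ?_⟩
    · have : d < c := by
        by_contra h
        push Not at h
        nlinarith
      omega
    · rw [Int.toNat_of_nonneg hd0]; linarith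
  have h3 := Finset.card_le_card this
  have h4 := Finset.card_image_le (s := Finset.range c) (f := fun t : ℕ => a + t * p)
  rw [Finset.card_range] at h4
  omega

theorem Num.dvd_zero (H : Num p q g n P Dl) (c : Circle p q N P Dl x Y k ess) {i j : ℤ}
    (h : x j = x i) : p ∣ j - i := by
  have := c.phase H.dvd i j
  rwa [h, sub_self, mul_zero, add_zero] at this

theorem Num.card_zeros (H : Num p q g n P Dl) (c : Circle p q N P Dl x Y k ess) {s : ℤ}
    (hs : k s < 2) (T : Finset ℤ) (hT : ∀ i ∈ T, x i = 0 ∧ Conn ess s i) :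
    (T.card : ℤ) ≤ 2 * half n (k s) - 1 := by
  have hh := H.half_pos (k s)
  by_contra hcon
  obtain ⟨i, hi, j, hj, hij⟩ := exists_far H.p_pos (2 * half n (k s) - 1).toNat T
    (fun i hi j hj => H.dvd_zero c (by rw [(hT i hi).1, (hT j hj).1])) (by omega)
  rw [Int.toNat_of_nonneg (by omega)] at hij
  have hk := (c.affine (hT i hi).2).1
  rw [← hk] at hij hs
  refine H.zeros_far c (hT i hi).1 (hT j hj).1 hs hij ((hT i hi).2.between (hT j hj).2 ?_)
  have := H.p_pos
  have : 0 ≤ (2 * half n (k i) - 1) * p := mul_nonneg (by rw [hk]; omega) this.le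
  linarith

theorem Num.card_negs (H : Num p q g n P Dl) (c : Circle p q N P Dl x Y k ess) {s : ℤ}
    (hs : k s < 2) (T : Finset ℤ) (hT : ∀ i ∈ T, x i = p - 1 ∧ Conn ess s i) :
    (T.card : ℤ) ≤ 2 * half n (k s) - 1 :=
  H.compl.card_zeros (c.compl H.P_two) hs T fun i hi => ⟨by simp [(hT i hi).1], (hT i hi).2⟩

theorem Num.card_zeros_two (H : Num p q g n P Dl) (c : Circle p q N P Dl x Y k ess) {s : ℤ}
    (hs : k s = 2) (T : Finset ℤ) (hT : ∀ i ∈ T, x i = 0 ∧ Conn ess s i) : T.card ≤ 1 := by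
  by_contra hcon
  have hg := H.g_pos
  have hg' := H.g_lt
  obtain ⟨i, hi, j, hj, hij⟩ := exists_far H.p_pos 1 T
    (fun i hi j hj => H.dvd_zero c (by rw [(hT i hi).1, (hT j hj).1])) (by omega)
  refine H.two_special c hs (hT i hi).2
    ((hT j hj).2.mono (i' := i + g) le_rfl ?_ ?_) (hT i hi).1 ?_
  · have := (hT i hi).2.1; omega
  · push_cast at hij; linarith
  · refine H.x_eq (i := i) c ?_ (by omega) (by omega)
    rw [(hT i hi).1]; exact ⟨g, by ring⟩

theorem Num.card_negs_two (H : Num p q g n P Dl) (c : Circle p q N P Dl x Y k ess) {s : ℤ}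
    (hs : k s = 2) (T : Finset ℤ) (hT : ∀ i ∈ T, x i = p - 1 ∧ Conn ess s i) : T.card ≤ 1 :=
  H.compl.card_zeros_two (c.compl H.P_two) hs T fun i hi => ⟨by simp [(hT i hi).1], (hT i hi).2⟩

theorem Num.card_run (H : Num p q g n P Dl) (c : Circle p q N P Dl x Y k ess) {s : ℤ}
    (T : Finset ℤ) (hT : ∀ i ∈ T, (x i = 0 ∨ x i = p - 1) ∧ Conn ess s i) :
    T.card ≤ (if k s = 2 then 1 else 0) + 2 * (if k s = 0 then 1 else 0) +
      (4 * n - 2) * (if k s = 1 then 1 else 0) := by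
  have hsplit : T.card ≤ (T.filter fun i => x i = 0).card + (T.filter fun i => x i = p - 1).card := by
    rw [← Finset.card_filter_add_card_filter_not (s := T) (fun i => x i = 0)]
    refine Nat.add_le_add_left (Finset.card_le_card fun i hi => ?_) _
    simp only [Finset.mem_filter] at hi ⊢
    exact ⟨hi.1, (hT i hi.1).1.resolve_left hi.2⟩
  have hz : ∀ i ∈ T.filter fun i => x i = 0, x i = 0 ∧ Conn ess s i := fun i hi => by
    simp only [Finset.mem_filter] at hi
    exact ⟨hi.2, (hT i hi.1).2⟩
  have hw : ∀ i ∈ T.filter fun i => x i = p - 1, x i = p - 1 ∧ Conn ess s i := fun i hi => by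
    simp only [Finset.mem_filter] at hi
    exact ⟨hi.2, (hT i hi.1).2⟩
  have hk := c.k_le s
  have hn := H.two_le
  rcases (by omega : k s = 2 ∨ k s < 2) with h2 | h2
  · have b1 := H.card_zeros_two c h2 _ hz
    have b2 := H.card_negs_two c h2 _ hw
    rw [h2]
    simp only [if_true, OfNat.ofNat_ne_zero, if_false]
    by_contra hcon
    obtain ⟨i, hi⟩ := Finset.card_pos.1 (by omega : 0 < (T.filter fun i => x i = 0).card)
    obtain ⟨j, hj⟩ := Finset.card_pos.1 (by omega : 0 < (T.filter fun i => x i = p - 1).card)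
    exact H.two_special c h2 (hz i hi).2 (hw j hj).2 (hz i hi).1 (hw j hj).1
  · have b1 := H.card_zeros c h2 _ hz
    have b2 := H.card_negs c h2 _ hw
    rcases (by omega : k s = 0 ∨ k s = 1) with h | h <;> rw [h] at b1 b2 ⊢ <;>
      simp [half] at b1 b2 ⊢ <;> omega

end Circle

end

section
open Function
set_option linter.unusedSectionVars false

section Weights
variable {p q g : ℤ} {n N : ℕ} {P Dl : ℕ → ℤ} {x Y : ℤ → ℤ} {k : ℤ → ℕ} {ess : ℤ → Prop}

open Classical in
/-- The weight of the corner at position `i`. -/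
noncomputable def cwt (k : ℤ → ℕ) (ess : ℤ → Prop) (i : ℤ) : ℕ :=
  (if ess i then 1 else 0) + (if ess i ∧ k i < 2 then 1 else 0)

theorem sum_range_shift {f : ℤ → ℕ} {N : ℕ} (hf : ∀ i, f (i + N) = f i) (a : ℤ) :
    ∑ i ∈ Finset.range N, f (a + i) = ∑ i ∈ Finset.range N, f i := by
  have step : ∀ a : ℤ, ∑ i ∈ Finset.range N, f (a + 1 + i) = ∑ i ∈ Finset.range N, f (a + i) := by
    intro a
    have h1 := Finset.sum_range_succ (fun i : ℕ => f (a + i)) N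
    have h2 := Finset.sum_range_succ' (fun i : ℕ => f (a + i)) N
    have h3 : ∀ i : ℕ, f (a + (i + 1 : ℕ)) = f (a + 1 + i) := fun i => by
      push_cast; congr 1; ring
    simp only [h3, hf, Nat.cast_zero, add_zero] at h1 h2
    omega
  induction a using Int.induction_on with
  | zero => simp
  | succ a ih => rw [step, ih]
  | pred a ih => rw [← ih, ← step]; simp only [sub_add_cancel]

theorem Circle.per_cwt (c : Circle p q N P Dl x Y k ess) (i : ℤ) :
    cwt k ess (i + N) = cwt k ess i := by
  rw [cwt, cwt, c.per_k, propext (c.per_ess i)]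

theorem Circle.per_mul (c : Circle p q N P Dl x Y k ess) (i j : ℤ) :
    x (i + j * N) = x i ∧ Y (i + j * N) = Y i ∧ k (i + j * N) = k i ∧
      (ess (i + j * N) ↔ ess i) := by
  induction j using Int.induction_on with
  | zero => simp
  | succ j ih =>
    have e : i + ((j : ℤ) + 1) * N = i + j * N + N := by ring
    rw [e, c.per_x, c.per_Y, c.per_k, c.per_ess]; exact ih
  | pred j ih =>
    have e : i + (-(j : ℤ)) * N = i + (-(j : ℤ) - 1) * N + N := by ring
    rw [e, c.per_x, c.per_Y, c.per_k, c.per_ess] at ih; exact ih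

theorem Num.exists_zero (H : Num p q g n P Dl) (c : Circle p q N P Dl x Y k ess) (a : ℤ) :
    ∃ z, a ≤ z ∧ z < a + p ∧ x z = 0 := by
  have h1 := Int.emod_nonneg (g * x a) H.p_pos.ne'
  have h2 := Int.emod_lt_of_pos (g * x a) H.p_pos
  refine ⟨a + (g * x a) % p, by omega, by omega, H.x_eq (i := a) c ?_ le_rfl H.p_pos⟩
  have := Int.emod_add_mul_ediv (g * x a) p
  exact ⟨-(g * x a / p), by linear_combination this⟩

theorem Num.exists_neg (H : Num p q g n P Dl) (c : Circle p q N P Dl x Y k ess) (a : ℤ) :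
    ∃ z, a ≤ z ∧ z < a + p ∧ x z = p - 1 := by
  obtain ⟨z, h1, h2, h3⟩ := H.compl.exists_zero (c.compl H.P_two) a
  exact ⟨z, h1, h2, by linarith⟩

theorem Num.x_add_mul (H : Num p q g n P Dl) (c : Circle p q N P Dl x Y k ess) (i j : ℤ) :
    x (i + j * p) = x i :=
  H.x_eq (i := i) c ⟨j, by ring⟩ (c.x_nonneg i) (c.x_lt i)

theorem Num.exists_ess (H : Num p q g n P Dl) (c : Circle p q N P Dl x Y k ess)
    : ∃ a, ess a := by
  by_contra hcon
  push Not at hcon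
  have conn : ∀ s i, s ≤ i → Conn ess s i := fun s i h => ⟨h, fun j _ _ => hcon j⟩
  obtain ⟨z, hz, -, hz0⟩ := H.exists_zero c 0
  obtain ⟨w, hw, -, hw0⟩ := H.exists_neg c 0
  rcases (by have := c.k_le z; omega : k z < 2 ∨ k z = 2) with h | h
  · have h1 : 0 ≤ (2 * half n (k z) - 1) * p :=
      mul_nonneg (by have := H.half_pos (k z); omega) H.p_pos.le
    refine H.zeros_far c (j := z + (2 * half n (k z) - 1) * p) hz0 ?_ h le_rfl
      (conn _ _ (by linarith))
    rw [H.x_add_mul c, hz0]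
  · have h1 : k 0 = 2 := by rw [← (c.affine (conn 0 z hz)).1, h]
    exact H.two_special c h1 (conn 0 z hz) (conn 0 w hw) hz0 hw0

open Classical in
/-- The number of runs facing a face of kind `j` in the period. -/
noncomputable def runs (N : ℕ) (k : ℤ → ℕ) (ess : ℤ → Prop) (j : ℕ) : ℕ :=
  ((Finset.range N).filter fun i : ℕ => ess i ∧ k i = j).card

theorem Num.runs_spec (H : Num p q g n P Dl) (c : Circle p q N P Dl x Y k ess)
    (hN : (N : ℤ) = 2 * p * n) (h0 : ess 0) :
    4 * n ≤ runs N k ess 2 + 2 * runs N k ess 0 + (4 * n - 2) * runs N k ess 1 ∧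
    ∑ i ∈ Finset.range N, cwt k ess i =
      runs N k ess 2 + 2 * runs N k ess 0 + 2 * runs N k ess 1 := by
  classical
  have hp := H.p_pos
  have hn := H.two_le
  obtain ⟨E, hE⟩ : ∃ E, E = (Finset.range N).filter fun i : ℕ => ess i := ⟨_, rfl⟩
  obtain ⟨z, hz, hzp, hz0⟩ := H.exists_zero c 0
  obtain ⟨w, hw, hwp, hw0⟩ := H.exists_neg c 0
  -- the special positions
  obtain ⟨Z, hZ⟩ : ∃ Z, Z = (Finset.range (2 * n)).image fun j : ℕ => z + j * p := ⟨_, rfl⟩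
  obtain ⟨W, hW⟩ : ∃ W, W = (Finset.range (2 * n)).image fun j : ℕ => w + j * p := ⟨_, rfl⟩
  have inj : ∀ a : ℤ, Injective fun j : ℕ => a + j * p := fun a i j hij => by
    have : (i : ℤ) * p = j * p := by simpa using hij
    exact_mod_cast mul_right_cancel₀ hp.ne' this
  have cZ : Z.card = 2 * n := by
    rw [hZ, Finset.card_image_of_injective _ (inj z), Finset.card_range]
  have cW : W.card = 2 * n := by
    rw [hW, Finset.card_image_of_injective _ (inj w), Finset.card_range]
  have bd : ∀ a : ℤ, 0 ≤ a → a < 0 + p → ∀ j : ℕ, j < 2 * n → 0 ≤ a + j * p ∧ a + j * p < N := by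
    intro a h1 h2 j hj
    constructor
    · positivity
    · have : (j : ℤ) + 1 ≤ 2 * n := by exact_mod_cast hj
      nlinarith
  have mZ : ∀ i ∈ Z, 0 ≤ i ∧ i < N ∧ x i = 0 := by
    intro i hi
    obtain ⟨j, hj, rfl⟩ := Finset.mem_image.1 (hZ ▸ hi)
    obtain ⟨b1, b2⟩ := bd z hz hzp j (Finset.mem_range.1 hj)
    exact ⟨b1, b2, by rw [H.x_add_mul c, hz0]⟩
  have mW : ∀ i ∈ W, 0 ≤ i ∧ i < N ∧ x i = p - 1 := by
    intro i hi
    obtain ⟨j, hj, rfl⟩ := Finset.mem_image.1 (hW ▸ hi)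
    obtain ⟨b1, b2⟩ := bd w hw hwp j (Finset.mem_range.1 hj)
    exact ⟨b1, b2, by rw [H.x_add_mul c, hw0]⟩
  have dis : Disjoint Z W := Finset.disjoint_left.2 fun i h1 h2 => by
    have := (mZ i h1).2.2
    have := (mW i h2).2.2
    have := H.g_pos
    have := H.g_lt
    omega
  have cS : (Z ∪ W).card = 4 * n := by
    rw [Finset.card_union_of_disjoint dis]; omega
  have mS : ∀ i ∈ Z ∪ W, 0 ≤ i ∧ i < N ∧ (x i = 0 ∨ x i = p - 1) := by
    intro i hi
    rcases Finset.mem_union.1 hi with h | h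
    · exact ⟨(mZ i h).1, (mZ i h).2.1, .inl (mZ i h).2.2⟩
    · exact ⟨(mW i h).1, (mW i h).2.1, .inr (mW i h).2.2⟩
  -- the essential corner at which the run of `i` starts
  obtain ⟨st, hst⟩ : ∃ st : ℤ → ℕ, ∀ i, st i = Nat.findGreatest (fun t : ℕ => ess t) i.toNat :=
    ⟨_, fun _ => rfl⟩
  have hess : ∀ i, ess (st i) := fun i => by
    rw [hst]
    exact Nat.findGreatest_spec (P := fun t : ℕ => ess t) (Nat.zero_le _) (by simpa using h0)
  have hle : ∀ i, 0 ≤ i → (st i : ℤ) ≤ i := fun i hi => by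
    have := Nat.findGreatest_le (P := fun t : ℕ => ess t) i.toNat
    rw [← hst] at this
    omega
  have hconn : ∀ i, 0 ≤ i → Conn ess (st i) i := fun i hi => by
    refine ⟨hle i hi, fun j h1 h2 h3 => ?_⟩
    have := Nat.le_findGreatest (P := fun t : ℕ => ess t) (m := j.toNat) (n := i.toNat) (by omega)
      (by rw [Int.toNat_of_nonneg (by omega)]; exact h3)
    rw [← hst] at this
    omega
  have hmap : ∀ i ∈ Z ∪ W, st i ∈ E := fun i hi => by
    have := mS i hi
    have := hle i this.1
    rw [hE]
    simp only [Finset.mem_filter, Finset.mem_range]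
    exact ⟨by omega, hess i⟩
  have count := Finset.card_eq_sum_card_fiberwise hmap
  have bound : ∀ e ∈ E, ((Z ∪ W).filter fun i => st i = e).card ≤
      (if k e = 2 then 1 else 0) + 2 * (if k e = 0 then 1 else 0) +
      (4 * n - 2) * (if k e = 1 then 1 else 0) := by
    intro e _
    refine H.card_run c _ fun i hi => ?_
    simp only [Finset.mem_filter] at hi
    exact ⟨(mS i hi.1).2.2, hi.2 ▸ hconn i (mS i hi.1).1⟩
  have total := Finset.sum_le_sum bound
  rw [← count, cS, Finset.sum_add_distrib, Finset.sum_add_distrib, ← Finset.mul_sum,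
    ← Finset.mul_sum] at total
  have weight : ∑ i ∈ Finset.range N, cwt k ess i = ∑ e ∈ E, (if k e = 2 then 1 else 0) +
      2 * ∑ e ∈ E, (if k e = 0 then 1 else 0) + 2 * ∑ e ∈ E, (if k e = 1 then 1 else 0) := by
    rw [Finset.mul_sum, Finset.mul_sum, ← Finset.sum_add_distrib, ← Finset.sum_add_distrib, hE,
      Finset.sum_filter]
    refine Finset.sum_congr rfl fun i _ => ?_
    have hk := c.k_le i
    by_cases he : ess i
    · simp only [cwt, he, true_and, if_true]
      rcases (by omega : k i = 0 ∨ k i = 1 ∨ k i = 2) with h | h | h <;> simp [h]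
    · simp [cwt, he]
  have hruns : ∀ j, ∑ e ∈ E, (if k e = j then 1 else 0) = runs N k ess j := fun j => by
    rw [runs, hE, Finset.sum_filter, Finset.card_filter]
    refine Finset.sum_congr rfl fun i _ => ?_
    by_cases he : ess i <;> simp [he]
  rw [hruns, hruns, hruns] at total weight
  exact ⟨total, weight⟩

theorem Num.four_le_of_ess (H : Num p q g n P Dl) (c : Circle p q N P Dl x Y k ess)
    (hN : (N : ℤ) = 2 * p * n) (h0 : ess 0) :
    4 ≤ ∑ i ∈ Finset.range N, cwt k ess i := by
  have hn := H.two_le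
  obtain ⟨h1, h2⟩ := H.runs_spec c hN h0
  rw [h2]
  rcases (by omega : runs N k ess 1 = 0 ∨ runs N k ess 1 = 1 ∨ 2 ≤ runs N k ess 1) with h | h | h
  · rw [h] at h1; omega
  · rw [h] at h1; omega
  · omega

theorem Num.two_runs (H : Num p q g n P Dl) (c : Circle p q N P Dl x Y k ess)
    (hN : (N : ℤ) = 2 * p * n) (h0 : ess 0) (hk0 : k 0 = 0)
    (h4 : ∑ i ∈ Finset.range N, cwt k ess i = 4) :
    ∃ b : ℤ, 0 < b ∧ b < N ∧ ess b ∧ k b = 1 ∧ ∀ i : ℤ, 0 ≤ i → i < N → ess i → i = 0 ∨ i = b := by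
  classical
  have hn := H.two_le
  have hp := H.p_pos
  have hN0 : 0 < N := by
    have : 0 < (N : ℤ) := by rw [hN]; positivity
    exact_mod_cast this
  obtain ⟨h1, h2⟩ := H.runs_spec c hN h0
  have hA0 : 0 < runs N k ess 0 :=
    Finset.card_pos.2 ⟨0, by simpa [hN0] using ⟨h0, hk0⟩⟩
  have hA1 : 0 < runs N k ess 1 := by
    by_contra h
    have : runs N k ess 1 = 0 := by omega
    rw [this] at h1; omega
  obtain ⟨a, ha⟩ := Finset.card_eq_one.1 (show runs N k ess 0 = 1 by omega)
  obtain ⟨b, hb⟩ := Finset.card_eq_one.1 (show runs N k ess 1 = 1 by omega)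
  have hz := Finset.card_eq_zero.1 (show runs N k ess 2 = 0 by omega)
  have mem : ∀ (i j : ℕ), i < N → ess i → k i = j →
      i ∈ (Finset.range N).filter fun i : ℕ => ess i ∧ k i = j := fun i j h1 h2 h3 => by
    simp [h1, h2, h3]
  have hb' : b ∈ (Finset.range N).filter fun i : ℕ => ess i ∧ k i = 1 := by rw [hb]; simp
  simp only [Finset.mem_filter, Finset.mem_range] at hb'
  have ha0 : (0 : ℕ) = a := by
    have := mem 0 0 hN0 (by simpa using h0) (by simpa using hk0)
    rw [ha] at this; simpa using this
  refine ⟨b, ?_, by exact_mod_cast hb'.1, hb'.2.1, hb'.2.2, fun i hi hiN he => ?_⟩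
  · have : b ≠ 0 := by
      rintro rfl
      have := hb'.2.2
      simp [hk0] at this
    omega
  · lift i to ℕ using hi
    have hiN' : i < N := by exact_mod_cast hiN
    have hk := c.k_le i
    rcases (by omega : k i = 0 ∨ k i = 1 ∨ k i = 2) with h | h | h
    · have := mem i 0 hiN' he h
      rw [ha] at this; left; simp at this; omega
    · have := mem i 1 hiN' he h
      rw [hb] at this; right; simp at this; omega
    · have := mem i 2 hiN' he h
      rw [hz] at this; simp at this

theorem Num.four_le (H : Num p q g n P Dl) (c : Circle p q N P Dl x Y k ess)
    (hN : (N : ℤ) = 2 * p * n) : 4 ≤ ∑ i ∈ Finset.range N, cwt k ess i := by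
  obtain ⟨a, ha⟩ := H.exists_ess c
  rw [← sum_range_shift c.per_cwt a]
  exact H.four_le_of_ess (c.shift a) hN (by simpa using ha)

/-- What a relator face of minimal weight next to the face of kind `0` looks like. -/
structure Tight (p : ℤ) (P Dl : ℕ → ℤ) (x Y : ℤ → ℤ) (k : ℤ → ℕ) (ess : ℤ → Prop) : Prop where
  pos : 0 < Dl 1
  le : p + p * Dl 1 ≤ P 1
  lt_two : ∀ i, k i < 2
  start_zero : ∀ i, ess i → k i = 0 → k (i - 1) = 1 ∧
    p * Y (i - 1) - P 1 * x (i - 1) ≤ (p - 1) * Dl 1 + P 1 - p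
  start_one : ∀ i, ess i → k i = 1 → k (i - 1) = 0 ∧ (1 - p) * Dl 1 ≤ p * Y i - P 1 * x i
  exists_one : ∃ i, k i = 1

set_option maxHeartbeats 1000000 in
theorem Num.tight_base (H : Num p q g n P Dl) (c : Circle p q N P Dl x Y k ess)
    (hN : (N : ℤ) = 2 * p * n) (h0 : ess 0) (hk0 : k 0 = 0) (hD : 0 < Dl 0)
    (h4 : ∑ i ∈ Finset.range N, cwt k ess i = 4) : Tight p P Dl x Y k ess := by
  obtain ⟨b, hb0, hbN, hbe, hbk, honly⟩ := H.two_runs c hN h0 hk0 h4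
  have hp := H.p_pos
  have hg := H.g_pos
  have hg' := H.g_lt
  have hn : (2 : ℤ) ≤ n := by exact_mod_cast H.two_le
  have cO : ∀ i, 0 ≤ i → i < b → Conn ess 0 i := fun i h1 h2 => ⟨h1, fun j h3 h4 h5 => by
    rcases honly j (by omega) (by omega) h5 with h | h <;> omega⟩
  have cI : ∀ i, b ≤ i → i < N → Conn ess b i := fun i h1 h2 => ⟨h1, fun j h3 h4 h5 => by
    rcases honly j (by omega) (by omega) h5 with h | h <;> omega⟩
  obtain ⟨z, hz, hzp, hz0⟩ := H.exists_zero c 0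
  obtain ⟨w, hw, hwp, hw0⟩ := H.exists_neg c 0
  have hnp : 2 * p ≤ n * p := by nlinarith
  have far : ∀ i, 0 ≤ i → i < 0 + p → i + (2 * half n (k b) - 1) * p < N := fun i h1 h2 => by
    rw [hbk, hN]; simp only [half, if_true]; nlinarith
  have zero_lt : z < b := by
    by_contra h
    push Not at h
    have h1 := (c.affine (cI z h (by nlinarith))).1
    have h2 := far z hz hzp
    rw [← h1] at h2
    have h3 : 0 ≤ (2 * half n (k z) - 1) * p := by
      have := H.half_pos (k z); exact mul_nonneg (by omega) hp.le
    refine H.zeros_far c hz0 ((H.x_add_mul c z _).trans hz0) (by omega) le_rfl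
      ((cI z h (by omega)).between (cI _ (by omega) h2) (by omega))
  have neg_lt : w < b := by
    by_contra h
    push Not at h
    have h1 := (c.affine (cI w h (by nlinarith))).1
    have h2 := far w hw hwp
    rw [← h1] at h2
    have h3 : 0 ≤ (2 * half n (k w) - 1) * p := by
      have := H.half_pos (k w); exact mul_nonneg (by omega) hp.le
    refine H.negs_far c hw0 ((H.x_add_mul c w _).trans hw0) (by omega) le_rfl
      ((cI w h (by omega)).between (cI _ (by omega) h2) (by omega))
  have hneg : ∀ j : ℤ, x (z + g + j * p) = p - 1 := fun j => by
    refine H.x_eq (i := z) c ?_ (by omega) (by omega)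
    rw [hz0]; exact ⟨g + j, by ring⟩
  have hgP := H.pos_zero hD
  -- a position `z + g` facing the face of kind `0` is impossible
  have hzg : b ≤ z + g := by
    by_contra h
    push Not at h
    have := c.zero_neg hp (cO z hz zero_lt) (cO (z + g) (by omega) h) hz0 (by simpa using hneg 0)
    rw [hk0] at this
    nlinarith
  have hgz : p ≤ z + g := by
    by_contra h
    push Not at h
    have h1 := H.dvd_zero c (i := z + g) (j := w) (by rw [hw0]; simpa using (hneg 0).symm)
    have := Int.eq_zero_of_abs_lt_dvd h1 (by rw [abs_lt]; constructor <;> linarith)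
    omega
  have nN : z + (2 * n - 1) * p < N := by rw [hN]; nlinarith
  have n1 : z + g + (2 * n - 2) * p < N := by nlinarith
  have n2 : 2 * p ≤ (2 * n - 2) * p := by nlinarith
  have cz1 := cI (z + p) (by omega) (by nlinarith)
  have cz2 := cI (z + (2 * n - 1) * p) (by nlinarith) nN
  have cw1 := cI (z + g) hzg (by nlinarith)
  have cw2 := cI (z + g + (2 * n - 2) * p) (by nlinarith) n1
  have xz1 : x (z + p) = 0 := by simpa [hz0] using H.x_add_mul c z 1
  have xz2 : x (z + (2 * n - 1) * p) = 0 := (H.x_add_mul c z _).trans hz0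
  have xw1 : x (z + g) = p - 1 := by simpa using hneg 0
  have xw2 := hneg (2 * n - 2)
  have hD1 : 0 < Dl 1 := by
    by_contra h
    have hneg1 : Dl 1 < 0 := lt_of_le_of_ne (by omega) H.ne_one
    have h1 := c.zero_neg hp cz2 cw1 xz2 xw1
    have h2 := H.neg_one hneg1
    rw [hbk] at h1
    nlinarith
  have lw := (c.affine cw2).2
  have lz := (c.affine cz1).2
  have Yz := c.Y_nonneg (z + p)
  have Yw := c.Y_lt (z + g + (2 * n - 2) * p)
  rw [(c.affine cw2).1, hbk] at Yw
  rw [hbk, xw2] at lw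
  rw [hbk, xz1] at lz
  have E1 : 0 ≤ p * Y b - P 1 * x b + (z + p - b) * Dl 1 := by
    have := mul_nonneg hp.le Yz
    linarith
  have E2 : p * Y b - P 1 * x b + (z + g + (2 * n - 2) * p - b) * Dl 1 ≤ P 1 - p := by
    have := mul_le_mul_of_nonneg_left (Int.le_sub_one_of_lt Yw) hp.le
    linarith
  have hlast : k (N - 1) = 1 := by rw [(c.affine (cI (N - 1) (by omega) (by omega))).1, hbk]
  have hper : ∀ i : ℤ, ∃ j r : ℤ, 0 ≤ r ∧ r < N ∧ i = r + j * N := fun i =>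
    ⟨i / N, i % N, Int.emod_nonneg _ (by omega), Int.emod_lt_of_pos _ (by omega), by
      rw [mul_comm]; exact (Int.emod_add_mul_ediv i N).symm⟩
  have hkr : ∀ r : ℤ, 0 ≤ r → r < N → (r < b ∧ k r = 0) ∨ (b ≤ r ∧ k r = 1) := fun r h1 h2 => by
    rcases lt_or_ge r b with h | h
    · exact .inl ⟨h, by rw [(c.affine (cO r h1 h)).1, hk0]⟩
    · exact .inr ⟨h, by rw [(c.affine (cI r h h2)).1, hbk]⟩
  refine ⟨hD1, ?_, fun i => ?_, fun i hi hki => ?_, fun i hi hki => ?_, ⟨b, hbk⟩⟩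
  · have := mul_nonneg (show 0 ≤ g + ((2 * n - 2) * p - 2 * p) by linarith) hD1.le
    linarith
  · obtain ⟨j, r, h1, h2, rfl⟩ := hper i
    rw [(c.per_mul r j).2.2.1]
    rcases hkr r h1 h2 with h | h <;> omega
  · obtain ⟨j, r, h1, h2, rfl⟩ := hper i
    rw [(c.per_mul r j).2.2.1] at hki
    rw [(c.per_mul r j).2.2.2] at hi
    obtain rfl : r = 0 := by
      rcases honly r h1 h2 hi with h | h
      · exact h
      · rw [h, hbk] at hki; omega
    have e : 0 + j * N - 1 = (N - 1) + (j - 1) * N := by ring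
    obtain ⟨p1, p2, p3, -⟩ := c.per_mul (N - 1) (j - 1)
    rw [e, p1, p2, p3]
    refine ⟨hlast, ?_⟩
    have ll := (c.affine (cI (N - 1) (by omega) (by omega))).2
    rw [hbk] at ll
    have := mul_nonneg (show 0 ≤ p - 1 - (N - 1 - z - g - (2 * n - 2) * p) by
      rw [hN]; linarith) hD1.le
    linarith
  · obtain ⟨j, r, h1, h2, rfl⟩ := hper i
    rw [(c.per_mul r j).2.2.1] at hki
    rw [(c.per_mul r j).2.2.2] at hi
    obtain rfl : b = r := by
      rcases honly r h1 h2 hi with h | h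
      · rw [h, hk0] at hki; omega
      · exact h.symm
    have e : b + j * N - 1 = (b - 1) + j * N := by ring
    rw [e, (c.per_mul (b - 1) j).2.2.1, (c.per_mul b j).1, (c.per_mul b j).2.1]
    refine ⟨by rw [(c.affine (cO (b - 1) (by omega) (by omega))).1, hk0], ?_⟩
    have := mul_nonneg (show 0 ≤ b - 1 - z by omega) hD1.le
    linarith

theorem Circle.exists_start (c : Circle p q N P Dl x Y k ess) (hN : 0 < N) {a : ℤ} (ha : ess a)
    (i : ℤ) : ∃ s, ess s ∧ k s = k i := by
  classical
  obtain ⟨i', hi', hki⟩ : ∃ i', a ≤ i' ∧ k i' = k i := by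
    refine ⟨i + |a - i| * N, ?_, (c.per_mul i _).2.2.1⟩
    have := le_abs_self (a - i)
    have := abs_nonneg (a - i)
    have : (1 : ℤ) ≤ N := by exact_mod_cast hN
    nlinarith
  obtain ⟨t, ht⟩ : ∃ t, t = Nat.findGreatest (fun t : ℕ => ess (a + t)) (i' - a).toNat := ⟨_, rfl⟩
  have h1 : ess (a + t) := by
    rw [ht]
    exact Nat.findGreatest_spec (P := fun t : ℕ => ess (a + t)) (Nat.zero_le _) (by simpa using ha)
  have h2 : t ≤ (i' - a).toNat := ht ▸ Nat.findGreatest_le _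
  refine ⟨a + t, h1, ?_⟩
  rw [← hki]
  refine (c.affine ⟨by omega, fun j h3 h4 h5 => ?_⟩).1.symm
  have := Nat.le_findGreatest (P := fun t : ℕ => ess (a + t)) (m := (j - a).toNat)
    (n := (i' - a).toNat) (by omega)
      (by rw [Int.toNat_of_nonneg (by omega), add_sub_cancel]; exact h5)
  rw [← ht] at this
  omega

theorem Num.tight (H : Num p q g n P Dl) (c : Circle p q N P Dl x Y k ess)
    (hN : (N : ℤ) = 2 * p * n) {i : ℤ} (hi : k i = 0) (hD : 0 < Dl 0)
    (h4 : ∑ i ∈ Finset.range N, cwt k ess i = 4) : Tight p P Dl x Y k ess := by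
  have hN0 : 0 < N := by
    have := H.p_pos
    have := H.two_le
    have : 0 < (N : ℤ) := by rw [hN]; positivity
    exact_mod_cast this
  obtain ⟨a, ha⟩ := H.exists_ess c
  obtain ⟨s, hs, hks⟩ := c.exists_start hN0 ha i
  have T := H.tight_base (c.shift s) hN (by simpa using hs) (by simp [hks, hi]) hD
    (by rw [← h4]; exact sum_range_shift c.per_cwt s)
  have e : ∀ i, s + (i - s - 1) = i - 1 := fun i => by ring
  refine ⟨T.pos, T.le, fun i => ?_, fun i hi hk => ?_, fun i hi hk => ?_, ?_⟩
  · simpa using T.lt_two (i - s)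
  · simpa [e] using T.start_zero (i - s) (by simpa using hi) (by simpa using hk)
  · simpa [e] using T.start_one (i - s) (by simpa using hi) (by simpa using hk)
  · obtain ⟨i, hi⟩ := T.exists_one
    exact ⟨s + i, hi⟩

theorem Num.tight_neg (H : Num p q g n P Dl) (c : Circle p q N P Dl x Y k ess)
    (hN : (N : ℤ) = 2 * p * n) {i : ℤ} (hi : k i = 0) (hD : Dl 0 < 0)
    (h4 : ∑ i ∈ Finset.range N, cwt k ess i = 4) :
    Tight p P (fun k => -Dl k) (fun i => p - 1 - x i) (fun i => P (k i) - 1 - Y i) k ess :=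
  H.compl.tight (c.compl H.P_two) hN hi (by linarith) h4

end Weights

end

section
open Equiv Function
set_option linter.unusedSectionVars false

section Setup
variable {D : Type} [Fintype D] [DecidableEq D]

theorem pv_apply (f : Perm D) (d : D) : f⁻¹ (f d) = d := f.symm_apply_apply d

theorem apply_pv (f : Perm D) (d : D) : f (f⁻¹ d) = d := f.apply_symm_apply d

/-- The determinant of the slope of kind `k` with respect to the slope of the relator. -/
def Par.det (π : Par) (k : ℕ) : ℤ := π.P 2 * π.Q k - π.P k * π.Q 2

/-- A reduced closed diagram over suitable parameters with one face of each of the kinds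
`0` and `1`. -/
structure Setup (π : Par) (m : Dg D) (g : ℤ) (n : ℕ) : Prop where
  valid : Valid π m []
  red : ∀ d, m.kind d = 2 → m.kind (m.α d) = 2 → m.x (m.α d) ≠ π.P 2 - 1 - m.x d
  num : Num (π.P 2) (π.Q 2) g n π.P π.det
  N_two : (π.N 2 : ℤ) = 2 * π.P 2 * n
  N_zero : (π.N 0 : ℤ) = 2 * π.P 0
  N_one : (π.N 1 : ℤ) = 2 * π.P 1
  P_zero : 0 < π.P 0
  P_one : 0 < π.P 1
  cnt_zero : m.cnt 0 = π.N 0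
  cnt_one : m.cnt 1 = π.N 1
  two_le : 2 ≤ π.Q 2
  two_le' : 2 ≤ π.P 2 - π.Q 2
  ne : π.P 0 * π.Q 1 ≠ π.P 1 * π.Q 0

variable {π : Par} {m : Dg D} {g : ℤ} {n : ℕ}

theorem Setup.kind_le (S : Setup π m g n) (d : D) : m.kind d ≤ 3 := by
  have h1 := S.valid.kind_le d
  have h2 := (S.valid.free d).2
  have : m.kind d ≠ 4 := fun h => by simpa using h2 h
  omega

theorem Setup.live (S : Setup π m g n) {d : D} (hd : m.kind d < 3) : m.kind (m.α d) < 3 := by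
  by_contra hh
  have := S.valid.junk (m.α d) (by have := S.kind_le (m.α d); omega)
  rw [S.valid.inv] at this
  omega

theorem Setup.kind_φ (S : Setup π m g n) {d : D} (hd : m.kind d < 3) :
    m.kind (m.φ d) = m.kind d := (S.valid.face d hd).kind_next

theorem Setup.kind_pv (S : Setup π m g n) {d : D} (hd : m.kind d < 3) :
    m.kind (m.φ⁻¹ d) = m.kind d := by
  obtain ⟨e, rfl⟩ := m.φ.surjective d
  rw [pv_apply]
  have h : m.kind e < 3 := by
    by_contra hh
    obtain ⟨h1, -, h3⟩ := S.valid.junk e (by have := S.kind_le e; omega)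
    rw [h1] at hd
    omega
  exact (S.kind_φ h).symm

theorem Setup.kind_zpow (S : Setup π m g n) {d : D} (hd : m.kind d < 3) (i : ℤ) :
    m.kind ((m.φ ^ i) d) = m.kind d := by
  induction i using Int.induction_on with
  | zero => simp
  | succ i ih => rw [add_comm, zpow_add, zpow_one, Perm.mul_apply, S.kind_φ (by rw [ih]; exact hd), ih]
  | pred i ih =>
    rw [sub_eq_add_neg, add_comm, zpow_add, zpow_neg_one, Perm.mul_apply,
      S.kind_pv (by rw [ih]; exact hd), ih]

/-- Whether the level jumps at the corner of `d`. -/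
def Dg.lam (m : Dg D) (d : D) : ℤ := if m.sg d = m.sg (m.φ⁻¹ d) then 0 else 1

theorem Setup.x_eq (S : Setup π m g n) {d : D} (hd : m.kind d < 3) :
    m.x d = m.x (m.φ⁻¹ d) + π.Q (m.kind d) - m.lam d * π.P (m.kind d) := by
  have h := S.kind_pv hd
  have := (S.valid.face (m.φ⁻¹ d) (by omega)).x_next
  rw [apply_pv, h] at this
  rw [this, Dg.lam]
  split <;> simp

theorem Setup.smooth (S : Setup π m g n) {d : D} (hd : m.kind d < 3) (h : ¬ Ess m.φ m.α d) :
    m.φ (m.α d) = m.α (m.φ⁻¹ d) ∧ m.kind (m.α d) = m.kind (m.α (m.φ⁻¹ d)) ∧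
    m.x (m.α (m.φ⁻¹ d)) =
      m.x (m.α d) + π.Q (m.kind (m.α d)) - m.lam d * π.P (m.kind (m.α d)) := by
  have h1 : m.φ (m.α (m.φ (m.α d))) = d := not_not.1 h
  have h2 : m.φ (m.α d) = m.α (m.φ⁻¹ d) := by
    have : m.α (m.φ (m.α d)) = m.φ⁻¹ d := by rw [Perm.eq_inv_iff_eq, h1]
    rw [← this, S.valid.inv]
  have h3 := S.live hd
  have h4 := S.kind_φ h3
  refine ⟨h2, by rw [← h2, h4], ?_⟩
  have h5 := (S.valid.face _ h3).x_next
  rw [h2, S.valid.sg_edge, S.valid.sg_edge] at h5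
  rw [h5, Dg.lam]
  have : ((!m.sg (m.φ⁻¹ d)) = !m.sg d) ↔ m.sg d = m.sg (m.φ⁻¹ d) := by
    rw [Bool.not_inj_iff]; exact eq_comm
  simp only [this]
  split <;> simp

theorem zpow_succ_apply (f : Perm D) (i : ℤ) (d : D) : (f ^ (i + 1)) d = f ((f ^ i) d) := by
  rw [add_comm, zpow_add, zpow_one, Perm.mul_apply]

theorem Setup.circle (S : Setup π m g n) {d : D} (hd : m.kind d = 2) :
    Circle (π.P 2) (π.Q 2) (π.N 2) π.P π.det (fun i => m.x ((m.φ ^ i) d))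
      (fun i => π.P (m.kind (m.α ((m.φ ^ i) d))) - 1 - m.x (m.α ((m.φ ^ i) d)))
      (fun i => m.kind (m.α ((m.φ ^ i) d))) (fun i => Ess m.φ m.α ((m.φ ^ i) d)) := by
  have hk : ∀ i : ℤ, m.kind ((m.φ ^ i) d) = 2 := fun i => by rw [S.kind_zpow (by omega), hd]
  have hl : ∀ i : ℤ, m.kind (m.α ((m.φ ^ i) d)) < 3 := fun i => S.live (by rw [hk]; omega)
  have hN : m.φ^[π.N 2] d = d := ((S.valid.face d (by omega)).period _).2 (by rw [hd])
  have per : ∀ i : ℤ, (m.φ ^ (i + π.N 2)) d = (m.φ ^ i) d := fun i => by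
    rw [zpow_add, Perm.mul_apply, zpow_natCast, Perm.coe_pow, hN]
  have hx : ∀ i : ℤ, m.x ((m.φ ^ (i + 1)) d) = m.x ((m.φ ^ i) d) + π.Q 2 -
      m.lam ((m.φ ^ (i + 1)) d) * π.P 2 := fun i => by
    have := S.x_eq (d := (m.φ ^ (i + 1)) d) (by rw [hk]; omega)
    rw [hk] at this
    rw [this, zpow_succ_apply, pv_apply]
  constructor
  · exact fun i => (S.valid.face _ (by rw [hk]; omega)).x_nonneg
  · intro i
    have := (S.valid.face ((m.φ ^ i) d) (by rw [hk]; omega)).x_lt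
    rwa [hk] at this
  · intro i
    exact ⟨-m.lam ((m.φ ^ (i + 1)) d), by rw [hx]; ring⟩
  · intro i
    have := (S.valid.face _ (hl i)).x_lt
    omega
  · intro i
    have := (S.valid.face _ (hl i)).x_nonneg
    omega
  · exact fun i => by have := hl i; omega
  · intro i hi
    obtain ⟨-, h1, h2⟩ := S.smooth (by rw [hk]; omega) hi
    have hp : m.φ⁻¹ ((m.φ ^ (i + 1)) d) = (m.φ ^ i) d := by
      rw [zpow_succ_apply, pv_apply]
    rw [hp] at h1 h2
    refine ⟨h1, ?_⟩
    rw [hx, h1]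
    rw [h1] at h2
    rw [h2, Par.det]
    ring
  · intro i hi h
    have := S.red ((m.φ ^ i) d) (hk i) hi
    rw [hi] at h
    omega
  · exact fun i => by rw [per]
  · exact fun i => by rw [per]
  · exact fun i => by rw [per]
  · exact fun i => by rw [per]

theorem sum_wt (φ α : Perm D) (kind : D → ℕ) (d : D) (N : ℕ) :
    ∑ i ∈ Finset.range N, wt φ α kind (φ^[i] d) = ∑ i ∈ Finset.range N,
      cwt (fun i => kind (α ((φ ^ i) d))) (fun i => Ess φ α ((φ ^ i) d)) i := by
  refine Finset.sum_congr rfl fun i _ => ?_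
  have h : (φ ^ (i : ℤ)) d = φ^[i] d := by rw [zpow_natCast, Perm.coe_pow]
  rw [wt, cwt, h]

theorem Setup.N_two_pos (S : Setup π m g n) : 0 < π.N 2 := by
  have := S.num.p_pos
  have := S.num.two_le
  have : 0 < (π.N 2 : ℤ) := by rw [S.N_two]; positivity
  exact_mod_cast this

theorem Setup.curvature (S : Setup π m g n) :
    (∀ d, m.kind d < 3 → Ess m.φ m.α d → (m.φ * m.α)^[4] d = d) ∧
    (∀ d, m.kind d = 2 → ∑ i ∈ Finset.range (π.N 2), wt m.φ m.α m.kind (m.φ^[i] d) = 4) ∧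
    (∀ d, m.kind d < 2 → Ess m.φ m.α d →
      ∃ c, m.kind c = 2 ∧ m.kind (m.α c) < 2 ∧ (m.φ * m.α) c = d) := by
  have per : ∀ k < 3, ∀ d, m.kind d = k → ∀ i, m.φ^[i] d = d → π.N k ∣ i := fun k hk d hd i hi => by
    have := ((S.valid.face d (by omega)).period i).1 hi
    rwa [hd] at this
  have n0 : 0 < π.N 0 := by have := S.N_zero; have := S.P_zero; omega
  have n1 : 0 < π.N 1 := by have := S.N_one; have := S.P_one; omega
  exact Heckoid.curvature S.valid.planar S.valid.inv S.valid.fpf S.valid.gen_edge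
    (fun d hd => (S.valid.face d hd).gen_next) (fun d hd => (S.valid.face d hd).kind_next) S.kind_le
    S.valid.junk S.N_two_pos n0 n1 (per 0 (by omega)) (per 1 (by omega)) (per 2 (by omega))
    S.cnt_zero S.cnt_one fun d hd => by
      rw [sum_wt]; exact S.num.four_le (S.circle hd) S.N_two

theorem Setup.single (S : Setup π m g n) {k : ℕ} (hk : k < 2) {d e : D} (hd : m.kind d = k)
    (he : m.kind e = k) : ∃ i : ℕ, m.φ^[i] d = e := by
  have hcnt : m.cnt k = π.N k := by
    rcases (by omega : k = 0 ∨ k = 1) with rfl | rfl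
    · exact S.cnt_zero
    · exact S.cnt_one
  have hper : ∀ i, m.φ^[i] d = d ↔ π.N k ∣ i := fun i => by
    have := (S.valid.face d (by omega)).period i
    rwa [hd] at this
  have hinj : Set.InjOn (fun i => m.φ^[i] d) (Finset.range (π.N k) : Set ℕ) := by
    have key : ∀ i j, i < j → j < π.N k → m.φ^[i] d ≠ m.φ^[j] d := fun i j hij hj h => by
      have h1 : m.φ^[i] (m.φ^[j - i] d) = m.φ^[i] d := by
        rw [← iterate_add_apply, Nat.add_sub_cancel' hij.le, h]
      have := Nat.eq_zero_of_dvd_of_lt ((hper _).1 ((m.φ.injective.iterate i) h1)) (by omega)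
      omega
    intro i hi j hj hij
    simp only [Finset.coe_range, Set.mem_Iio] at hi hj
    rcases lt_trichotomy i j with hh | hh | hh
    · exact absurd hij (key i j hh hj)
    · exact hh
    · exact absurd hij.symm (key j i hh hi)
  have hsub : (Finset.range (π.N k)).image (fun i => m.φ^[i] d) ⊆
      Finset.univ.filter fun d => m.kind d = k := by
    intro z hz
    obtain ⟨i, -, rfl⟩ := Finset.mem_image.1 hz
    simp only [Finset.mem_filter, Finset.mem_univ, true_and]
    rw [(Face.gen_iterate S.valid.face (by omega) i).1, hd]
  have heq := Finset.eq_of_subset_of_card_le hsub (by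
    rw [Finset.card_image_of_injOn hinj, Finset.card_range, ← hcnt]; rfl)
  have : e ∈ (Finset.range (π.N k)).image (fun i => m.φ^[i] d) := by rw [heq]; simp [he]
  obtain ⟨i, -, hi⟩ := Finset.mem_image.1 this
  exact ⟨i, hi⟩

theorem Setup.induction (S : Setup π m g n) {k : ℕ} (hk : k < 2) {p : D → Prop} {d : D}
    (hd : m.kind d = k) (h0 : p d) (hs : ∀ e, m.kind e = k → p e → p (m.φ e)) (e : D)
    (he : m.kind e = k) : p e := by
  obtain ⟨i, rfl⟩ := S.single hk hd he
  clear he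
  have : m.kind (m.φ^[i] d) = k ∧ p (m.φ^[i] d) := by
    induction i with
    | zero => exact ⟨hd, h0⟩
    | succ i ih =>
      rw [iterate_succ_apply']
      exact ⟨by rw [S.kind_φ (by omega), ih.1], hs _ ih.1 ih.2⟩
  exact this.2

theorem Setup.exists_kind (S : Setup π m g n) {k : ℕ} (hk : k < 2) : ∃ d, m.kind d = k := by
  have hcnt : 0 < m.cnt k := by
    rcases (by omega : k = 0 ∨ k = 1) with rfl | rfl
    · rw [S.cnt_zero]; have := S.N_zero; have := S.P_zero; omega
    · rw [S.cnt_one]; have := S.N_one; have := S.P_one; omega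
  obtain ⟨d, hd⟩ := Finset.card_pos.1 hcnt
  exact ⟨d, by simpa using hd⟩

theorem Setup.exists_ess_zero (S : Setup π m g n) : ∃ o, m.kind o = 0 ∧ Ess m.φ m.α o := by
  by_contra hcon
  push Not at hcon
  have hsm : ∀ z, m.kind z = 0 → m.φ (m.α z) = m.α (m.φ⁻¹ z) ∧
      m.kind (m.α z) = m.kind (m.α (m.φ⁻¹ z)) ∧ m.x (m.α (m.φ⁻¹ z)) =
      m.x (m.α z) + π.Q (m.kind (m.α z)) - m.lam z * π.P (m.kind (m.α z)) :=
    fun z hz => S.smooth (by omega) (hcon z hz)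
  have hφ : ∀ z, m.kind z = 0 → m.kind (m.φ z) = 0 := fun z hz => by rw [S.kind_φ (by omega), hz]
  have hpv : ∀ z, m.kind z = 0 → m.kind (m.φ⁻¹ z) = 0 := fun z hz => by
    rw [S.kind_pv (by omega), hz]
  obtain ⟨o, ho⟩ := S.exists_kind (k := 0) (by omega)
  have hit : ∀ i, m.kind (m.φ^[i] o) = 0 := fun i => by
    rw [(Face.gen_iterate S.valid.face (by omega) i).1, ho]
  have hback : ∀ i, m.φ^[i] (m.α (m.φ^[i] o)) = m.α o := by
    intro i
    induction i with
    | zero => rfl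
    | succ i ih =>
      have := (hsm _ (hit (i + 1))).1
      rw [iterate_succ_apply' _ i o, pv_apply] at this
      rw [iterate_succ_apply, iterate_succ_apply' _ i o, this, ih]
  have hlive : m.kind (m.α o) < 3 := S.live (by omega)
  have hkind : ∀ i, m.kind (m.α (m.φ^[i] o)) = m.kind (m.α o) := by
    intro i
    induction i with
    | zero => rfl
    | succ i ih =>
      have := (hsm _ (hit (i + 1))).2.1
      rw [iterate_succ_apply' _ i o, pv_apply, ih] at this
      rw [iterate_succ_apply' _ i o, this]
  rcases (by omega : m.kind (m.α o) = 0 ∨ m.kind (m.α o) = 1 ∨ m.kind (m.α o) = 2) with h | h | h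
  · obtain ⟨i, hi⟩ := S.single (by omega) ho h
    have := (Face.gen_iterate S.valid.face (by omega : m.kind o < 3) i).2
    rw [hi, S.valid.gen_edge] at this
    obtain ⟨t, rfl⟩ := this.1 rfl
    have h1 := hback t
    rw [← hi, iterate_add_apply] at h1
    exact S.valid.fpf _ ((m.φ.injective.iterate t) h1)
  · have key : ∀ i : ℕ, π.P 0 * m.x (m.α (m.φ^[i] o)) + π.P 1 * m.x (m.φ^[i] o) =
        π.P 0 * m.x (m.α o) + π.P 1 * m.x o + i * (π.P 1 * π.Q 0 - π.P 0 * π.Q 1) := by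
      intro i
      induction i with
      | zero => simp
      | succ i ih =>
        have h1 := (hsm _ (hit (i + 1))).2.2
        have h2 := S.x_eq (d := m.φ^[i + 1] o) (by rw [hit]; omega)
        rw [hkind, h] at h1
        rw [hit] at h2
        rw [iterate_succ_apply' _ i o, pv_apply] at h1 h2
        rw [iterate_succ_apply' _ i o]
        push_cast
        linear_combination ih + π.P 1 * h2 - π.P 0 * h1
    have h1 := key (orderOf m.φ)
    rw [← Perm.coe_pow, pow_orderOf_eq_one, Perm.one_apply] at h1
    have h2 : (orderOf m.φ : ℤ) ≠ 0 := by exact_mod_cast (orderOf_pos m.φ).ne'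
    have h3 : (orderOf m.φ : ℤ) * (π.P 1 * π.Q 0 - π.P 0 * π.Q 1) = 0 := by linarith
    rcases mul_eq_zero.1 h3 with h4 | h4
    · exact h2 h4
    · exact S.ne (by linarith)
  · obtain ⟨i, hi⟩ := S.num.exists_ess (S.circle h)
    have hz : ∀ i : ℤ, ∃ z, m.kind z = 0 ∧ (m.φ ^ i) (m.α o) = m.α z := by
      intro i
      induction i using Int.induction_on with
      | zero => exact ⟨o, ho, rfl⟩
      | succ i ih =>
        obtain ⟨z, hz, h1⟩ := ih
        exact ⟨m.φ⁻¹ z, hpv z hz, by rw [zpow_succ_apply, h1, (hsm z hz).1]⟩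
      | pred i ih =>
        obtain ⟨z, hz, h1⟩ := ih
        refine ⟨m.φ z, hφ z hz, ?_⟩
        have h2 := (hsm _ (hφ z hz)).1
        rw [pv_apply, ← h1] at h2
        rw [sub_eq_add_neg, add_comm, zpow_add, zpow_neg_one, Perm.mul_apply, ← h2,
          pv_apply]
    obtain ⟨z, hz, h1⟩ := hz i
    refine hi ?_
    have h2 := (hsm _ (hφ z hz)).1
    rw [pv_apply] at h2
    rw [h1, Perm.mul_apply, Perm.mul_apply, S.valid.inv, h2]

end Setup

end

section
open Equiv Function
set_option linter.unusedSectionVars false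

section Final
variable {D : Type} [Fintype D] [DecidableEq D] {π : Par} {m : Dg D} {g : ℤ} {n : ℕ}

/-- The relator face of `d` has an edge in common with the face of kind `0`. -/
def Dg.Touch (m : Dg D) (d : D) : Prop := m.kind d = 2 ∧ ∃ i : ℤ, m.kind (m.α ((m.φ ^ i) d)) = 0

theorem Setup.touch_φ (S : Setup π m g n) {d : D} (h : m.Touch d) : m.Touch (m.φ d) := by
  obtain ⟨h1, i, hi⟩ := h
  refine ⟨by rw [S.kind_φ (by omega), h1], i - 1, ?_⟩
  have e : (m.φ ^ (i - 1)) (m.φ d) = (m.φ ^ i) d := by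
    rw [← Perm.mul_apply, ← zpow_add_one, sub_add_cancel]
  rwa [e]

theorem Setup.touch_pv (S : Setup π m g n) {d : D} (h : m.Touch d) : m.Touch (m.φ⁻¹ d) := by
  obtain ⟨h1, i, hi⟩ := h
  refine ⟨by rw [S.kind_pv (by omega), h1], i + 1, ?_⟩
  rwa [zpow_add_one, Perm.mul_apply, apply_pv]

/-- `Tight` read off at the darts of a relator face. -/
theorem Setup.tight_pos (S : Setup π m g n) (hD : 0 < π.det 0) {d : D} (h : m.Touch d) :
    0 < π.det 1 ∧ π.P 2 + π.P 2 * π.det 1 ≤ π.P 1 ∧ m.kind (m.α d) < 2 ∧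
    (Ess m.φ m.α d → m.kind (m.α d) = 0 → m.kind (m.α (m.φ⁻¹ d)) = 1 ∧
      π.P 2 * (π.P 1 - 1 - m.x (m.α (m.φ⁻¹ d))) - π.P 1 * m.x (m.φ⁻¹ d) ≤
        (π.P 2 - 1) * π.det 1 + π.P 1 - π.P 2) ∧
    (Ess m.φ m.α d → m.kind (m.α d) = 1 → m.kind (m.α (m.φ⁻¹ d)) = 0 ∧
      (1 - π.P 2) * π.det 1 ≤ π.P 2 * (π.P 1 - 1 - m.x (m.α d)) - π.P 1 * m.x d) ∧
    ∃ i : ℤ, m.kind (m.α ((m.φ ^ i) d)) = 1 := by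
  obtain ⟨h1, i, hi⟩ := h
  have T := S.num.tight (S.circle h1) S.N_two hi hD (by
    rw [← sum_wt]; exact S.curvature.2.1 d h1)
  have e : (m.φ ^ (0 - 1 : ℤ)) d = m.φ⁻¹ d := by rw [zero_sub, zpow_neg_one]
  refine ⟨T.pos, T.le, T.lt_two 0, fun he hk => ?_, fun he hk => ?_, T.exists_one⟩
  · have := T.start_zero 0 he hk
    simp only [e] at this
    refine ⟨this.1, ?_⟩
    have h2 := this.2
    rwa [this.1] at h2
  · have := T.start_one 0 he hk
    simp only [e, zpow_zero, Perm.one_apply] at this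
    refine ⟨this.1, ?_⟩
    have h2 := this.2
    rwa [hk] at h2

theorem Setup.tight_neg (S : Setup π m g n) (hD : π.det 0 < 0) {d : D} (h : m.Touch d) :
    π.det 1 < 0 ∧ π.P 2 + π.P 2 * -π.det 1 ≤ π.P 1 ∧ m.kind (m.α d) < 2 ∧
    (Ess m.φ m.α d → m.kind (m.α d) = 0 → m.kind (m.α (m.φ⁻¹ d)) = 1 ∧
      π.P 2 * m.x (m.α (m.φ⁻¹ d)) - π.P 1 * (π.P 2 - 1 - m.x (m.φ⁻¹ d)) ≤
        (π.P 2 - 1) * -π.det 1 + π.P 1 - π.P 2) ∧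
    (Ess m.φ m.α d → m.kind (m.α d) = 1 → m.kind (m.α (m.φ⁻¹ d)) = 0 ∧
      (1 - π.P 2) * -π.det 1 ≤ π.P 2 * m.x (m.α d) - π.P 1 * (π.P 2 - 1 - m.x d)) ∧
    ∃ i : ℤ, m.kind (m.α ((m.φ ^ i) d)) = 1 := by
  obtain ⟨h1, i, hi⟩ := h
  have T := S.num.tight_neg (S.circle h1) S.N_two hi hD (by
    rw [← sum_wt]; exact S.curvature.2.1 d h1)
  have e : (m.φ ^ (0 - 1 : ℤ)) d = m.φ⁻¹ d := by rw [zero_sub, zpow_neg_one]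
  refine ⟨by linarith [T.pos], T.le, T.lt_two 0, fun he hk => ?_, fun he hk => ?_, T.exists_one⟩
  · have := T.start_zero 0 he hk
    simp only [e, sub_sub_cancel] at this
    exact this
  · have := T.start_one 0 he hk
    simp only [e, zpow_zero, Perm.one_apply, sub_sub_cancel] at this
    exact this

theorem Setup.touch_spec (S : Setup π m g n) {d : D} (h : m.Touch d) : m.kind (m.α d) < 2 ∧
    (Ess m.φ m.α d → m.kind (m.α d) = 0 → m.kind (m.α (m.φ⁻¹ d)) = 1) ∧
    (Ess m.φ m.α d → m.kind (m.α d) = 1 → m.kind (m.α (m.φ⁻¹ d)) = 0) ∧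
    ∃ i : ℤ, m.kind (m.α ((m.φ ^ i) d)) = 1 := by
  rcases lt_or_gt_of_ne S.num.ne_zero with hD | hD
  · obtain ⟨-, -, h1, h2, h3, h4⟩ := S.tight_neg hD h
    exact ⟨h1, fun a b => (h2 a b).1, fun a b => (h3 a b).1, h4⟩
  · obtain ⟨-, -, h1, h2, h3, h4⟩ := S.tight_pos hD h
    exact ⟨h1, fun a b => (h2 a b).1, fun a b => (h3 a b).1, h4⟩

theorem ess_next {φ α : Perm D} {d : D} (h : Ess φ α d) : Ess φ α (φ (α d)) := fun h' =>
  h ((φ * α).injective h')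

/-- The four corners `o, X, i, F` at an essential vertex of the face of kind `0`. -/
structure Vertex (m : Dg D) (o X i F : D) : Prop where
  next_o : m.φ (m.α o) = X
  next_X : m.φ (m.α X) = i
  next_i : m.φ (m.α i) = F
  next_F : m.φ (m.α F) = o
  ess_o : Ess m.φ m.α o
  ess_X : Ess m.φ m.α X
  ess_i : Ess m.φ m.α i
  ess_F : Ess m.φ m.α F
  kind_o : m.kind o = 0
  touch_X : m.Touch X
  kind_i : m.kind i = 1
  touch_F : m.Touch F
  kind_αo : m.kind (m.α o) = 2
  kind_αX : m.kind (m.α X) = 1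
  kind_αF : m.kind (m.α F) = 0

theorem Setup.vertex (S : Setup π m g n) {o : D} (ho : m.kind o = 0) (he : Ess m.φ m.α o) :
    ∃ X i F, Vertex m o X i F := by
  obtain ⟨E1, -, E3⟩ := S.curvature
  obtain ⟨F, hF, -, hFo⟩ := E3 o (by omega) he
  rw [Perm.mul_apply] at hFo
  have h4 := E1 o (by omega) he
  simp only [iterate_succ_apply', iterate_zero, id_eq, Perm.mul_apply] at h4
  obtain ⟨X, hX⟩ : ∃ X, m.φ (m.α o) = X := ⟨_, rfl⟩
  obtain ⟨i, hi⟩ : ∃ i, m.φ (m.α X) = i := ⟨_, rfl⟩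
  rw [hX, hi] at h4
  have hiF : m.φ (m.α i) = F := m.α.injective (m.φ.injective (h4.trans hFo.symm))
  have eX : Ess m.φ m.α X := hX ▸ ess_next he
  have ei : Ess m.φ m.α i := hi ▸ ess_next eX
  have eF : Ess m.φ m.α F := hiF ▸ ess_next ei
  have kαF : m.kind (m.α F) = 0 := by
    rw [← S.kind_φ (S.live (by omega)), hFo, ho]
  have tF : m.Touch F := ⟨hF, 0, by simpa using kαF⟩
  have ki : m.kind i = 1 := by
    rw [← (S.touch_spec tF).2.1 eF kαF, ← hiF, pv_apply, S.valid.inv]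
  have kX : m.kind X = 2 := by
    obtain ⟨c, hc, -, hci⟩ := E3 i (by omega) ei
    rw [← hi, Perm.mul_apply] at hci
    rw [← m.α.injective (m.φ.injective hci), hc]
  have kαX : m.kind (m.α X) = 1 := by
    rw [← S.kind_φ (S.live (by omega)), hi, ki]
  have kαo : m.kind (m.α o) = 2 := by
    rw [← S.kind_φ (S.live (by omega)), hX, kX]
  have tX : m.Touch X := by
    rw [← hX]
    exact S.touch_φ ⟨kαo, 0, by simpa [S.valid.inv] using ho⟩
  exact ⟨X, i, F, hX, hi, hiF, hFo, he, eX, ei, eF, ho, tX, ki, tF, kαo, kαX, kαF⟩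

theorem Setup.touch_zero (S : Setup π m g n) {o : D} (ho : m.kind o = 0) : m.Touch (m.α o) := by
  refine ⟨?_, 0, by simpa [S.valid.inv] using ho⟩
  obtain ⟨o₀, h0, he⟩ := S.exists_ess_zero
  obtain ⟨X, i, F, V⟩ := S.vertex h0 he
  refine S.induction (k := 0) (by omega) h0 (p := fun o => m.kind (m.α o) = 2) V.kind_αo ?_ o ho
  intro e hk h
  have hk' : m.kind (m.φ e) = 0 := by rw [S.kind_φ (by omega), hk]
  by_cases hes : Ess m.φ m.α (m.φ e)
  · obtain ⟨X, i, F, V⟩ := S.vertex hk' hes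
    exact V.kind_αo
  · have := (S.smooth (by omega) hes).2.1
    rw [pv_apply, h] at this
    exact this

/-- An essential corner of the face of kind `1` preceded by an edge on a touching face. -/
theorem Setup.vertex_of_one (S : Setup π m g n) {i : D} (hi : m.kind i = 1)
    (he : Ess m.φ m.α i) (ht : m.Touch (m.α (m.φ⁻¹ i))) : ∃ o X F, Vertex m o X i F := by
  obtain ⟨E1, -, E3⟩ := S.curvature
  obtain ⟨X, hX⟩ : ∃ X, X = m.α (m.φ⁻¹ i) := ⟨_, rfl⟩
  rw [← hX] at ht
  have hXi : m.φ (m.α X) = i := by rw [hX, S.valid.inv, apply_pv]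
  have kαX : m.kind (m.α X) = 1 := by rw [hX, S.valid.inv, S.kind_pv (by omega), hi]
  have eX : Ess m.φ m.α X := fun h => he (by
    rw [← hXi]; exact congrArg (m.φ * m.α) h)
  have h0 := (S.touch_spec ht).2.2.1 eX kαX
  obtain ⟨o, ho⟩ : ∃ o, o = m.α (m.φ⁻¹ X) := ⟨_, rfl⟩
  rw [← ho] at h0
  have hoX : m.φ (m.α o) = X := by rw [ho, S.valid.inv, apply_pv]
  have eo : Ess m.φ m.α o := fun h => eX (by
    rw [← hoX]; exact congrArg (m.φ * m.α) h)
  obtain ⟨X', i', F, V⟩ := S.vertex h0 eo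
  obtain rfl : X' = X := by rw [← hoX, V.next_o]
  obtain rfl : i' = i := by rw [← hXi, V.next_X]
  exact ⟨o, X', F, V⟩

theorem Setup.touch_one (S : Setup π m g n) {i : D} (hi : m.kind i = 1) : m.Touch (m.α i) := by
  obtain ⟨o₀, h0⟩ := S.exists_kind (k := 0) (by omega)
  have hT := S.touch_zero h0
  obtain ⟨j, hj⟩ := (S.touch_spec hT).2.2.2
  have hTj : ∀ j : ℤ, m.Touch ((m.φ ^ j) (m.α o₀)) := fun j => by
    refine ⟨by rw [S.kind_zpow (by have := hT.1; omega), hT.1], ?_⟩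
    obtain ⟨-, t, ht⟩ := hT
    have e : (m.φ ^ (t - j)) ((m.φ ^ j) (m.α o₀)) = (m.φ ^ t) (m.α o₀) := by
      rw [← Perm.mul_apply, ← zpow_add, sub_add_cancel]
    exact ⟨t - j, by rwa [e]⟩
  refine S.induction (k := 1) (by omega) hj (p := fun i => m.Touch (m.α i))
    (by rw [S.valid.inv]; exact hTj j) ?_ i hi
  intro e hk h
  have hk' : m.kind (m.φ e) = 1 := by rw [S.kind_φ (by omega), hk]
  by_cases hes : Ess m.φ m.α (m.φ e)
  · obtain ⟨o, X, F, V⟩ := S.vertex_of_one hk' hes (by rwa [pv_apply])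
    have := S.touch_pv V.touch_F
    rwa [← V.next_i, pv_apply] at this
  · have := (S.smooth (by omega) hes).1
    rw [pv_apply] at this
    have h2 := S.touch_pv (d := m.φ (m.α (m.φ e))) (by rw [this]; exact h)
    rwa [pv_apply] at h2

theorem Setup.lam_next (S : Setup π m g n) (d : D) :
    m.lam (m.φ (m.α d)) = if m.sg (m.φ (m.α d)) = m.sg d then 1 else 0 := by
  rw [Dg.lam, pv_apply, S.valid.sg_edge]
  cases m.sg (m.φ (m.α d)) <;> cases m.sg d <;> rfl

theorem Setup.lam_smooth (S : Setup π m g n) {d : D} (h : ¬ Ess m.φ m.α d) :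
    m.lam d - m.lam (m.φ (m.α d)) = 0 := by
  have h1 : m.φ (m.α (m.φ (m.α d))) = d := not_not.1 h
  have h2 := S.lam_next d
  have h3 := S.lam_next (m.φ (m.α d))
  rw [h1] at h3
  rw [h2, h3]
  simp only [eq_comm, sub_self]

/-- The alternating sum of the jumps around a vertex. -/
def Dg.alt (m : Dg D) (o X i F : D) : ℤ := m.lam o - m.lam X + (m.lam i - m.lam F)

theorem Vertex.jumps {o X i F : D} (V : Vertex m o X i F) (S : Setup π m g n) :
    m.alt o X i F = 0 ∨ (m.lam o = 1 ∧ m.lam i = 1 ∧ m.lam X = 0 ∧ m.lam F = 0) ∨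
      (m.lam o = 0 ∧ m.lam i = 0 ∧ m.lam X = 1 ∧ m.lam F = 1) := by
  have h1 := S.lam_next o
  have h2 := S.lam_next X
  have h3 := S.lam_next i
  have h4 := S.lam_next F
  rw [V.next_o] at h1
  rw [V.next_X] at h2
  rw [V.next_i] at h3
  rw [V.next_F] at h4
  rw [Dg.alt, h1, h2, h3, h4]
  cases m.sg o <;> cases m.sg X <;> cases m.sg i <;> cases m.sg F <;> decide

theorem Vertex.equations {o X i F : D} (V : Vertex m o X i F) (S : Setup π m g n) :
    m.α (m.φ⁻¹ F) = i ∧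
    m.x i = m.x (m.α X) + π.Q 1 - m.lam i * π.P 1 ∧
    m.x X = m.x (m.φ⁻¹ X) + π.Q 2 - m.lam X * π.P 2 ∧
    m.x F = m.x (m.φ⁻¹ F) + π.Q 2 - m.lam F * π.P 2 ∧
    0 ≤ m.x (m.φ⁻¹ X) ∧ m.x (m.φ⁻¹ X) < π.P 2 ∧ 0 ≤ m.x F ∧ m.x F < π.P 2 := by
  have hX := V.touch_X.1
  have hF := V.touch_F.1
  have hX' := (S.touch_pv V.touch_X).1
  have h1 := S.x_eq (d := i) (by rw [V.kind_i]; omega)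
  have h2 := S.x_eq (d := X) (by omega)
  have h3 := S.x_eq (d := F) (by omega)
  rw [V.kind_i] at h1
  rw [hX] at h2
  rw [hF] at h3
  have f1 := S.valid.face F (by omega)
  have f2 := S.valid.face (m.φ⁻¹ X) (by omega)
  have l1 := f1.x_lt
  have l2 := f2.x_lt
  rw [hF] at l1
  rw [hX'] at l2
  refine ⟨by rw [← V.next_i, pv_apply, S.valid.inv], ?_, h2, h3, f2.x_nonneg, l2, f1.x_nonneg, l1⟩
  rw [h1]
  congr 3
  rw [← V.next_X, pv_apply]

theorem Vertex.alt_nonpos {o X i F : D} (V : Vertex m o X i F) (S : Setup π m g n)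
    (hD : 0 < π.det 0) : m.alt o X i F ≤ 0 := by
  rcases V.jumps S with h | ⟨-, h1, h2, h3⟩ | ⟨h1, h2, h3, h4⟩
  · exact h.le
  · exfalso
    obtain ⟨e0, e1, e2, e3, b1, b2, b3, b4⟩ := V.equations S
    obtain ⟨t1, t2, -, t3, -, -⟩ := S.tight_pos hD V.touch_F
    obtain ⟨-, -, -, -, t4, -⟩ := S.tight_pos hD V.touch_X
    have t3 := (t3 V.ess_F V.kind_αF).2
    have t4 := (t4 V.ess_X V.kind_αX).2
    have hq := S.two_le
    have hp := S.num.p_pos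
    have hd : π.det 1 = π.P 2 * π.Q 1 - π.P 1 * π.Q 2 := rfl
    rw [h1] at e1
    rw [h2] at e2
    rw [h3] at e3
    rw [e0, e1] at t3
    have c1 := mul_le_mul_of_nonneg_left (show π.Q 2 ≤ m.x X by linarith) S.P_one.le
    have c2 := mul_le_mul_of_nonneg_left
      (show m.x (m.φ⁻¹ F) ≤ π.P 2 - 1 - π.Q 2 by linarith) S.P_one.le
    have c3 := mul_le_mul_of_nonneg_left hq S.P_one.le
    linarith
  · rw [Dg.alt, h1, h2, h3, h4]; norm_num

theorem Vertex.alt_nonneg {o X i F : D} (V : Vertex m o X i F) (S : Setup π m g n)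
    (hD : π.det 0 < 0) : 0 ≤ m.alt o X i F := by
  rcases V.jumps S with h | ⟨h1, h2, h3, h4⟩ | ⟨-, h1, h2, h3⟩
  · exact h.ge
  · rw [Dg.alt, h1, h2, h3, h4]; norm_num
  · exfalso
    obtain ⟨e0, e1, e2, e3, b1, b2, b3, b4⟩ := V.equations S
    obtain ⟨t1, t2, -, t3, -, -⟩ := S.tight_neg hD V.touch_F
    obtain ⟨-, -, -, -, t4, -⟩ := S.tight_neg hD V.touch_X
    have t3 := (t3 V.ess_F V.kind_αF).2
    have t4 := (t4 V.ess_X V.kind_αX).2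
    have hq := S.two_le'
    have hp := S.num.p_pos
    have hd : π.det 1 = π.P 2 * π.Q 1 - π.P 1 * π.Q 2 := rfl
    rw [h1] at e1
    rw [h2] at e2
    rw [h3] at e3
    rw [e0, e1] at t3
    have c1 := mul_le_mul_of_nonneg_left (show m.x X ≤ π.Q 2 - 1 by linarith) S.P_one.le
    have c2 := mul_le_mul_of_nonneg_left
      (show π.P 2 - π.Q 2 ≤ m.x (m.φ⁻¹ F) by linarith) S.P_one.le
    have c3 := mul_le_mul_of_nonneg_left hq S.P_one.le
    linarith

theorem Setup.sum_lam (S : Setup π m g n) {k : ℕ} (hk : k < 3) (s : Finset D)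
    (hs : ∀ d ∈ s, m.kind d = k) (h1 : ∀ d ∈ s, m.φ d ∈ s) (h2 : ∀ d ∈ s, m.φ⁻¹ d ∈ s) :
    (∑ d ∈ s, m.lam d) * π.P k = s.card * π.Q k := by
  have h : ∑ d ∈ s, m.x (m.φ⁻¹ d) = ∑ d ∈ s, m.x d :=
    Finset.sum_nbij' (fun d => m.φ⁻¹ d) (fun d => m.φ d) h2 h1 (fun d _ => apply_pv _ _)
      (fun d _ => pv_apply _ _) (fun _ _ => rfl)
  have h3 : ∑ d ∈ s, m.x d = ∑ d ∈ s, (m.x (m.φ⁻¹ d) + π.Q k - m.lam d * π.P k) :=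
    Finset.sum_congr rfl fun d hd => by
      have := S.x_eq (d := d) (by rw [hs d hd]; exact hk)
      rwa [hs d hd] at this
  rw [Finset.sum_sub_distrib, Finset.sum_add_distrib, h, Finset.sum_const, nsmul_eq_mul,
    ← Finset.sum_mul] at h3
  linarith

theorem Setup.sum_lam_special (S : Setup π m g n) {k : ℕ} (hk : k < 2) :
    ∑ d ∈ Finset.univ.filter (fun d => m.kind d = k), m.lam d = 2 * π.Q k ∧
    ((Finset.univ.filter (fun d => m.kind d = k)).card : ℤ) = 2 * π.P k := by
  have hc : ((Finset.univ.filter (fun d => m.kind d = k)).card : ℤ) = 2 * π.P k := by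
    change (m.cnt k : ℤ) = _
    rcases (by omega : k = 0 ∨ k = 1) with rfl | rfl
    · rw [S.cnt_zero, S.N_zero]
    · rw [S.cnt_one, S.N_one]
  have hP : 0 < π.P k := by
    rcases (by omega : k = 0 ∨ k = 1) with rfl | rfl
    · exact S.P_zero
    · exact S.P_one
  have := S.sum_lam (k := k) (by omega) (Finset.univ.filter (fun d => m.kind d = k))
    (fun d hd => by simpa using hd)
    (fun d hd => by
      simp only [Finset.mem_filter, Finset.mem_univ, true_and] at hd ⊢
      rw [S.kind_φ (by omega), hd])
    (fun d hd => by
      simp only [Finset.mem_filter, Finset.mem_univ, true_and] at hd ⊢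
      rw [S.kind_pv (by omega), hd])
  rw [hc] at this
  refine ⟨mul_right_cancel₀ hP.ne' ?_, hc⟩
  rw [this]; ring

theorem Setup.false (S : Setup π m g n) : False := by
  classical
  have touch : ∀ d, m.kind d < 2 → m.Touch (m.α d) := fun d hd => by
    rcases (by omega : m.kind d = 0 ∨ m.kind d = 1) with h | h
    · exact S.touch_zero h
    · exact S.touch_one h
  obtain ⟨A, hA⟩ : ∃ A, A = Finset.univ.filter fun d => m.Touch d := ⟨_, rfl⟩
  obtain ⟨B, hB⟩ : ∃ B, B = Finset.univ.filter fun d => m.kind d < 2 := ⟨_, rfl⟩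
  obtain ⟨O, hO⟩ : ∃ O, O = Finset.univ.filter fun d => m.kind d = 0 := ⟨_, rfl⟩
  obtain ⟨I, hI⟩ : ∃ I, I = Finset.univ.filter fun d => m.kind d = 1 := ⟨_, rfl⟩
  have mA : ∀ d, d ∈ A ↔ m.Touch d := fun d => by rw [hA]; simp
  have mB : ∀ d, d ∈ B ↔ m.kind d < 2 := fun d => by rw [hB]; simp
  have mO : ∀ d, d ∈ O ↔ m.kind d = 0 := fun d => by rw [hO]; simp
  have mI : ∀ d, d ∈ I ↔ m.kind d = 1 := fun d => by rw [hI]; simp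
  have bij : ∀ f : D → ℤ, ∑ d ∈ B, f (m.φ (m.α d)) = ∑ d ∈ A, f d := fun f => by
    refine Finset.sum_nbij' (fun d => m.φ (m.α d)) (fun d => m.α (m.φ⁻¹ d)) ?_ ?_ ?_ ?_
      (fun _ _ => rfl)
    · intro d hd
      exact (mA _).2 (S.touch_φ (touch d ((mB d).1 hd)))
    · intro d hd
      exact (mB _).2 (S.touch_spec (S.touch_pv ((mA d).1 hd))).1
    · intro d _
      simp only [pv_apply, S.valid.inv]
    · intro d _
      simp only [apply_pv, S.valid.inv]
  have split : ∀ f : D → ℤ, ∑ d ∈ B, f d = ∑ d ∈ O, f d + ∑ d ∈ I, f d := fun f => by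
    rw [← Finset.sum_union]
    · refine Finset.sum_congr (Finset.ext fun d => ?_) fun _ _ => rfl
      rw [Finset.mem_union, mB, mO, mI]
      omega
    · exact Finset.disjoint_left.2 fun d h1 h2 => by
        rw [mO] at h1; rw [mI] at h2; omega
  obtain ⟨sO, cO⟩ := S.sum_lam_special (k := 0) (by omega)
  obtain ⟨sI, cI⟩ := S.sum_lam_special (k := 1) (by omega)
  rw [← hO] at sO cO
  rw [← hI] at sI cI
  have sA := S.sum_lam (k := 2) (by omega) A (fun d hd => ((mA d).1 hd).1)
    (fun d hd => (mA _).2 (S.touch_φ ((mA d).1 hd)))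
    (fun d hd => (mA _).2 (S.touch_pv ((mA d).1 hd)))
  have cA : (A.card : ℤ) = 2 * π.P 0 + 2 * π.P 1 := by
    have h1 := bij fun _ => 1
    have h2 := split fun _ => 1
    simp only [Finset.sum_const, nsmul_eq_mul, mul_one] at h1 h2
    rw [← h1, h2, cO, cI]
  have total : π.P 2 * ∑ d ∈ B, (m.lam d - m.lam (m.φ (m.α d))) = 2 * π.det 0 + 2 * π.det 1 := by
    rw [Finset.sum_sub_distrib, bij m.lam, split, sO, sI, Par.det, Par.det]
    rw [cA] at sA
    linear_combination -sA
  -- only essential corners contribute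
  have ess_only : ∀ s : Finset D, ∑ d ∈ s, (m.lam d - m.lam (m.φ (m.α d))) =
      ∑ d ∈ s.filter fun d => Ess m.φ m.α d, (m.lam d - m.lam (m.φ (m.α d))) := fun s => by
    rw [Finset.sum_filter]
    refine Finset.sum_congr rfl fun d _ => ?_
    by_cases h : Ess m.φ m.α d
    · rw [if_pos h]
    · rw [if_neg h, S.lam_smooth h]
  have shift : ∑ d ∈ I.filter (fun d => Ess m.φ m.α d), (m.lam d - m.lam (m.φ (m.α d))) =
      ∑ d ∈ O.filter (fun d => Ess m.φ m.α d), (m.lam (m.φ (m.α (m.φ (m.α d)))) -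
        m.lam (m.φ (m.α (m.φ (m.α (m.φ (m.α d))))))) := by
    symm
    refine Finset.sum_bij (fun d _ => m.φ (m.α (m.φ (m.α d)))) ?_ ?_ ?_ (fun _ _ => rfl)
    · intro d hd
      rw [Finset.mem_filter, mO] at hd
      obtain ⟨X, i, F, V⟩ := S.vertex hd.1 hd.2
      rw [V.next_o, V.next_X, Finset.mem_filter, mI]
      exact ⟨V.kind_i, V.ess_i⟩
    · intro d _ e _ h
      exact ((m.φ * m.α) * (m.φ * m.α)).injective h
    · intro i hi
      rw [Finset.mem_filter, mI] at hi
      have hpv : m.kind (m.φ⁻¹ i) = 1 := by rw [S.kind_pv (by omega), hi.1]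
      obtain ⟨o, X, F, V⟩ := S.vertex_of_one hi.1 hi.2 (S.touch_one hpv)
      exact ⟨o, by rw [Finset.mem_filter, mO]; exact ⟨V.kind_o, V.ess_o⟩,
        by rw [V.next_o, V.next_X]⟩
  rw [split, ess_only O, ess_only I, shift, ← Finset.sum_add_distrib] at total
  have hp := S.num.p_pos
  obtain ⟨o, ho⟩ := S.exists_kind (k := 0) (by omega)
  have alt : ∀ d ∈ O.filter (fun d => Ess m.φ m.α d), ∃ X i F, Vertex m d X i F ∧
      m.lam d - m.lam (m.φ (m.α d)) + (m.lam (m.φ (m.α (m.φ (m.α d)))) -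
        m.lam (m.φ (m.α (m.φ (m.α (m.φ (m.α d))))))) = m.alt d X i F := fun d hd => by
    rw [Finset.mem_filter, mO] at hd
    obtain ⟨X, i, F, V⟩ := S.vertex hd.1 hd.2
    exact ⟨X, i, F, V, by rw [V.next_o, V.next_X, V.next_i]; rfl⟩
  rcases lt_or_gt_of_ne S.num.ne_zero with hD | hD
  · have h1 := (S.tight_neg hD (S.touch_zero ho)).1
    have h2 := mul_nonneg hp.le (Finset.sum_nonneg fun d hd => by
      obtain ⟨X, i, F, V, h⟩ := alt d hd
      exact (V.alt_nonneg S hD).trans_eq h.symm)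
    linarith
  · have h1 := (S.tight_pos hD (S.touch_zero ho)).1
    have h2 := mul_nonpos_of_nonneg_of_nonpos hp.le (Finset.sum_nonpos fun d hd => by
      obtain ⟨X, i, F, V, h⟩ := alt d hd
      exact h.trans_le (V.alt_nonpos S hD))
    linarith

end Final

end

/-! ### Continued fractions -/

theorem cfQ_nonneg (l : List ℕ) : 0 ≤ cfQ l := by
  induction l with
  | nil => exact le_rfl
  | cons a l ih => rw [cfQ]; positivity

/-- The Möbius transformation attached to an initial segment of a continued fraction. -/
theorem exists_cfQ_append (l : List ℕ) (hl : ∀ x ∈ l, 0 < x) : ∃ α β γ δ : ℕ, 0 < γ ∧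
    (∀ m, l.head? = some m → 2 ≤ m → 0 < α ∧ α < γ ∧ β ≤ δ) ∧
    (α * δ - β * γ : ℤ) = (-1) ^ (l.length + 1) ∧
    ∀ t, cfQ (l ++ t) = (α + β * cfQ t) / (γ + δ * cfQ t) := by
  induction l with
  | nil => exact ⟨0, 1, 1, 0, by simp⟩
  | cons m l ih =>
    obtain ⟨α, β, γ, δ, h1, -, h2, h3⟩ := ih fun x hx => hl x (List.mem_cons_of_mem _ hx)
    have hm := hl m List.mem_cons_self
    refine ⟨γ, δ, m * γ + α, m * δ + β, by positivity, fun k hk h2 => ?_, ?_, fun t => ?_⟩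
    · obtain rfl : m = k := by simpa using hk
      exact ⟨h1, by nlinarith, by nlinarith⟩
    · rw [List.length_cons, pow_succ, ← h2]
      push_cast
      ring
    · have ht := cfQ_nonneg t
      have h4 : (0 : ℚ) < γ + δ * cfQ t := by positivity
      rw [List.cons_append, cfQ, h3]
      have h5 : (0 : ℚ) < m := by exact_mod_cast hm
      have h6 : (m + (α + β * cfQ t) / (γ + δ * cfQ t) : ℚ) ≠ 0 := by positivity
      have h7 : ((m * γ + α : ℕ) + (m * δ + β : ℕ) * cfQ t : ℚ) ≠ 0 := by
        push_cast; positivity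
      rw [one_div, inv_eq_iff_eq_inv, inv_div, eq_div_iff h4.ne', add_mul, div_mul_cancel₀ _ h4.ne']
      push_cast
      ring

theorem den_le_of_le {r s : ℚ} {A B : ℤ} (hB : 0 < B) (h : r.den * A - B * r.num = -1)
    (hs : s ≤ A / B) : (s.den : ℤ) ≤ B * -(r.den * s.num - s.den * r.num) := by
  have hB' : (0 : ℚ) < B := by exact_mod_cast hB
  rw [le_div_iff₀ hB', ← Rat.num_div_den s, div_mul_eq_mul_div,
    div_le_iff₀ (by exact_mod_cast s.den_pos)] at hs
  have hs' : s.num * B ≤ A * s.den := by exact_mod_cast hs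
  have := mul_le_mul_of_nonneg_left hs' (Int.natCast_nonneg r.den)
  linear_combination this + s.den * h

theorem den_le_of_ge {r s : ℚ} {A B : ℤ} (hB : 0 < B) (h : r.den * A - B * r.num = 1)
    (hs : A / B ≤ s) : (s.den : ℤ) ≤ B * (r.den * s.num - s.den * r.num) := by
  have hB' : (0 : ℚ) < B := by exact_mod_cast hB
  rw [div_le_iff₀ hB', ← Rat.num_div_den s, div_mul_eq_mul_div,
    le_div_iff₀ (by exact_mod_cast s.den_pos)] at hs
  have hs' : A * s.den ≤ s.num * B := by exact_mod_cast hs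
  have := mul_le_mul_of_nonneg_left hs' (Int.natCast_nonneg r.den)
  linear_combination this - s.den * h

/-- The data of `r = cfQ M` that matter: a residue `g` and bounds on the denominators of the
slopes in the intervals around `r`. -/
structure Slope (M : List ℕ) (n : ℕ) (r : ℚ) (g : ℤ) : Prop where
  nonneg : 0 ≤ r
  le_one : r ≤ 1
  g_pos : 0 < g
  g_lt : g < r.den
  dvd : (r.den : ℤ) ∣ g * r.num + 1
  two_le : 2 ≤ r.num
  two_le' : 2 ≤ r.den - r.num
  mem : ∀ s, memI1 M n s ∨ memI2 M n s →
    (s.den : ℤ) ≤ ((2 * n - 2) * r.den + g) * (r.den * s.num - s.den * r.num) ∨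
    (s.den : ℤ) ≤ ((2 * n - 2) * r.den + (r.den - g)) * -(r.den * s.num - s.den * r.num)
  hat : ∀ s, memI1hat M s ∨ memI2hat M s →
    (s.den : ℤ) ≤ g * (r.den * s.num - s.den * r.num) ∨
    (s.den : ℤ) ≤ (r.den - g) * -(r.den * s.num - s.den * r.num)

set_option maxHeartbeats 1000000 in
theorem exists_slope {M : List ℕ} {m n : ℕ} {r : ℚ} (hMlen : 2 ≤ M.length)
    (hMpos : ∀ x ∈ M, 0 < x) (hMlast : 2 ≤ M.getLast!) (hm : M.head? = some m) (hn : 2 ≤ n)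
    (hr : r = cfQ M) (hm2 : 2 ≤ m) : ∃ g, Slope M n r g := by
  have hne : M ≠ [] := by rintro rfl; simp at hMlen
  obtain ⟨L, a, rfl⟩ : ∃ L a, M = L ++ [a] :=
    ⟨M.dropLast, M.getLast hne, (List.dropLast_append_getLast hne).symm⟩
  have hlast : (L ++ [a]).getLast! = a := by simp
  obtain ⟨l, rfl⟩ : ∃ l, L = m :: l := by
    cases L with
    | nil => simp at hMlen
    | cons x l => simp at hm; exact ⟨l, by rw [hm]⟩
  rw [hlast] at hMlast
  obtain ⟨α, β, γ, δ, h1, h2, h3, h4⟩ := exists_cfQ_append (m :: l) fun x hx =>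
    hMpos x (by simp at hx ⊢; tauto)
  obtain ⟨hα, hαγ, hβδ⟩ := h2 m rfl hm2
  have hlen : ((m :: l) ++ [a]).length = (m :: l).length + 1 := by simp
  have hdrop : ((m :: l) ++ [a]).dropLast = m :: l := List.dropLast_concat
  obtain ⟨p, hp⟩ : ∃ p : ℤ, p = a * γ + δ := ⟨_, rfl⟩
  obtain ⟨q, hq⟩ : ∃ q : ℤ, q = a * α + β := ⟨_, rfl⟩
  have za : (2 : ℤ) ≤ a := by exact_mod_cast hMlast
  have zγ : (0 : ℤ) < γ := by exact_mod_cast h1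
  have zα : (1 : ℤ) ≤ α := by exact_mod_cast hα
  have zαγ : (α : ℤ) + 1 ≤ γ := by exact_mod_cast hαγ
  have zβδ : (β : ℤ) ≤ δ := by exact_mod_cast hβδ
  have zn : (2 : ℤ) ≤ n := by exact_mod_cast hn
  have zβ : (0 : ℤ) ≤ β := Int.natCast_nonneg _
  have zδ : (0 : ℤ) ≤ δ := Int.natCast_nonneg _
  have hp0 : 0 < p := by rw [hp]; positivity
  have hγp : (γ : ℤ) < p := by nlinarith
  have hq2 : 2 ≤ q := by nlinarith
  have hpq : 2 ≤ p - q := by nlinarith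
  have det : p * α - γ * q = (-1) ^ ((m :: l).length + 1) := by
    rw [← h3, hp, hq]; ring
  have hrq : r = (q : ℚ) / (p : ℚ) := by
    rw [hr, h4, hp, hq]
    have : (a : ℚ) ≠ 0 := by have : a ≠ 0 := by omega
                             exact_mod_cast this
    simp only [cfQ, add_zero, mul_one_div]
    push_cast
    field_simp
  have hcop : Nat.Coprime q.natAbs p.natAbs := by
    rw [← Int.isCoprime_iff_nat_coprime]
    rcases neg_one_pow_eq_or ℤ ((m :: l).length + 1) with h | h
    · exact ⟨-γ, α, by rw [h] at det; linarith⟩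
    · exact ⟨γ, -α, by rw [h] at det; linarith⟩
  have hnum : r.num = q := by rw [hrq]; exact Rat.num_div_eq_of_coprime hp0 hcop
  have hden : (r.den : ℤ) = p := by rw [hrq]; exact Rat.den_div_eq_of_coprime hp0 hcop
  have hr0 : 0 ≤ r := by rw [hr]; exact cfQ_nonneg _
  have hr1 : r ≤ 1 := by
    rw [← Rat.num_le_denom_iff, hnum, hden]; linarith
  have c1 : cfQ (m :: l) = ((α : ℤ) : ℚ) / ((γ : ℤ) : ℚ) := by
    have := h4 []
    simpa [cfQ] using this
  have qa : ((a - 1 : ℕ) : ℚ) = a - 1 := by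
    rw [Nat.cast_sub (by omega)]; simp
  have qa0 : (0 : ℚ) < a - 1 := by
    have : (2 : ℚ) ≤ a := by exact_mod_cast hMlast
    linarith
  have qn : ((2 * n - 2 : ℕ) : ℚ) = 2 * n - 2 := by
    rw [Nat.cast_sub (by omega)]; push_cast; ring
  have qn0 : (0 : ℚ) < 2 * n - 2 := by
    have : (2 : ℚ) ≤ n := by exact_mod_cast hn
    linarith
  have frac : ∀ {x y : ℚ}, y ≠ 0 →
      (α + β * (x / y)) / (γ + δ * (x / y)) = (α * y + β * x) / (γ * y + δ * x) := by
    intro x y hy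
    rw [← mul_div_assoc, ← mul_div_assoc, ← mul_div_mul_right _ _ hy, add_mul, add_mul,
      div_mul_cancel₀ _ hy, div_mul_cancel₀ _ hy]
  have c2 : cfQ (m :: l ++ [a - 1]) = ((q - α : ℤ) : ℚ) / ((p - γ : ℤ) : ℚ) := by
    rw [h4, cfQ, cfQ, add_zero, qa, frac qa0.ne', hp, hq]
    push_cast
    congr 1 <;> ring
  have c3 : cfQ (m :: l ++ [a - 1, 2]) = ((2 * q - α : ℤ) : ℚ) / ((2 * p - γ : ℤ) : ℚ) := by
    have h5 : (a - 1) * 2 + 1 ≠ (0 : ℚ) := by linarith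
    have h6 : cfQ [a - 1, 2] = 2 / ((a - 1) * 2 + 1) := by
      simp only [cfQ, qa]
      push_cast
      have : (a - 1 + 1 / (2 + 0) : ℚ) ≠ 0 := by linarith
      rw [div_eq_div_iff this h5]
      ring
    rw [h4, h6, frac h5, hp, hq]
    push_cast
    congr 1 <;> ring
  have c4 : cfQ (m :: l ++ [a] ++ [2 * n - 2]) =
      (((2 * n - 2) * q + α : ℤ) : ℚ) / (((2 * n - 2) * p + γ : ℤ) : ℚ) := by
    have h5 : (a * (2 * n - 2) + 1 : ℚ) ≠ 0 := by positivity
    have h6 : cfQ [a, 2 * n - 2] = (2 * n - 2) / (a * (2 * n - 2) + 1) := by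
      have : (a + 1 / (2 * n - 2 + 0) : ℚ) ≠ 0 := by rw [add_zero]; positivity
      rw [cfQ, cfQ, cfQ, qn, div_eq_div_iff this h5, add_zero, mul_add (2 * (n : ℚ) - 2),
        mul_one_div_cancel qn0.ne']
      ring
    rw [List.append_assoc, List.singleton_append, h4, h6, frac h5, hp, hq]
    push_cast
    congr 1 <;> ring
  have pn : 2 * p ≤ (2 * n - 2) * p := by nlinarith
  have swap : ∀ {A B y D : ℤ}, 0 < A → A ≤ B → 0 < y → y ≤ A * D → y ≤ B * D := by
    intro A B y D hA hAB hy h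
    have : 0 < D := (mul_pos_iff_of_pos_left hA).1 (hy.trans_le h)
    exact h.trans (mul_le_mul_of_nonneg_right hAB this.le)
  have sd : ∀ s : ℚ, (0 : ℤ) < s.den := fun s => by exact_mod_cast s.den_pos
  by_cases hev : Even ((m :: l) ++ [a]).length
  · have hev' := hev
    rw [hlen] at hev'
    rw [hev'.neg_one_pow] at det
    refine ⟨γ, hr0, hr1, zγ, by rwa [hden], ⟨α, by rw [hnum, hden]; linarith⟩, by rwa [hnum],
      by rwa [hnum, hden], fun s hs => ?_, fun s hs => ?_⟩
    · rw [memI1, memI2, if_pos hev, if_pos hev, hlast, hdrop, c3, c4] at hs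
      rcases hs with ⟨-, hs⟩ | ⟨hs, -⟩
      · right
        have := den_le_of_le (r := r) (by linarith) (by rw [hnum, hden]; linarith) hs
        rw [hden, hnum] at this ⊢
        exact swap (by linarith) (by linarith) (sd s) this
      · left
        have := den_le_of_ge (r := r) (by linarith) (by rw [hnum, hden]; linarith) hs.le
        rwa [hden, hnum] at this ⊢
    · rw [memI1hat, memI2hat, if_pos hev, if_pos hev, hlast, hdrop, c1, c2] at hs
      rcases hs with ⟨-, hs⟩ | ⟨hs, -⟩
      · right
        have := den_le_of_le (r := r) (by linarith) (by rw [hnum, hden]; linarith) hs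
        rwa [hden, hnum] at this ⊢
      · left
        have := den_le_of_ge (r := r) (by linarith) (by rw [hnum, hden]; linarith) hs
        rwa [hden, hnum] at this ⊢
  · have hev' := Nat.not_even_iff_odd.1 hev
    rw [hlen] at hev'
    rw [hev'.neg_one_pow] at det
    refine ⟨p - γ, hr0, hr1, by linarith, by rw [hden]; linarith,
      ⟨q - α, by rw [hnum, hden]; linarith⟩, by rwa [hnum],
      by rwa [hnum, hden], fun s hs => ?_, fun s hs => ?_⟩
    · rw [memI1, memI2, if_neg hev, if_neg hev, hlast, hdrop, c3, c4] at hs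
      rcases hs with ⟨-, hs⟩ | ⟨hs, -⟩
      · right
        have := den_le_of_le (r := r) (by linarith) (by rw [hnum, hden]; linarith) hs.le
        rw [hden, hnum] at this ⊢
        rwa [sub_sub_cancel]
      · left
        have := den_le_of_ge (r := r) (by linarith) (by rw [hnum, hden]; linarith) hs
        rw [hden, hnum] at this ⊢
        exact swap (by linarith) (by linarith) (sd s) this
    · rw [memI1hat, memI2hat, if_neg hev, if_neg hev, hlast, hdrop, c1, c2] at hs
      rcases hs with ⟨-, hs⟩ | ⟨hs, -⟩
      · right
        have := den_le_of_le (r := r) (by linarith) (by rw [hnum, hden]; linarith) hs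
        rw [hden, hnum] at this ⊢
        rwa [sub_sub_cancel]
      · left
        have := den_le_of_ge (r := r) (by linarith) (by rw [hnum, hden]; linarith) hs
        rwa [hden, hnum] at this ⊢

theorem not_isConj {M : List ℕ} {n : ℕ} {r s s' : ℚ} {g : ℤ} (R : Slope M n r g) (hn : 2 ≤ n)
    (hs0 : 0 ≤ s) (hs1 : s ≤ 1) (hs0' : 0 ≤ s') (hs1' : s' ≤ 1) (hss : s ≠ s')
    (hs : memI1hat M s ∨ memI2hat M s) (hs' : memI1 M n s' ∨ memI2 M n s')
    (h : IsConj (heckQ r n (uWord s)) (heckQ r n (uWord s')) ∨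
      IsConj (heckQ r n (uWord s)) ((heckQ r n (uWord s'))⁻¹)) : False := by
  obtain ⟨c, g', sg', x', t, ⟨D, _, _, m, L, hv, hL, hc⟩, hc0, hc1⟩ :=
    exists_ex_of_isConj (by omega) R.nonneg R.le_one hs0 hs1 hs0' hs1' h
  have hd : ∀ t : ℚ, (0 : ℤ) < t.den := fun t => by exact_mod_cast t.den_pos
  have hd' := s'.den_pos
  obtain ⟨m₁, v₁, a₁, b₁⟩ := hv.close hL (by positivity) (by simp [par])
    (by simpa [par] using t) (by rw [hc 1 (by omega), hc1])
  obtain ⟨m₂, v₂, a₂, b₂, red⟩ := v₁.exists_reduced (by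
    have := r.den_pos
    simp [par]; omega)
  have rd := hd r
  have rg := R.g_pos
  have rg' := R.g_lt
  have zn : (2 : ℤ) ≤ n := by exact_mod_cast hn
  have sign : ∀ {A B y z : ℤ}, 0 < A → 0 < B → 0 < y → (y ≤ A * z ∨ y ≤ B * -z) →
      z ≠ 0 ∧ (0 < z → y - r.den < A * z) ∧ (z < 0 → y - r.den < B * -z) := by
    intro A B y z hA hB hy h
    rcases h with h | h
    · have : 0 < z := (mul_pos_iff_of_pos_left hA).1 (hy.trans_le h)
      exact ⟨this.ne', fun _ => by linarith, fun h' => absurd h' this.not_gt⟩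
    · have : 0 < -z := (mul_pos_iff_of_pos_left hB).1 (hy.trans_le h)
      exact ⟨by omega, fun h' => by omega, fun _ => by linarith⟩
  obtain ⟨e1, e2, e3⟩ := sign rg (by linarith) (hd s) (R.hat s hs)
  have pn : 0 ≤ (2 * (n : ℤ) - 2) * r.den := by nlinarith
  obtain ⟨f1, f2, f3⟩ := sign (by linarith) (by linarith) (hd s') (R.mem s' hs')
  refine Setup.false (π := par n r s s') (m := m₂) (g := g) (n := n) ⟨v₂, red,
    ⟨rg, rg', R.dvd, hn, rfl, ?_, e1, f1, e2, e3, f2, f3⟩, ?_, ?_, ?_, hd s, hd s', ?_, ?_,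
    R.two_le, R.two_le', ?_⟩
  · simp [Par.det]
  · simp [par]
  · simp [par]
  · simp [par]
  · rw [a₂, a₁, hc 0 (by omega), hc0]; simp [par]
  · rw [b₂, b₁]; simp [par]
  · intro he
    refine hss (Rat.eq_iff_mul_eq_mul.2 ?_)
    simp only [par] at he
    simp at he
    linarith

theorem cfQ_cons_le_one {m : ℕ} (hm : 0 < m) (l : List ℕ) : cfQ (m :: l) ≤ 1 := by
  have h1 := cfQ_nonneg l
  have h2 : (1 : ℚ) ≤ m := by exact_mod_cast hm
  rw [cfQ, div_le_one (by linarith)]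
  linarith

theorem mem_unit {M : List ℕ} {m n : ℕ} (hMlen : 2 ≤ M.length) (hm : M.head? = some m)
    (hm0 : 0 < m) {s : ℚ} (hs : memI1 M n s ∨ memI2 M n s) : 0 ≤ s ∧ s ≤ 1 := by
  obtain ⟨l, rfl⟩ : ∃ l, M = m :: l := by
    cases M with
    | nil => simp at hm
    | cons x l => simp at hm; exact ⟨l, by rw [hm]⟩
  obtain ⟨x, l, rfl⟩ := List.exists_cons_of_ne_nil (l := l) (by rintro rfl; simp at hMlen)
  rw [memI1, memI2, List.dropLast_cons_cons, List.cons_append, List.cons_append] at hs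
  split_ifs at hs
  · rcases hs with h | h
    · exact ⟨h.1, h.2.trans (cfQ_cons_le_one hm0 _)⟩
    · exact ⟨(cfQ_nonneg _).trans h.1.le, h.2⟩
  · rcases hs with h | h
    · exact ⟨h.1, h.2.le.trans (cfQ_cons_le_one hm0 _)⟩
    · exact ⟨(cfQ_nonneg _).trans h.1, h.2⟩

/-- Lemma 3.2: if `m ≥ 2` and `s ≠ s'` in `I₁(r;n) ∪ I₂(r;n)` are such that
`u_s` is conjugate in `Heck(r;n)` to `u_{s'}^{±1}`, then neither `s` nor `s'`
belongs to `I₁(r) ∪ I₂(r)`. -/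
theorem statement9
    (M : List ℕ) (m n : ℕ) (r : ℚ)
    (hMlen : 2 ≤ M.length) (hMpos : ∀ x ∈ M, 0 < x) (hMlast : 2 ≤ M.getLast!)
    (hm : M.head? = some m) (hn : 2 ≤ n) (hr : r = cfQ M)
    (hm2 : 2 ≤ m)
    (s s' : ℚ) (hss' : s ≠ s')
    (hs : memI1 M n s ∨ memI2 M n s) (hs' : memI1 M n s' ∨ memI2 M n s')
    (hconj : IsConj (heckQ r n (uWord s)) (heckQ r n (uWord s')) ∨
      IsConj (heckQ r n (uWord s)) ((heckQ r n (uWord s'))⁻¹)) :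
    ¬ (memI1hat M s ∨ memI2hat M s) ∧ ¬ (memI1hat M s' ∨ memI2hat M s') := by
  obtain ⟨g, R⟩ := exists_slope hMlen hMpos hMlast hm hn hr hm2
  obtain ⟨h0, h1⟩ := mem_unit hMlen hm (by omega) hs
  obtain ⟨h0', h1'⟩ := mem_unit hMlen hm (by omega) hs'
  refine ⟨fun h => not_isConj R hn h0 h1 h0' h1' hss' h hs' hconj,
    fun h => not_isConj R hn h0' h1' h0 h1 hss'.symm h hs ?_⟩
  refine hconj.imp IsConj.symm fun hc => ?_
  obtain ⟨c, hc⟩ := isConj_iff.1 hc.symm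
  exact isConj_iff.2 ⟨c, by rw [← hc]; group⟩

end Heckoid
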